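/- arXiv:1407.2861 — 5 statements merged into one kernel-verified Lean document; each statement's English description precedes it below -/
import Mathlib

section
/- Let R_n*(Q) denote the set of monic integer polynomials of degree n and height at most Q that are reducible over ℚ. Then for each fixed n ≥ 3 there is a positive constant υ_n, depending only on n, such that #R_n*(Q)/Q^{n−1} → υ_n as Q → ∞; and for n = 2, #R_2*(Q)/(2Q ln Q) → 1 as Q → ∞. -/
open Filter

/-- `R_n^*(Q)`: the set of monic integer polynomials of degree `n` and height at most `Q`
that are reducible, i.e. factor as a product of two integer polynomials of degree `≥ 1`. -/
def ReducibleMonicSet (n : ℕ) (Q : ℝ) : Set (Polynomial ℤ) :=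
  {p | p.Monic ∧ p.natDegree = n ∧ (∀ i, (|p.coeff i| : ℝ) ≤ Q) ∧
    ∃ q r : Polynomial ℤ, 1 ≤ q.natDegree ∧ 1 ≤ r.natDegree ∧ p = q * r}

namespace RMC
open Polynomial

/-- Gelfond constant. -/
noncomputable def gc (n : ℕ) : ℝ := 2 ^ n * (n + 1)

lemma gc_ge_one (n : ℕ) : 1 ≤ gc n := by
  unfold gc
  have h1 : (1:ℝ) ≤ 2 ^ n := one_le_pow₀ (by norm_num)
  have h2 : (1:ℝ) ≤ n + 1 := by
    have : (0:ℝ) ≤ n := Nat.cast_nonneg n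
    linarith
  nlinarith

lemma gelfond (n : ℕ) (g h : ℝ[X]) (hd : g.natDegree + h.natDegree ≤ n) (B : ℝ)
    (hB : ∀ k, |(g * h).coeff k| ≤ B) (i j : ℕ) :
    |g.coeff i| * |h.coeff j| ≤ gc n * B := by
  set g' : ℂ[X] := g.map (algebraMap ℝ ℂ) with hg'
  set h' : ℂ[X] := h.map (algebraMap ℝ ℂ) with hh'
  have hB0 : 0 ≤ B := (abs_nonneg _).trans (hB 0)
  have hgd : g'.natDegree = g.natDegree := natDegree_map _
  have hhd : h'.natDegree = h.natDegree := natDegree_map _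
  have e1 : |g.coeff i| = ‖g'.coeff i‖ := by simp [hg']
  have e2 : |h.coeff j| = ‖h'.coeff j‖ := by simp [hh']
  have k1 := g'.norm_coeff_le_choose_mul_mahlerMeasure i
  have k2 := h'.norm_coeff_le_choose_mul_mahlerMeasure j
  have k1' : ((g'.natDegree).choose i : ℝ) ≤ 2 ^ g.natDegree := by
    rw [hgd]; exact_mod_cast Nat.choose_le_two_pow _ _
  have k2' : ((h'.natDegree).choose j : ℝ) ≤ 2 ^ h.natDegree := by
    rw [hhd]; exact_mod_cast Nat.choose_le_two_pow _ _
  have k3 : (g' * h').mahlerMeasure ≤ (n + 1) * B := by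
    refine (mahlerMeasure_le_sum_norm_coeff _).trans ?_
    rw [Polynomial.sum_def]
    have : ∀ k ∈ (g' * h').support, ‖(g' * h').coeff k‖ ≤ B := by
      intro k _
      have : (g' * h').coeff k = (((g * h).coeff k : ℝ) : ℂ) := by
        rw [hg', hh', ← Polynomial.map_mul, coeff_map]; rfl
      rw [this, Complex.norm_real, Real.norm_eq_abs]
      exact hB k
    refine (Finset.sum_le_card_nsmul _ _ _ this).trans ?_
    rw [nsmul_eq_mul]
    gcongr
    have h1 := (g' * h').card_supp_le_succ_natDegree
    have h2 := natDegree_mul_le (p := g') (q := h')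
    rw [hgd, hhd] at h2
    exact_mod_cast (by omega : (g' * h').support.card ≤ n + 1)
  rw [mahlerMeasure_mul] at k3
  have m1 := g'.mahlerMeasure_nonneg
  have m2 := h'.mahlerMeasure_nonneg
  calc |g.coeff i| * |h.coeff j| ≤ (2 ^ g.natDegree * g'.mahlerMeasure) *
        (2 ^ h.natDegree * h'.mahlerMeasure) := by
        rw [e1, e2]
        gcongr
        · exact k1.trans (by gcongr)
        · exact k2.trans (by gcongr)
    _ = 2 ^ (g.natDegree + h.natDegree) * (g'.mahlerMeasure * h'.mahlerMeasure) := by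
        rw [pow_add]; ring
    _ ≤ 2 ^ n * ((n + 1) * B) := by
        gcongr
        norm_num
    _ = gc n * B := by unfold gc; ring

lemma gelfond_int (n : ℕ) (g h : ℤ[X]) (hd : g.natDegree + h.natDegree ≤ n) (B : ℝ)
    (hB : ∀ k, (|(g * h).coeff k| : ℝ) ≤ B) (i j : ℕ) :
    (|g.coeff i| : ℝ) * (|h.coeff j| : ℝ) ≤ gc n * B := by
  have := gelfond n (g.map (Int.castRingHom ℝ)) (h.map (Int.castRingHom ℝ))
    (le_trans (by gcongr <;> exact natDegree_map_le) hd) B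
    (by intro k; rw [← Polynomial.map_mul, coeff_map]; exact hB k) i j
  simpa using this

/-- monic integer polynomials of degree `m` with coefficients bounded by `B` -/
def MB (m : ℕ) (B : ℝ) : Set ℤ[X] := {p | p.Monic ∧ p.natDegree = m ∧ ∀ i, (|p.coeff i| : ℝ) ≤ B}

lemma MB_sub_inj (m : ℕ) : Set.InjOn (fun (p : ℤ[X]) (i : Fin m) => p.coeff i)
    {p | p.Monic ∧ p.natDegree = m} := by
  rintro p ⟨hp, hpd⟩ q ⟨hq, hqd⟩ h
  ext k
  rcases lt_trichotomy k m with hk | hk | hk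
  · exact congrFun h ⟨k, hk⟩
  · subst hk
    have h1 := hp.coeff_natDegree
    have h2 := hq.coeff_natDegree
    rw [hpd] at h1; rw [hqd] at h2; rw [h1, h2]
  · rw [coeff_eq_zero_of_natDegree_lt (by omega), coeff_eq_zero_of_natDegree_lt (by omega)]

lemma MB_count (m : ℕ) (B : ℝ) (hB0 : 0 ≤ B) : (MB m B).Finite ∧ ((MB m B).ncard : ℝ) ≤ (3 * B) ^ m := by
  by_cases hB : B < 1
  · have : MB m B = ∅ := by
      ext p
      simp only [Set.mem_empty_iff_false, iff_false]
      rintro ⟨h1, h2, h3⟩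
      have := h3 p.natDegree
      rw [h1.coeff_natDegree] at this
      simp at this
      linarith
    rw [this]
    refine ⟨Set.finite_empty, ?_⟩
    simp only [Set.ncard_empty, Nat.cast_zero]
    positivity
  push Not at hB
  set F : Finset (Fin m → ℤ) := Fintype.piFinset (fun _ => Finset.Icc (-⌊B⌋) ⌊B⌋) with hF
  have hmaps : Set.MapsTo (fun (p : ℤ[X]) (i : Fin m) => p.coeff i) (MB m B) F := by
    rintro p ⟨_, _, h3⟩
    simp only [hF, Finset.mem_coe, Fintype.mem_piFinset, Finset.mem_Icc]
    intro i
    have := h3 i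
    rw [← abs_le, Int.le_floor]
    exact_mod_cast this
  have hinj : Set.InjOn (fun (p : ℤ[X]) (i : Fin m) => p.coeff i) (MB m B) :=
    (MB_sub_inj m).mono (by intro p hp; exact ⟨hp.1, hp.2.1⟩)
  have hcard : (F.card : ℝ) ≤ (3 * B) ^ m := by
    rw [hF, Fintype.card_piFinset]
    simp only [Int.card_Icc, Finset.prod_const, Finset.card_univ, Fintype.card_fin, Nat.cast_pow]
    gcongr
    have h0 : 0 ≤ ⌊B⌋ := Int.floor_nonneg.2 (by linarith)
    have h1 : (⌊B⌋ : ℝ) ≤ B := Int.floor_le B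
    have : (((⌊B⌋ + 1 - -⌊B⌋).toNat : ℤ) : ℝ) = 2 * ⌊B⌋ + 1 := by
      rw [Int.toNat_of_nonneg (by omega)]; push_cast; ring
    rw [Int.cast_natCast] at this
    rw [this]; linarith
  refine ⟨Set.Finite.of_injOn hmaps hinj F.finite_toSet, ?_⟩
  refine le_trans ?_ hcard
  have := Set.ncard_le_ncard_of_injOn _ hmaps hinj F.finite_toSet
  rw [Set.ncard_coe_finset] at this
  exact_mod_cast this

/-- multiples of `g` -/
def AA (n : ℕ) (g : ℤ[X]) (Q : ℝ) : Set ℤ[X] := {p | p ∈ MB n Q ∧ g ∣ p}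

lemma AA_finite (n : ℕ) (g : ℤ[X]) (Q : ℝ) (hQ : 0 ≤ Q) : (AA n g Q).Finite :=
  (MB_count n Q hQ).1.subset fun _ h => h.1

lemma monic_of_mul {g h p : ℤ[X]} (hg : g.Monic) (hp : p.Monic) (e : p = g * h) : h.Monic :=
  hg.of_mul_monic_left (e ▸ hp)

lemma AA_bound {n d : ℕ} {g : ℤ[X]} (hg : g.Monic) (hd : g.natDegree = d) {H : ℝ}
    (hH1 : 1 ≤ H) {i : ℕ} (hH : H ≤ (|g.coeff i| : ℝ)) {Q : ℝ} (hQ : 0 ≤ Q) :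
    ((AA n g Q).ncard : ℝ) ≤ (3 * (gc n * Q / H)) ^ (n - d) := by
  have hgc := gc_ge_one n
  have hB : 0 ≤ gc n * Q / H := by positivity
  obtain ⟨hfin, hcard⟩ := MB_count (n - d) (gc n * Q / H) hB
  refine le_trans ?_ hcard
  have key : ∀ p ∈ AA n g Q, p = g * (p /ₘ g) := by
    rintro p ⟨_, hdvd⟩
    have := modByMonic_add_div p g
    rw [(modByMonic_eq_zero_iff_dvd hg).2 hdvd, zero_add] at this
    exact this.symm
  have hmaps : Set.MapsTo (fun p : ℤ[X] => p /ₘ g) (AA n g Q) (MB (n - d) (gc n * Q / H)) := by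
    intro p hp
    have e := key p hp
    obtain ⟨⟨hpm, hpd, hpB⟩, _⟩ := hp
    have hm := monic_of_mul hg hpm e
    have hdeg : n = d + (p /ₘ g).natDegree := by
      rw [← hpd, ← hd]
      nth_rewrite 1 [e]
      exact hg.natDegree_mul hm
    refine ⟨hm, by change (p /ₘ g).natDegree = _; omega, ?_⟩
    intro j
    rw [le_div_iff₀ (by positivity)]
    have := gelfond_int n g (p /ₘ g) (by omega) Q (by rw [← e]; exact hpB) i j
    refine le_trans ?_ this
    rw [mul_comm]
    gcongr
  have hinj : Set.InjOn (fun p : ℤ[X] => p /ₘ g) (AA n g Q) := by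
    intro p hp q hq h
    rw [key p hp, key q hq]
    simp only at h
    rw [h]
  exact_mod_cast Set.ncard_le_ncard_of_injOn _ hmaps hinj hfin

lemma AA_dom {n d : ℕ} {g : ℤ[X]} (hg : g.Monic) (hd : g.natDegree = d) (hd1 : 1 ≤ d) {H : ℝ}
    (hH1 : 1 ≤ H) {i : ℕ} (hH : H ≤ (|g.coeff i| : ℝ)) {Q : ℝ} (hQ : 0 ≤ Q) :
    ((AA n g Q).ncard : ℝ) ≤ (3 * (gc n * Q / H)) ^ (n - 1) := by
  have hgc := gc_ge_one n
  rcases (AA n g Q).eq_empty_or_nonempty with h | ⟨p, ⟨hpm, hpd, hpB⟩, hdvd⟩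
  · rw [h]; simp only [Set.ncard_empty, Nat.cast_zero]; positivity
  · refine (AA_bound hg hd hH1 hH hQ).trans ?_
    obtain ⟨h, e⟩ := hdvd
    have hm := monic_of_mul hg hpm e
    have hdeg : p.natDegree = g.natDegree + h.natDegree := by
      rw [e]; exact hg.natDegree_mul hm
    have := gelfond_int n g h (by omega) Q (by rw [← e]; exact hpB) i h.natDegree
    rw [hm.coeff_natDegree] at this
    simp only [Int.cast_one, abs_one, mul_one] at this
    have h1 : 1 ≤ gc n * Q / H := by
      rw [le_div_iff₀ (by positivity)]; linarith
    exact pow_le_pow_right₀ (by linarith) (by omega)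

lemma AA_small {n d : ℕ} {g : ℤ[X]} (hg : g.Monic) (hd : g.natDegree = d) (hd1 : 2 ≤ d)
    (hn : 2 ≤ n) :
    Tendsto (fun Q : ℝ => ((AA n g Q).ncard : ℝ) / Q ^ (n - 1)) atTop (nhds 0) := by
  have hgc := gc_ge_one n
  have hlim : Tendsto (fun Q : ℝ => (3 * gc n) ^ (n - 2) * Q⁻¹) atTop (nhds 0) := by
    simpa using tendsto_inv_atTop_zero.const_mul ((3 * gc n) ^ (n - 2))
  refine squeeze_zero' (Eventually.of_forall ?_) ?_ hlim
  · intro Q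
    by_cases hQ : 0 ≤ Q
    · positivity
    · have : AA n g Q = ∅ := by
        ext p
        simp only [Set.mem_empty_iff_false, iff_false]
        rintro ⟨⟨_, _, h⟩, _⟩
        exact hQ ((abs_nonneg _).trans (h 0))
      simp [this]
  · filter_upwards [eventually_ge_atTop 1] with Q hQ
    have h1 := AA_bound (n := n) (H := 1) (i := d) hg hd le_rfl
      (by rw [← hd, hg.coeff_natDegree]; simp) (Q := Q) (by linarith)
    rw [div_le_iff₀ (by positivity)]
    have e : Q ^ (n - 1) = Q ^ (n - 2) * Q := by rw [← pow_succ]; congr 1; omega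
    calc ((AA n g Q).ncard : ℝ) ≤ _ := h1
      _ ≤ (3 * (gc n * Q / 1)) ^ (n - 2) :=
        pow_le_pow_right₀ (by rw [div_one]; nlinarith) (by omega)
      _ = (3 * gc n) ^ (n - 2) * Q⁻¹ * Q ^ (n - 1) := by
        rw [e, div_one, ← mul_assoc, mul_pow]; field_simp

open scoped Pointwise

/-- polynomial of degree `< m` with given coefficients -/
noncomputable def PP {R : Type} [CommRing R] {m : ℕ} (v : Fin m → R) : R[X] :=
  ∑ i : Fin m, monomial (i : ℕ) (v i)

lemma PP_coeff {R : Type} [CommRing R] {m : ℕ} (v : Fin m → R) (k : ℕ) :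
    (PP v).coeff k = if h : k < m then v ⟨k, h⟩ else 0 := by
  unfold PP
  rw [finsetSum_coeff]
  simp only [coeff_monomial]
  split_ifs with h
  · rw [Finset.sum_eq_single ⟨k, h⟩]
    · simp
    · intro b _ hb
      rw [if_neg]
      intro h'
      exact hb (Fin.ext h')
    · simp
  · apply Finset.sum_eq_zero
    intro i _
    rw [if_neg]
    have := i.2
    omega

lemma PP_map {m : ℕ} (v : Fin m → ℤ) :
    PP (fun i => (v i : ℝ)) = (PP v).map (Int.castRingHom ℝ) := by
  ext k
  rw [coeff_map, PP_coeff, PP_coeff]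
  split_ifs <;> simp

lemma PP_degree {R : Type} [CommRing R] {m : ℕ} (v : Fin m → R) : (PP v).degree < m := by
  rw [degree_lt_iff_coeff_zero]
  intro k hk
  rw [PP_coeff, dif_neg (by omega)]

/-- monic polynomial with given coefficients -/
noncomputable def mk {R : Type} [CommRing R] {m : ℕ} (v : Fin m → R) : R[X] := X ^ m + PP v

lemma mk_monic {R : Type} [CommRing R] {m : ℕ} (v : Fin m → R) : (mk v).Monic :=
  monic_X_pow_add (PP_degree v)

lemma mk_natDegree {m : ℕ} (v : Fin m → ℤ) : (mk v).natDegree = m :=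
  natDegree_eq_of_degree_eq_some (by
    rw [mk, degree_add_eq_left_of_degree_lt (by rw [degree_X_pow]; exact PP_degree v), degree_X_pow])

lemma mk_coeff {m : ℕ} (v : Fin m → ℤ) (i : Fin m) : (mk v).coeff i = v i := by
  have := i.2
  rw [mk, coeff_add, PP_coeff, dif_pos i.2, coeff_X_pow, if_neg (by omega), zero_add]

lemma mk_surj {m : ℕ} {h : ℤ[X]} (h1 : h.Monic) (h2 : h.natDegree = m) :
    mk (fun i : Fin m => h.coeff i) = h := by
  apply MB_sub_inj m ⟨mk_monic _, mk_natDegree _⟩ ⟨h1, h2⟩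
  ext i
  exact mk_coeff _ i

lemma mk_inj {m : ℕ} : Function.Injective (mk : (Fin m → ℤ) → ℤ[X]) := by
  intro v w h
  ext i
  rw [← mk_coeff v i, ← mk_coeff w i, h]

/-- linear forms -/
noncomputable def LL (m : ℕ) (c : ℝ) (k : ℕ) : (Fin m → ℝ) →ₗ[ℝ] ℝ :=
  (lcoeff ℝ k).comp ((LinearMap.mulLeft ℝ (X + C c)).comp
    (∑ i : Fin m, (monomial (i : ℕ)).comp (LinearMap.proj i)))

lemma LL_apply (m : ℕ) (c : ℝ) (k : ℕ) (y : Fin m → ℝ) :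
    LL m c k y = ((X + C c) * PP y).coeff k := by
  simp [LL, PP, Finset.mul_sum]

lemma LL_int (m : ℕ) (c : ℤ) (k : ℕ) (v : Fin m → ℤ) :
    LL m c k (fun i => (v i : ℝ)) = ((((X + C c) * PP v).coeff k : ℤ) : ℝ) := by
  rw [LL_apply, PP_map]
  have : (X + C (c : ℝ)) * (PP v).map (Int.castRingHom ℝ) =
    ((X + C c) * PP v).map (Int.castRingHom ℝ) := by
    simp
  rw [this, coeff_map]; rfl

/-- the convex body -/
def KK (m : ℕ) (c : ℝ) : Set (Fin m → ℝ) := {y | ∀ k, |LL m c k y| ≤ 1}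

lemma KK_eq (m : ℕ) (c : ℝ) : KK m c = ⋂ k, (LL m c k) ⁻¹' (Set.Icc (-1) 1) := by
  ext y
  simp only [KK, Set.mem_ofPred_eq, Set.mem_iInter, Set.mem_preimage, Set.mem_Icc, abs_le]

lemma KK_convex (m : ℕ) (c : ℝ) : Convex ℝ (KK m c) := by
  rw [KK_eq]
  exact convex_iInter fun k => (convex_Icc _ _).linear_preimage _

lemma KK_closed (m : ℕ) (c : ℝ) : IsClosed (KK m c) := by
  rw [KK_eq]
  exact isClosed_iInter fun k => isClosed_Icc.preimage (LinearMap.continuous_of_finiteDimensional _)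

lemma KK_bdd (m : ℕ) (c : ℝ) : Bornology.IsBounded (KK m c) := by
  refine (Metric.isBounded_closedBall (x := 0) (r := gc (m + 1))).subset ?_
  intro y hy
  rw [mem_closedBall_zero_iff, pi_norm_le_iff_of_nonneg (by linarith [gc_ge_one (m + 1)])]
  intro i
  have h1 : (X + C c).natDegree = 1 := natDegree_X_add_C c
  have h2 : (PP y).natDegree ≤ m := natDegree_le_of_degree_le (PP_degree y).le
  have := gelfond (m + 1) (X + C c) (PP y) (by omega) 1
    (by intro k; rw [← LL_apply]; exact hy k) 1 i
  simpa [PP_coeff, coeff_C] using this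

lemma KK_zero (m : ℕ) (c : ℝ) : 0 ∈ KK m c := by
  intro k; simp

lemma KK_pos (m : ℕ) (c : ℝ) : 0 < MeasureTheory.volume.real (KK m c) := by
  have hsub : Metric.ball (0 : Fin m → ℝ) (1 / (1 + |c|)) ⊆ KK m c := by
    intro y hy k
    rw [mem_ball_zero_iff] at hy
    have hco : ∀ k, |(PP y).coeff k| ≤ ‖y‖ := by
      intro k
      rw [PP_coeff]
      split_ifs with h
      · exact norm_le_pi_norm y ⟨k, h⟩
      · simp
    have hy1 : (1 + |c|) * ‖y‖ ≤ 1 := by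
      rw [lt_div_iff₀ (by positivity)] at hy
      linarith
    have hc : |c * (PP y).coeff k| ≤ |c| * ‖y‖ := by
      rw [abs_mul]; gcongr; exact hco k
    rw [LL_apply, add_mul, coeff_add, coeff_C_mul]
    refine (abs_add_le _ _).trans ?_
    have : |(X * PP y).coeff k| ≤ ‖y‖ := by
      cases k with
      | zero => simp
      | succ k => rw [coeff_X_mul]; exact hco k
    linarith
  rw [MeasureTheory.measureReal_def]
  refine ENNReal.toReal_pos ?_ (KK_bdd m c).measure_lt_top.ne
  have := Metric.measure_ball_pos MeasureTheory.volume (0 : Fin m → ℝ)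
    (r := 1 / (1 + |c|)) (by positivity)
  exact (this.trans_le (MeasureTheory.measure_mono hsub)).ne'

/-- integer points -/
def SS (m : ℕ) (c : ℤ) (t : ℝ) : Set (Fin m → ℤ) :=
  {v | ∀ k, (|(((X + C c) * PP v).coeff k : ℤ)| : ℝ) ≤ t}

lemma SS_card (m : ℕ) (c : ℤ) (t : ℝ) (ht : 0 < t) :
    Nat.card ↑(KK m c ∩ t⁻¹ • (Submodule.span ℤ (Set.range (Pi.basisFun ℝ (Fin m))) :
      Set (Fin m → ℝ))) = (SS m c t).ncard := by
  have inj : Function.Injective (fun (v : Fin m → ℤ) => t⁻¹ • (fun i => (v i : ℝ))) := by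
    intro v w h
    ext i
    have := congrFun h i
    simpa [ht.ne'] using this
  rw [← Set.ncard_image_of_injective _ inj, ← Nat.card_coe_set_eq]
  congr 2
  ext x
  have hmem : ∀ v : Fin m → ℤ, (t⁻¹ • (fun i => (v i : ℝ))) ∈ KK m c ↔ v ∈ SS m c t := by
    intro v
    simp only [KK, SS, Set.mem_ofPred_eq, map_smul, LL_int, smul_eq_mul, abs_mul, abs_inv,
      abs_of_pos ht]
    refine forall_congr' fun k => ?_
    rw [inv_mul_le_iff₀ ht, mul_one]
  constructor
  · rintro ⟨h1, y, hy, rfl⟩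
    have hy' := (Module.Basis.mem_span_iff_repr_mem ℤ _ _).1 hy
    choose v hv using hy'
    have : y = fun i => (v i : ℝ) := by
      ext i; have := hv i; simpa using this.symm
    subst this
    exact ⟨v, (hmem v).1 h1, rfl⟩
  · rintro ⟨v, hv, rfl⟩
    refine ⟨(hmem v).2 hv, _, ?_, rfl⟩
    refine (Module.Basis.mem_span_iff_repr_mem ℤ _ _).2 ?_
    intro i
    exact ⟨v i, by simp⟩

lemma SS_lim (m : ℕ) (c : ℤ) : Tendsto (fun t : ℝ => ((SS m c t).ncard : ℝ) / t ^ m) atTop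
    (nhds (MeasureTheory.volume.real (KK m c))) := by
  have := tendsto_card_div_pow_atTop_volume' (KK m c) (KK_bdd m c) (KK_closed m c).measurableSet
    ((KK_convex m c).addHaar_frontier _) (by
      rintro x y hx hxy _ ⟨z, hz, rfl⟩
      refine ⟨(x / y) • z, (KK_convex m c).smul_mem_of_zero_mem (KK_zero m c) hz
        ⟨div_nonneg hx.le (hx.le.trans hxy), ?_⟩, ?_⟩
      · rw [div_le_one (by linarith)]; exact hxy
      · have : y ≠ 0 := by linarith
        simp only [smul_smul]
        congr 1; field_simp)
  refine this.congr' ?_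
  filter_upwards [eventually_gt_atTop 0] with t ht
  rw [SS_card m c t ht, Fintype.card_fin]

lemma SS_finite (m : ℕ) (c : ℤ) (t : ℝ) : (SS m c t).Finite := by
  set F : Finset (Fin m → ℤ) := Fintype.piFinset
    (fun _ => Finset.Icc (-⌊gc (m + 1) * t⌋) ⌊gc (m + 1) * t⌋) with hF
  refine F.finite_toSet.subset ?_
  intro v hv
  simp only [hF, Finset.mem_coe, Fintype.mem_piFinset, Finset.mem_Icc]
  intro i
  have h1 : (X + C c).natDegree = 1 := natDegree_X_add_C c
  have h2 : (PP v).natDegree ≤ m := natDegree_le_of_degree_le (PP_degree v).le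
  have := gelfond_int (m + 1) (X + C c) (PP v) (by omega) t hv 1 i
  rw [← abs_le, Int.le_floor]
  push_cast
  rw [PP_coeff, dif_pos i.2, coeff_add, coeff_X_one, coeff_C, if_neg one_ne_zero] at this
  simpa using this

lemma mul_mk_coeff {m : ℕ} (c : ℤ) (v : Fin m → ℤ) (k : ℕ) :
    ((X + C c) * mk v).coeff k = (if k = m + 1 then 1 else 0) + (if k = m then c else 0) +
      ((X + C c) * PP v).coeff k := by
  have : (X + C c) * mk v = X ^ (m + 1) + C c * X ^ m + (X + C c) * PP v := by
    rw [mk]; ring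
  rw [this, coeff_add, coeff_add, coeff_C_mul, coeff_X_pow, coeff_X_pow]
  simp

lemma mul_PP_coeff_top {m : ℕ} (c : ℤ) (v : Fin m → ℤ) :
    ((X + C c) * PP v).coeff (m + 1) = 0 := by
  rw [add_mul, coeff_add, coeff_C_mul, coeff_X_mul, PP_coeff, PP_coeff]
  simp

lemma AA_lin_eq (m : ℕ) (c : ℤ) (Q : ℝ) : (AA (m + 1) (X + C c) Q) =
    (fun v : Fin m → ℤ => (X + C c) * mk v) ''
      {v | ∀ k, (|((((X + C c) * mk v).coeff k : ℤ) : ℝ)|) ≤ Q} := by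
  have hg : (X + C c).Monic := monic_X_add_C c
  ext p
  constructor
  · rintro ⟨⟨hpm, hpd, hpB⟩, h, e⟩
    have hm := monic_of_mul hg hpm e
    have hdeg : p.natDegree = 1 + h.natDegree := by
      rw [e, hg.natDegree_mul hm, natDegree_X_add_C]
    have hs := mk_surj hm (show h.natDegree = m by omega)
    refine ⟨fun i => h.coeff i, ?_, ?_⟩
    · intro k
      rw [hs, ← e]; exact hpB k
    · simp only; rw [hs, e]
  · rintro ⟨v, hv, rfl⟩
    refine ⟨⟨hg.mul (mk_monic v), ?_, hv⟩, dvd_mul_right _ _⟩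
    simp only
    rw [hg.natDegree_mul (mk_monic v), natDegree_X_add_C, mk_natDegree]; omega

lemma AA_lin (m : ℕ) (c : ℤ) :
    Tendsto (fun Q : ℝ => ((AA (m + 1) (X + C c) Q).ncard : ℝ) / Q ^ m) atTop
    (nhds (MeasureTheory.volume.real (KK m c))) := by
  have hg : (X + C c).Monic := monic_X_add_C c
  have hinj : Function.Injective (fun v : Fin m → ℤ => (X + C c) * mk v) := by
    intro v w h
    exact mk_inj (mul_left_cancel₀ hg.ne_zero h)
  have hcard : ∀ Q, (AA (m + 1) (X + C c) Q).ncard =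
      ({v | ∀ k, (|((((X + C c) * mk v).coeff k : ℤ) : ℝ)|) ≤ Q} : Set (Fin m → ℤ)).ncard := by
    intro Q
    rw [AA_lin_eq, Set.ncard_image_of_injective _ hinj]
  set b : ℝ := |(c : ℝ)| with hb
  have hb0 : 0 ≤ b := abs_nonneg _
  have up : ∀ Q, 0 ≤ Q → (AA (m + 1) (X + C c) Q).ncard ≤ (SS m c (Q + b)).ncard := by
    intro Q hQ
    rw [hcard]
    refine Set.ncard_le_ncard ?_ (SS_finite _ _ _)
    intro v hv k
    have := hv k
    rw [mul_mk_coeff] at this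
    by_cases h1 : k = m + 1
    · rw [h1, mul_PP_coeff_top]; simp; positivity
    · rw [if_neg h1] at this
      split_ifs at this with h2
      · push_cast at this
        rw [abs_le] at this ⊢
        have h3 := neg_abs_le (c : ℝ)
        have h4 := le_abs_self (c : ℝ)
        constructor <;> linarith
      · simp only [zero_add] at this; linarith
  have lo : ∀ Q, 1 ≤ Q → (SS m c (Q + -b)).ncard ≤ (AA (m + 1) (X + C c) Q).ncard := by
    intro Q hQ
    have hfin := AA_finite (m + 1) (X + C c) Q (by linarith)
    rw [AA_lin_eq] at hfin
    rw [hcard]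
    refine Set.ncard_le_ncard ?_ (hfin.of_finite_image hinj.injOn)
    intro v hv k
    have := hv k
    rw [mul_mk_coeff]
    by_cases h1 : k = m + 1
    · rw [h1, mul_PP_coeff_top]; simp; linarith
    · rw [if_neg h1]
      split_ifs with h2
      · push_cast
        rw [abs_le] at this ⊢
        have h3 := neg_abs_le (c : ℝ)
        have h4 := le_abs_self (c : ℝ)
        constructor <;> linarith
      · simp only [zero_add]; linarith
  have ratio : ∀ s : ℝ, Tendsto (fun Q : ℝ => ((Q + s) / Q) ^ m) atTop (nhds 1) := by
    intro s
    have : Tendsto (fun Q : ℝ => (1 + s * Q⁻¹) ^ m) atTop (nhds ((1 + s * 0) ^ m)) :=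
      ((tendsto_inv_atTop_zero.const_mul s).const_add 1).pow m
    simp only [mul_zero, add_zero, one_pow] at this
    refine this.congr' ?_
    filter_upwards [eventually_gt_atTop 0] with Q hQ
    congr 1; field_simp
  have shift : ∀ s : ℝ, Tendsto (fun Q : ℝ => ((SS m c (Q + s)).ncard : ℝ) / Q ^ m) atTop
      (nhds (MeasureTheory.volume.real (KK m c))) := by
    intro s
    have h1 := ((SS_lim m c).comp (tendsto_atTop_add_const_right atTop s tendsto_id)).mul (ratio s)
    rw [mul_one] at h1
    refine h1.congr' ?_
    filter_upwards [eventually_gt_atTop 0, eventually_gt_atTop (-s)] with Q hQ hs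
    have : 0 < Q + s := by linarith
    simp only [Function.comp, id, div_pow]
    field_simp
  refine tendsto_of_tendsto_of_tendsto_of_le_of_le' (shift (-b)) (shift b) ?_ ?_
  · filter_upwards [eventually_ge_atTop 1] with Q hQ
    gcongr
    exact lo Q hQ
  · filter_upwards [eventually_ge_atTop 1] with Q hQ
    gcongr
    exact up Q (by linarith)

lemma summable_vec (d k : ℕ) (hdk : d < k) :
    Summable (fun v : Fin d → ℤ => (1 / max 1 ‖v‖) ^ k) := by
  set Lt := Submodule.span ℤ (Set.range (Pi.basisFun ℝ (Fin d))) with hLt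
  have hr : Module.finrank ℤ Lt = d := by
    rw [ZLattice.rank ℝ Lt]; simp
  have h1 : Summable fun z : Lt => ‖z‖⁻¹ ^ k := ZLattice.summable_norm_pow_inv Lt k (by omega)
  have hmem : ∀ v : Fin d → ℤ, (fun i => (v i : ℝ)) ∈ Lt := by
    intro v
    refine (Module.Basis.mem_span_iff_repr_mem ℤ _ _).2 ?_
    intro i
    exact ⟨v i, by simp⟩
  let f : (Fin d → ℤ) → Lt := fun v => ⟨fun i => (v i : ℝ), hmem v⟩
  have hf : Function.Injective f := by
    intro v w h
    ext i
    have := congrFun (congrArg Subtype.val h) i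
    simpa [f] using this
  have hn : ∀ v, ‖f v‖ = ‖v‖ := by
    intro v
    change ‖(fun i => (v i : ℝ))‖ = ‖v‖
    simp only [Pi.norm_def]
    congr 1
  have h2 := (h1.comp_injective hf).congr (g := fun v : Fin d → ℤ => ‖v‖⁻¹ ^ k)
    (by intro v; simp only [Function.comp, hn])
  have h3 : Summable (fun v : Fin d → ℤ => if v = 0 then (1:ℝ) else 0) :=
    summable_of_ne_finset_zero (s := {0}) (by intro v hv; simp at hv; simp [hv])
  refine Summable.of_nonneg_of_le (fun v => by positivity) ?_ (h2.add h3)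
  intro v
  by_cases hv : v = 0
  · subst hv
    simp
  · have : 0 < ‖v‖ := norm_pos_iff.2 hv
    rw [if_neg hv, add_zero, one_div]
    gcongr
    exact le_max_right _ _

lemma exists_coeff {d : ℕ} (v : Fin d → ℤ) : ∃ i, max 1 ‖v‖ ≤ (|(mk v).coeff i| : ℝ) := by
  by_cases h : ‖v‖ ≤ 1
  · refine ⟨(mk v).natDegree, ?_⟩
    rw [(mk_monic v).coeff_natDegree, max_eq_left h]
    simp
  · push Not at h
    by_contra hcon
    push Not at hcon
    have : ‖v‖ < ‖v‖ := by
      nth_rewrite 1 [pi_norm_lt_iff (by linarith)]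
      intro i
      have := hcon i
      rw [mk_coeff, max_eq_right h.le] at this
      rw [Int.norm_eq_abs]
      exact this
    exact lt_irrefl _ this

lemma small_of_subset {n : ℕ} {S : ℝ → Set ℤ[X]} {T : ℝ → Set ℤ[X]}
    (hT : ∀ Q, 0 ≤ Q → (T Q).Finite) (hST : ∀ Q, S Q ⊆ T Q)
    (h : Tendsto (fun Q : ℝ => ((T Q).ncard : ℝ) / Q ^ n) atTop (nhds 0)) :
    Tendsto (fun Q : ℝ => ((S Q).ncard : ℝ) / Q ^ n) atTop (nhds 0) := by
  refine squeeze_zero' ?_ ?_ h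
  · filter_upwards [eventually_ge_atTop 0] with Q hQ
    positivity
  · filter_upwards [eventually_ge_atTop 0] with Q hQ
    gcongr
    · exact hT Q hQ
    · exact hST Q

lemma pair_small {n : ℕ} (hn : 2 ≤ n) {g g' : ℤ[X]} (hg : g.Monic) (hg' : g'.Monic)
    (h1 : 1 ≤ g.natDegree) (h1' : 1 ≤ g'.natDegree) (hne : g ≠ g') :
    Tendsto (fun Q : ℝ => ((AA n g Q ∩ AA n g' Q).ncard : ℝ) / Q ^ (n - 1)) atTop (nhds 0) := by
  by_cases h2 : 2 ≤ g.natDegree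
  · exact small_of_subset (AA_finite n g) (fun Q => Set.inter_subset_left)
      (AA_small hg rfl h2 hn)
  by_cases h2' : 2 ≤ g'.natDegree
  · exact small_of_subset (AA_finite n g') (fun Q => Set.inter_subset_right)
      (AA_small hg' rfl h2' hn)
  have e := hg.eq_X_add_C (by omega)
  have e' := hg'.eq_X_add_C (by omega)
  set c := g.coeff 0
  set c' := g'.coeff 0
  have hcc : c ≠ c' := by rintro h; apply hne; rw [e, e', h]
  refine small_of_subset (T := fun Q => AA n (g * g') Q) (AA_finite n _) ?_
    (AA_small (hg.mul hg') rfl (by rw [hg.natDegree_mul hg']; omega) hn)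
  rintro Q p ⟨⟨hp, h, hh⟩, ⟨_, hp'⟩⟩
  refine ⟨hp, ?_⟩
  rw [hh]
  apply mul_dvd_mul_left
  have t : X + C c' = X - C (-c') := by simp
  rw [hh, e', t, dvd_iff_isRoot, IsRoot, eval_mul, e] at hp'
  rw [e', t, dvd_iff_isRoot, IsRoot]
  rcases mul_eq_zero.1 hp' with h3 | h3
  · exfalso
    simp at h3
    omega
  · exact h3

lemma AA_deg_one {n : ℕ} (hn : 1 ≤ n) {g : ℤ[X]} (hg : g.Monic) (h1 : g.natDegree = 1) :
    ∃ υ : ℝ, 0 < υ ∧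
      Tendsto (fun Q : ℝ => ((AA n g Q).ncard : ℝ) / Q ^ (n - 1)) atTop (nhds υ) := by
  obtain ⟨m, rfl⟩ : ∃ m, n = m + 1 := ⟨n - 1, by omega⟩
  rw [hg.eq_X_add_C h1]
  exact ⟨_, KK_pos m _, AA_lin m _⟩

lemma exists_monic {p q : ℤ[X]} (hp : p.Monic) (hq : q ∣ p) :
    ∃ q' : ℤ[X], q'.Monic ∧ q' ∣ p ∧ q'.natDegree = q.natDegree := by
  obtain ⟨r, hr⟩ := hq
  have h : q.leadingCoeff * r.leadingCoeff = 1 := by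
    rw [← leadingCoeff_mul, ← hr]; exact hp
  rcases Int.isUnit_iff.1 (IsUnit.of_mul_eq_one _ h) with h | h
  · exact ⟨q, h, ⟨r, hr⟩, rfl⟩
  · refine ⟨-q, ?_, ?_, natDegree_neg q⟩
    · rw [Monic, leadingCoeff_neg, h]; norm_num
    · rw [neg_dvd]; exact ⟨r, hr⟩

/-- index set -/
abbrev Idx (n : ℕ) : Type := Σ d : Fin (n / 2), (Fin ((d : ℕ) + 1) → ℤ)

lemma exists_idx {n : ℕ} {Q : ℝ} {p : ℤ[X]} (hp : p ∈ ReducibleMonicSet n Q) :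
    ∃ x : Idx n, mk x.2 ∣ p := by
  obtain ⟨hpm, hpd, _, q, r, hq, hr, e⟩ := hp
  have hq0 : q ≠ 0 := by rintro rfl; simp at hq
  have hr0 : r ≠ 0 := by rintro rfl; simp at hr
  have hdeg : p.natDegree = q.natDegree + r.natDegree := by rw [e, natDegree_mul hq0 hr0]
  have key : ∀ q : ℤ[X], q ∣ p → 1 ≤ q.natDegree → 2 * q.natDegree ≤ n →
      ∃ x : Idx n, mk x.2 ∣ p := by
    intro q hq h1 h2
    obtain ⟨q', m', d', e'⟩ := exists_monic hpm hq
    refine ⟨⟨⟨q.natDegree - 1, by omega⟩, fun i => q'.coeff i⟩, ?_⟩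
    simp only
    rw [mk_surj m' (by omega)]
    exact d'
  rcases le_total q.natDegree r.natDegree with h | h
  · exact key q ⟨r, e⟩ hq (by omega)
  · exact key r ⟨q, by rw [e, mul_comm]⟩ hr (by omega)

lemma idx_inj {n : ℕ} {x y : Idx n} (h : mk x.2 = mk y.2) : x = y := by
  obtain ⟨⟨d, hd⟩, v⟩ := x
  obtain ⟨⟨d', hd'⟩, v'⟩ := y
  simp only at h v v'
  have := congrArg natDegree h
  rw [mk_natDegree, mk_natDegree] at this
  obtain rfl : d = d' := by omega
  rw [mk_inj h]

lemma ncard_eq_tsum {α β : Type*} (R : Set α) (hR : R.Finite) (φ : α → β) :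
    (R.ncard : ℝ) = ∑' x, (({p | p ∈ R ∧ φ p = x} : Set α).ncard : ℝ) := by
  classical
  have h := Finset.card_eq_sum_card_image φ hR.toFinset
  rw [Set.ncard_eq_toFinset_card R hR, h, Nat.cast_sum]
  rw [tsum_eq_sum (s := hR.toFinset.image φ)]
  · apply Finset.sum_congr rfl
    intro x _
    congr 1
    rw [← Set.ncard_coe_finset]
    congr 1
    ext p
    simp
  · intro x hx
    have : ({p | p ∈ R ∧ φ p = x} : Set α) = ∅ := by
      ext p
      simp only [Set.mem_ofPred_eq, Set.mem_empty_iff_false, iff_false]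
      rintro ⟨h1, h2⟩
      apply hx
      rw [Finset.mem_image]
      exact ⟨p, by simpa using h1, h2⟩
    rw [this]; simp

theorem part1 (n : ℕ) (hn : 3 ≤ n) : ∃ υ : ℝ, 0 < υ ∧
      Tendsto (fun Q : ℝ => ((ReducibleMonicSet n Q).ncard : ℝ) / Q ^ (n - 1))
        atTop (nhds υ) := by
  classical
  have hgc := gc_ge_one n
  obtain ⟨e, he⟩ := Countable.exists_injective_nat (Idx n)
  let x0 : Idx n := ⟨⟨0, by omega⟩, fun _ => 0⟩
  have : Nonempty (Idx n) := ⟨x0⟩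
  have hφ : ∀ p : ℤ[X], (∃ x : Idx n, mk x.2 ∣ p) →
      ∃ x : Idx n, mk x.2 ∣ p ∧ ∀ y : Idx n, e y < e x → ¬ mk y.2 ∣ p := by
    intro p hp
    have hp' : ∃ k, ∃ x : Idx n, mk x.2 ∣ p ∧ e x = k := by
      obtain ⟨x, hx⟩ := hp
      exact ⟨_, x, hx, rfl⟩
    obtain ⟨x, hx, hxe⟩ := Nat.find_spec hp'
    refine ⟨x, hx, fun y hy hyp => ?_⟩
    rw [hxe] at hy
    exact Nat.find_min hp' hy ⟨y, hyp, rfl⟩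
  choose! φ hφ1 hφ2 using hφ
  have hRfin : ∀ Q, 0 ≤ Q → (ReducibleMonicSet n Q).Finite := fun Q hQ =>
    (MB_count n Q hQ).1.subset (fun p hp => ⟨hp.1, hp.2.1, hp.2.2.1⟩)
  let F : ℝ → Idx n → Set ℤ[X] := fun Q x => {p | p ∈ ReducibleMonicSet n Q ∧ φ p = x}
  have hdeg : ∀ x : Idx n, (mk x.2).natDegree = x.1 + 1 := fun x => mk_natDegree x.2
  have hFA : ∀ Q x, F Q x ⊆ AA n (mk x.2) Q := by
    rintro Q x p ⟨hp, rfl⟩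
    exact ⟨⟨hp.1, hp.2.1, hp.2.2.1⟩, hφ1 p (exists_idx hp)⟩
  have hAR : ∀ Q (x : Idx n), AA n (mk x.2) Q ⊆ ReducibleMonicSet n Q := by
    rintro Q x p ⟨⟨h1, h2, h3⟩, r, hr⟩
    refine ⟨h1, h2, h3, mk x.2, r, by rw [hdeg]; omega, ?_, hr⟩
    have hm := monic_of_mul (mk_monic x.2) h1 hr
    have : p.natDegree = (mk x.2).natDegree + r.natDegree := by
      rw [hr, (mk_monic x.2).natDegree_mul hm]
    rw [hdeg] at this
    have := x.1.2
    omega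
  let bound : Idx n → ℝ := fun x => (3 * gc n) ^ (n - 1) * (1 / max 1 ‖x.2‖) ^ (n - 1)
  have hbsum : Summable bound := by
    refine Summable.mul_left _ ?_
    rw [summable_sigma_of_nonneg (fun x => by positivity)]
    refine ⟨fun d => summable_vec _ _ ?_, Summable.of_finite⟩
    have := d.2
    omega
  have hbd : ∀ Q, 1 ≤ Q → ∀ x, ‖((F Q x).ncard : ℝ) / Q ^ (n - 1)‖ ≤ bound x := by
    intro Q hQ x
    obtain ⟨i, hi⟩ := exists_coeff x.2
    have h1 := AA_dom (n := n) (mk_monic x.2) (hdeg x) (by omega) (le_max_left _ _) hi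
      (Q := Q) (by linarith)
    have h2 : ((F Q x).ncard : ℝ) ≤ ((AA n (mk x.2) Q).ncard : ℝ) := by
      exact_mod_cast Set.ncard_le_ncard (hFA Q x) (AA_finite n _ Q (by linarith))
    rw [Real.norm_of_nonneg (by positivity), div_le_iff₀ (by positivity)]
    refine (h2.trans h1).trans (le_of_eq ?_)
    simp only [bound]
    rw [← mul_pow, ← mul_pow]
    congr 1; ring
  have hlim : ∀ x : Idx n, ∃ υ : ℝ, ((x.1 : ℕ) = 0 → 0 < υ) ∧
      Tendsto (fun Q => ((F Q x).ncard : ℝ) / Q ^ (n - 1)) atTop (nhds υ) := by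
    intro x
    by_cases hx : (x.1 : ℕ) = 0
    · obtain ⟨υ, hυ, hlim⟩ := AA_deg_one (n := n) (by omega) (mk_monic x.2) (by rw [hdeg, hx])
      refine ⟨υ, fun _ => hυ, ?_⟩
      have hYfin : {y : Idx n | e y < e x}.Finite :=
        Set.Finite.preimage he.injOn (Set.finite_lt_nat (e x))
      set Y := hYfin.toFinset with hY
      have hsum : Tendsto (fun Q : ℝ => ∑ y ∈ Y,
          ((AA n (mk x.2) Q ∩ AA n (mk y.2) Q).ncard : ℝ) / Q ^ (n - 1)) atTop (nhds 0) := by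
        rw [show (0:ℝ) = ∑ y ∈ Y, (0:ℝ) by simp]
        apply tendsto_finsetSum
        intro y hy
        refine pair_small (by omega) (mk_monic _) (mk_monic _) (by rw [hdeg]; omega)
          (by rw [hdeg]; omega) ?_
        intro h
        have hxy := idx_inj h
        rw [hY, Set.Finite.mem_toFinset] at hy
        subst hxy
        have hy' : e x < e x := hy
        exact lt_irrefl _ hy'
      have hlow := hlim.sub hsum
      rw [sub_zero] at hlow
      refine tendsto_of_tendsto_of_tendsto_of_le_of_le' hlow hlim ?_ ?_
      · filter_upwards [eventually_ge_atTop 1] with Q hQ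
        rw [← Finset.sum_div, ← sub_div]
        gcongr
        rw [sub_le_iff_le_add]
        have hsub : AA n (mk x.2) Q ⊆ F Q x ∪ ⋃ y ∈ Y, (AA n (mk x.2) Q ∩ AA n (mk y.2) Q) := by
          intro p hp
          have hpR := hAR Q x hp
          by_cases hpx : φ p = x
          · exact Or.inl ⟨hpR, hpx⟩
          · right
            have hle : ¬ e x < e (φ p) := fun hlt => hφ2 p (exists_idx hpR) x hlt hp.2
            have hne : e (φ p) ≠ e x := fun h => hpx (he h)
            simp only [Set.mem_iUnion]
            refine ⟨φ p, ?_, hp, hp.1, hφ1 p (exists_idx hpR)⟩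
            rw [hY, Set.Finite.mem_toFinset]
            change e (φ p) < e x
            omega
        have hfin : (F Q x ∪ ⋃ y ∈ Y, (AA n (mk x.2) Q ∩ AA n (mk y.2) Q)).Finite := by
          refine (AA_finite n (mk x.2) Q (by linarith)).subset ?_
          refine Set.union_subset (hFA Q x) ?_
          refine Set.iUnion₂_subset fun y _ => Set.inter_subset_left
        have h1 := Set.ncard_le_ncard hsub hfin
        have h2 := Set.ncard_union_le (F Q x) (⋃ y ∈ Y, (AA n (mk x.2) Q ∩ AA n (mk y.2) Q))
        have h3 := Finset.set_ncard_biUnion_le Y (fun y => AA n (mk x.2) Q ∩ AA n (mk y.2) Q)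
        exact_mod_cast h1.trans (h2.trans (by gcongr))
      · filter_upwards [eventually_ge_atTop 1] with Q hQ
        gcongr
        · exact AA_finite n (mk x.2) Q (by linarith)
        · exact hFA Q x
    · refine ⟨0, fun h => absurd h hx, ?_⟩
      exact small_of_subset (AA_finite n (mk x.2)) (fun Q => hFA Q x)
        (AA_small (mk_monic _) (hdeg x) (by omega) (by omega))
  choose υ hυpos hυlim using hlim
  have hev : ∀ᶠ Q : ℝ in atTop, ∀ x, ‖((F Q x).ncard : ℝ) / Q ^ (n - 1)‖ ≤ bound x := by
    filter_upwards [eventually_ge_atTop 1] with Q hQ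
    exact hbd Q hQ
  have hT := tendsto_tsum_of_dominated_convergence hbsum hυlim hev
  have hυ0 : ∀ x, 0 ≤ υ x := by
    intro x
    refine ge_of_tendsto (hυlim x) ?_
    filter_upwards [eventually_ge_atTop 1] with Q hQ
    positivity
  have hυb : ∀ x, υ x ≤ bound x := by
    intro x
    refine le_of_tendsto (hυlim x) ?_
    filter_upwards [hev] with Q hQ
    exact (Real.le_norm_self _).trans (hQ x)
  refine ⟨∑' x, υ x, ?_, ?_⟩
  · exact (Summable.of_nonneg_of_le hυ0 hυb hbsum).tsum_pos hυ0 x0 (hυpos x0 rfl)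
  · refine hT.congr' ?_
    filter_upwards [eventually_ge_atTop 1] with Q hQ
    rw [tsum_div_const, ncard_eq_tsum _ (hRfin Q (by linarith)) φ]

/-- split quadratic -/
noncomputable def qd (a b : ℤ) : ℤ[X] := (X - C a) * (X - C b)

lemma qd_eq (a b : ℤ) : qd a b = X ^ 2 + C (-(a + b)) * X + C (a * b) := by
  unfold qd
  simp only [C_neg, C_add, C_mul]
  ring

lemma qd_mem {a b : ℤ} {Q : ℝ} (hQ : 1 ≤ Q) :
    qd a b ∈ ReducibleMonicSet 2 Q ↔ (|((a + b : ℤ) : ℝ)| ≤ Q ∧ |((a * b : ℤ) : ℝ)| ≤ Q) := by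
  have c0 : (qd a b).coeff 0 = a * b := by
    rw [qd_eq]; simp
  have c1 : (qd a b).coeff 1 = -(a + b) := by
    rw [qd_eq, coeff_add, coeff_add, coeff_X_pow, coeff_C_mul, coeff_X_one, coeff_C]; simp
  have hm : (qd a b).Monic := (monic_X_sub_C a).mul (monic_X_sub_C b)
  have hd : (qd a b).natDegree = 2 := by
    rw [qd, (monic_X_sub_C a).natDegree_mul (monic_X_sub_C b), natDegree_X_sub_C,
      natDegree_X_sub_C]
  constructor
  · rintro ⟨_, _, h, _⟩
    have h0 := h 0
    have h1 := h 1
    rw [c0] at h0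
    rw [c1] at h1
    rw [Int.cast_neg, abs_neg] at h1
    exact ⟨h1, h0⟩
  · rintro ⟨h1, h0⟩
    refine ⟨hm, hd, ?_, X - C a, X - C b, by rw [natDegree_X_sub_C], by rw [natDegree_X_sub_C], rfl⟩
    intro i
    rcases lt_trichotomy i 2 with hi | hi | hi
    · interval_cases i
      · rw [c0]; exact h0
      · rw [c1, Int.cast_neg, abs_neg]; exact h1
    · have := hm.coeff_natDegree
      rw [hd] at this
      rw [hi, this]; simpa using hQ
    · rw [coeff_eq_zero_of_natDegree_lt (by omega)]; simp; linarith

lemma exists_qd {Q : ℝ} {p : ℤ[X]} (hp : p ∈ ReducibleMonicSet 2 Q) :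
    ∃ a b : ℤ, |a| ≤ |b| ∧ p = qd a b := by
  obtain ⟨hpm, hpd, _, q, r, hq, hr, e⟩ := hp
  have hq0 : q ≠ 0 := by rintro rfl; simp at hq
  have hr0 : r ≠ 0 := by rintro rfl; simp at hr
  have hdeg : p.natDegree = q.natDegree + r.natDegree := by rw [e, natDegree_mul hq0 hr0]
  obtain ⟨q', m', ⟨r', e'⟩, d'⟩ := exists_monic hpm ⟨r, e⟩
  have hm := monic_of_mul m' hpm e'
  have hdeg' : p.natDegree = q'.natDegree + r'.natDegree := by rw [e', m'.natDegree_mul hm]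
  have e1 := m'.eq_X_add_C (by omega)
  have e2 := hm.eq_X_add_C (by omega)
  have : p = qd (-(q'.coeff 0)) (-(r'.coeff 0)) := by
    rw [e', qd]
    nth_rewrite 1 [e1]
    nth_rewrite 1 [e2]
    simp
  rcases le_total |-(q'.coeff 0)| |-(r'.coeff 0)| with h | h
  · exact ⟨_, _, h, this⟩
  · exact ⟨_, _, h, by rw [this, qd, qd, mul_comm]⟩

lemma qd_inj {a b a' b' : ℤ} (h : |a| < |b|) (h' : |a'| < |b'|) (e : qd a b = qd a' b') :
    a = a' ∧ b = b' := by
  have h1 := congrArg (fun p => eval a p) e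
  have h2 := congrArg (fun p => eval b p) e
  have h3 := congrArg (fun p => coeff p 1) e
  simp only [qd_eq, coeff_add, coeff_X_pow, coeff_C_mul, coeff_X_one, coeff_C] at h3
  simp at h3
  simp [qd] at h1
  rcases h1 with h1 | h1
  · exact ⟨by omega, by omega⟩
  · have : a = b' := by omega
    have : b = a' := by omega
    subst_vars
    exact absurd h (not_lt.2 h'.le)

/-- signs -/
def sg : Finset ℤ := {1, -1}

lemma sg_card : sg.card = 2 := by decide

lemma sg_abs {s : ℤ} (h : s ∈ sg) : |s| = 1 := by
  simp only [sg, Finset.mem_insert, Finset.mem_singleton] at h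
  rcases h with rfl | rfl <;> rfl

/-- parametrization -/
noncomputable def qf (t : ℤ × ℤ × (Σ _ : ℕ, ℕ)) : ℤ[X] := qd (t.1 * t.2.2.1) (t.2.1 * t.2.2.2)

lemma sgn_exists (a : ℤ) : ∃ s ∈ sg, a = s * (a.natAbs : ℤ) := by
  rcases Int.natAbs_eq a with h | h
  · exact ⟨1, by simp [sg], by omega⟩
  · exact ⟨-1, by simp [sg], by omega⟩

lemma sgn_unique {s s' : ℤ} (h : s ∈ sg) (h' : s' ∈ sg) {i i' : ℕ} (hi : 0 < i) (hi' : 0 < i')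
    (e : s * (i : ℤ) = s' * i') : s = s' ∧ i = i' := by
  simp only [sg, Finset.mem_insert, Finset.mem_singleton] at h h'
  rcases h with rfl | rfl <;> rcases h' with rfl | rfl <;> constructor <;> omega

lemma upper_count {Q : ℝ} (hQ : 1 ≤ Q) : ((ReducibleMonicSet 2 Q).ncard : ℝ) ≤
    (2 * Q + 1) + 4 * ∑ i ∈ Finset.Icc 1 (Nat.sqrt ⌊Q⌋₊), Q / i := by
  classical
  set N := ⌊Q⌋₊ with hN
  set s := Nat.sqrt N
  have hNQ : (N : ℝ) ≤ Q := Nat.floor_le (by linarith)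
  have hle : ∀ z : ℤ, |(z : ℝ)| ≤ Q → z.natAbs ≤ N := by
    intro z hz
    rw [hN, Nat.le_floor_iff (by linarith)]
    rw [Nat.cast_natAbs]
    exact_mod_cast hz
  set U1 : Finset ℤ[X] := (Finset.Icc (-(N:ℤ)) N).image (fun b => qd 0 b) with hU1
  set U2 : Finset (ℤ × ℤ × (Σ _ : ℕ, ℕ)) :=
    sg ×ˢ sg ×ˢ (Finset.Icc 1 s).sigma (fun i => Finset.Icc 1 (N / i)) with hU2
  have hsub : ReducibleMonicSet 2 Q ⊆ ((U1 ∪ U2.image qf : Finset ℤ[X]) : Set ℤ[X]) := by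
    intro p hp
    obtain ⟨a, b, hab, rfl⟩ := exists_qd hp
    obtain ⟨h1, h2⟩ := (qd_mem hQ).1 hp
    rw [Finset.coe_union]
    by_cases ha : a = 0
    · left
      subst ha
      rw [zero_add] at h1
      have := hle b h1
      simp only [hU1, Finset.coe_image, Set.mem_image, Finset.mem_coe, Finset.mem_Icc]
      exact ⟨b, by omega, rfl⟩
    · right
      have hb : b ≠ 0 := by
        rintro rfl; simp at hab; exact ha hab
      obtain ⟨sa, hsa, ea⟩ := sgn_exists a
      obtain ⟨sb, hsb, eb⟩ := sgn_exists b
      have h3 := hle _ h2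
      rw [Int.natAbs_mul] at h3
      have hab' : a.natAbs ≤ b.natAbs := by
        rw [Int.abs_eq_natAbs, Int.abs_eq_natAbs] at hab; exact_mod_cast hab
      have ha' : 0 < a.natAbs := by omega
      have hb' : 0 < b.natAbs := by omega
      simp only [hU2, Finset.coe_image, Set.mem_image, Finset.mem_coe]
      refine ⟨⟨sa, sb, ⟨a.natAbs, b.natAbs⟩⟩, ?_, ?_⟩
      · simp only [Finset.mem_product, Finset.mem_sigma, Finset.mem_Icc]
        refine ⟨hsa, hsb, ⟨ha', ?_⟩, hb', ?_⟩
        · rw [Nat.le_sqrt]; exact (Nat.mul_le_mul_left _ hab').trans h3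
        · rw [Nat.le_div_iff_mul_le ha', mul_comm]; exact h3
      · simp only [qf]; rw [← ea, ← eb]
  have hc := Set.ncard_le_ncard hsub (Finset.finite_toSet _)
  rw [Set.ncard_coe_finset] at hc
  have hc1 : U1.card ≤ 2 * N + 1 := by
    refine Finset.card_image_le.trans ?_
    rw [Int.card_Icc]; omega
  have hc2 : (U2.image qf).card ≤ 4 * ∑ i ∈ Finset.Icc 1 s, N / i := by
    refine Finset.card_image_le.trans ?_
    rw [hU2, Finset.card_product, Finset.card_product, sg_card, Finset.card_sigma]
    simp only [Nat.card_Icc, Nat.add_sub_cancel]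
    omega
  have hc3 : (ReducibleMonicSet 2 Q).ncard ≤ (2 * N + 1) + 4 * ∑ i ∈ Finset.Icc 1 s, N / i :=
    hc.trans ((Finset.card_union_le _ _).trans (add_le_add hc1 hc2))
  have hc4 : ((ReducibleMonicSet 2 Q).ncard : ℝ) ≤
      (2 * N + 1) + 4 * ∑ i ∈ Finset.Icc 1 s, ((N / i : ℕ) : ℝ) := by exact_mod_cast hc3
  refine hc4.trans ?_
  gcongr with i hi
  exact Nat.cast_div_le.trans (by gcongr)

lemma lower_count {Q : ℝ} (hQ : 1 ≤ Q) :
    4 * ∑ i ∈ Finset.Icc 2 (Nat.sqrt ⌊Q⌋₊), (Q / i - 1 - i) ≤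
      ((ReducibleMonicSet 2 Q).ncard : ℝ) := by
  classical
  set N := ⌊Q⌋₊ with hN
  set s := Nat.sqrt N
  have hNQ : (N : ℝ) ≤ Q := Nat.floor_le (by linarith)
  have hfin : (ReducibleMonicSet 2 Q).Finite :=
    (MB_count 2 Q (by linarith)).1.subset (fun p hp => ⟨hp.1, hp.2.1, hp.2.2.1⟩)
  set U2 : Finset (ℤ × ℤ × (Σ _ : ℕ, ℕ)) :=
    sg ×ˢ sg ×ˢ (Finset.Icc 2 s).sigma (fun i => Finset.Ioc i (N / i)) with hU2
  have hmaps : Set.MapsTo qf (U2 : Set (ℤ × ℤ × (Σ _ : ℕ, ℕ))) (ReducibleMonicSet 2 Q) := by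
    rintro ⟨sa, sb, ⟨i, j⟩⟩ ht
    simp only [hU2, Finset.mem_coe, Finset.mem_product, Finset.mem_sigma, Finset.mem_Icc,
      Finset.mem_Ioc] at ht
    obtain ⟨hsa, hsb, ⟨hi, _⟩, hij, hj⟩ := ht
    rw [Nat.le_div_iff_mul_le (by omega)] at hj
    have hsum : i + j ≤ j * i := by nlinarith
    have hjQ : ((j * i : ℕ) : ℝ) ≤ Q := le_trans (by exact_mod_cast hj) hNQ
    have aa : |sa * (i : ℤ)| = i := by rw [abs_mul, sg_abs hsa]; simp
    have ab : |sb * (j : ℤ)| = j := by rw [abs_mul, sg_abs hsb]; simp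
    refine (qd_mem hQ).2 ⟨?_, ?_⟩
    · refine le_trans ?_ hjQ
      have : |sa * (i : ℤ) + sb * (j : ℤ)| ≤ ((j * i : ℕ) : ℤ) := by
        refine (abs_add_le _ _).trans ?_
        rw [aa, ab]; exact_mod_cast hsum
      exact_mod_cast this
    · refine le_trans ?_ hjQ
      have : |sa * (i : ℤ) * (sb * (j : ℤ))| ≤ ((j * i : ℕ) : ℤ) := by
        rw [abs_mul, aa, ab]; push_cast; rw [mul_comm]
      exact_mod_cast this
  have hinj : Set.InjOn qf (U2 : Set (ℤ × ℤ × (Σ _ : ℕ, ℕ))) := by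
    rintro ⟨sa, sb, ⟨i, j⟩⟩ ht ⟨sa', sb', ⟨i', j'⟩⟩ ht' e
    simp only [hU2, Finset.mem_coe, Finset.mem_product, Finset.mem_sigma, Finset.mem_Icc,
      Finset.mem_Ioc] at ht ht'
    obtain ⟨hsa, hsb, ⟨hi, _⟩, hij, hj⟩ := ht
    obtain ⟨hsa', hsb', ⟨hi', _⟩, hij', hj'⟩ := ht'
    have aux : ∀ {sa sb : ℤ} {i j : ℕ}, sa ∈ sg → sb ∈ sg → i < j →
        |sa * (i : ℤ)| < |sb * (j : ℤ)| := by
      intro sa sb i j h1 h2 h3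
      rw [abs_mul, abs_mul, sg_abs h1, sg_abs h2]
      simpa using h3
    obtain ⟨e1, e2⟩ := qd_inj (aux hsa hsb hij) (aux hsa' hsb' hij') e
    obtain ⟨rfl, rfl⟩ := sgn_unique hsa hsa' (by omega) (by omega) e1
    obtain ⟨rfl, rfl⟩ := sgn_unique hsb hsb' (by omega) (by omega) e2
    rfl
  have hc := Set.ncard_le_ncard_of_injOn _ hmaps hinj hfin
  rw [Set.ncard_coe_finset] at hc
  have hc2 : U2.card = 4 * ∑ i ∈ Finset.Icc 2 s, (N / i - i) := by
    rw [hU2, Finset.card_product, Finset.card_product, sg_card, Finset.card_sigma]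
    simp only [Nat.card_Ioc]
    omega
  rw [hc2] at hc
  have hc4 : 4 * ∑ i ∈ Finset.Icc 2 s, ((N / i - i : ℕ) : ℝ) ≤
    ((ReducibleMonicSet 2 Q).ncard : ℝ) := by exact_mod_cast hc
  refine le_trans ?_ hc4
  gcongr with i hi
  have h1 : (((N / i : ℕ) : ℝ)) - i ≤ ((N / i - i : ℕ) : ℝ) := by
    rw [sub_le_iff_le_add]; norm_cast; omega
  refine le_trans ?_ h1
  have h2 : N / i = ⌊Q / i⌋₊ := by rw [hN, Nat.floor_div_natCast]
  have h3 := Nat.lt_floor_add_one (Q / i)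
  rw [h2]
  linarith

lemma part2_bound {Q : ℝ} (hQ : 1 ≤ Q) :
    |((ReducibleMonicSet 2 Q).ncard : ℝ) - 2 * Q * Real.log Q| ≤ 20 * Q := by
  have hu := upper_count hQ
  have hl := lower_count hQ
  set N := ⌊Q⌋₊ with hN
  set s := Nat.sqrt N with hs
  have hNQ : (N : ℝ) ≤ Q := Nat.floor_le (by linarith)
  have hN1 : 1 ≤ N := by rw [hN, Nat.one_le_floor_iff]; exact hQ
  have hs1 : 1 ≤ s := by rw [hs, Nat.le_sqrt]; omega
  have hsQ : (s : ℝ) ^ 2 ≤ Q := by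
    refine le_trans ?_ hNQ
    exact_mod_cast Nat.sqrt_le' N
  have hsQ' : Q ≤ ((s + 1 : ℕ) : ℝ) ^ 2 := by
    have h1 : N + 1 ≤ (s + 1) ^ 2 := Nat.lt_succ_sqrt' N
    have h2 := Nat.lt_floor_add_one Q
    have h3 : ((N + 1 : ℕ) : ℝ) ≤ ((s + 1) ^ 2 : ℕ) := by exact_mod_cast h1
    push_cast at h3 ⊢
    linarith
  have hsp : (1 : ℝ) ≤ s := by exact_mod_cast hs1
  have H : ((harmonic s : ℚ) : ℝ) = ∑ i ∈ Finset.Icc 1 s, (i : ℝ)⁻¹ := by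
    rw [harmonic_eq_sum_Icc]; push_cast; rfl
  have Hu := harmonic_le_one_add_log s
  have Hl := log_add_one_le_harmonic s
  rw [H] at Hu Hl
  have hlog1 : 2 * Real.log s ≤ Real.log Q := by
    have := Real.log_le_log (by positivity) hsQ
    rwa [Real.log_pow] at this
  have hlog2 : Real.log Q ≤ 2 * Real.log ((s + 1 : ℕ) : ℝ) := by
    have := Real.log_le_log (by linarith) hsQ'
    rwa [Real.log_pow] at this
  have eu : ∑ i ∈ Finset.Icc 1 s, Q / (i : ℝ) = Q * ∑ i ∈ Finset.Icc 1 s, (i : ℝ)⁻¹ := by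
    rw [Finset.mul_sum]; rfl
  have el : Q * ∑ i ∈ Finset.Icc 1 s, (i : ℝ)⁻¹ - Q - 2 * Q ≤
      ∑ i ∈ Finset.Icc 2 s, (Q / (i : ℝ) - 1 - i) := by
    have h1 : ∑ i ∈ Finset.Icc 1 s, (Q / (i : ℝ) - 1 - i) =
        (Q - 2) + ∑ i ∈ Finset.Icc 2 s, (Q / (i : ℝ) - 1 - i) := by
      rw [← Finset.add_sum_Ioc_eq_sum_Icc hs1]
      congr 1
      simp; ring
    have h2 : ∑ i ∈ Finset.Icc 1 s, (1 + (i : ℝ)) ≤ 2 * Q := by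
      have : ∀ i ∈ Finset.Icc 1 s, (1 + (i : ℝ)) ≤ 2 * s := by
        intro i hi
        rw [Finset.mem_Icc] at hi
        have : (i : ℝ) ≤ s := by exact_mod_cast hi.2
        linarith
      refine (Finset.sum_le_card_nsmul _ _ _ this).trans ?_
      rw [Nat.card_Icc, nsmul_eq_mul]
      simp only [Nat.add_sub_cancel]
      nlinarith
    have h3 : ∑ i ∈ Finset.Icc 1 s, (Q / (i : ℝ) - 1 - i) =
        ∑ i ∈ Finset.Icc 1 s, Q / (i : ℝ) - ∑ i ∈ Finset.Icc 1 s, (1 + (i : ℝ)) := by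
      rw [← Finset.sum_sub_distrib]
      apply Finset.sum_congr rfl
      intro i _; ring
    rw [h3, eu] at h1
    linarith
  rw [eu] at hu
  set S := ∑ i ∈ Finset.Icc 1 s, (i : ℝ)⁻¹
  have b1 : Q * S ≤ Q * (1 + Real.log Q / 2) := by gcongr; linarith
  have b2 : Q * (Real.log Q / 2) ≤ Q * S := by gcongr; linarith
  rw [abs_le]
  constructor <;> nlinarith

theorem part2 :
    Tendsto (fun Q : ℝ => ((ReducibleMonicSet 2 Q).ncard : ℝ) / (2 * Q * Real.log Q))
      atTop (nhds 1) := by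
  rw [tendsto_iff_norm_sub_tendsto_zero]
  have hlim : Tendsto (fun Q : ℝ => 10 * (Real.log Q)⁻¹) atTop (nhds 0) := by
    simpa using (Real.tendsto_log_atTop.inv_tendsto_atTop).const_mul 10
  refine squeeze_zero' (Eventually.of_forall fun Q => norm_nonneg _) ?_ hlim
  filter_upwards [eventually_gt_atTop 1] with Q hQ
  have hl := Real.log_pos hQ
  have h := part2_bound hQ.le
  have hp : 0 < 2 * Q * Real.log Q := by positivity
  rw [Real.norm_eq_abs, div_sub_one hp.ne', abs_div, abs_of_pos hp, div_le_iff₀ hp]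
  refine h.trans (le_of_eq ?_)
  field_simp
  ring

end RMC

theorem reducible_monic_count :
    (∀ n : ℕ, 3 ≤ n → ∃ υ : ℝ, 0 < υ ∧
      Tendsto (fun Q : ℝ => ((ReducibleMonicSet n Q).ncard : ℝ) / Q ^ (n - 1))
        atTop (nhds υ)) ∧
    Tendsto (fun Q : ℝ => ((ReducibleMonicSet 2 Q).ncard : ℝ) / (2 * Q * Real.log Q))
      atTop (nhds 1) :=
  ⟨RMC.part1, RMC.part2⟩
end

section
/- Let n ≥ 3 and fix ξ > 0. Define the map F : ℝ^{n−3+2} → ℝ^{n} sending (b_{n−3},…,b_1,b_0,α,β) to the coefficient vector (a_{n−1},…,a_1,a_0) determined by the polynomial identity ξx^n + Σ_{k=0}^{n−1} a_k x^k = (x−α)(x−β)(ξx^{n−2} + Σ_{m=0}^{n−3} b_m x^m). Then the absolute value of the Jacobian determinant ∂(a_{n−1},…,a_1,a_0)/∂(b_{n−3},…,b_0,α,β) equals |(β−α)·g(b,α)·g(b,β)|, where g(b,x) = ξx^{n−2} + b_{n−3}x^{n−3} + ⋯ + b_1 x + b_0. -/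
open Polynomial

def HPD {E : Type*} [NormedAddCommGroup E] [NormedSpace ℝ E] (p : E → ℝ[X]) (p' : E → ℝ[X])
    (v : E) : Prop :=
  ∀ k, DifferentiableAt ℝ (fun w => (p w).coeff k) v ∧
    ∀ h, fderiv ℝ (fun w => (p w).coeff k) v h = (p' h).coeff k

section
variable {E : Type*} [NormedAddCommGroup E] [NormedSpace ℝ E] {p q p' q' : E → ℝ[X]} {v : E}

theorem HPD.const (c : ℝ[X]) : HPD (fun _ : E => c) (fun _ => 0) v := by
  intro k
  simp

theorem HPD.add (hp : HPD p p' v) (hq : HPD q q' v) :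
    HPD (fun w => p w + q w) (fun h => p' h + q' h) v := by
  intro k
  have := ((hp k).1.hasFDerivAt.add (hq k).1.hasFDerivAt)
  have e : (fun w => (p w + q w).coeff k) =
    (fun w => (p w).coeff k) + (fun w => (q w).coeff k) := by ext w; simp
  rw [e]
  refine ⟨this.differentiableAt, fun h => ?_⟩
  rw [this.fderiv]
  simp [(hp k).2 h, (hq k).2 h]

theorem HPD.neg (hp : HPD p p' v) :
    HPD (fun w => - p w) (fun h => - p' h) v := by
  intro k
  have := (hp k).1.hasFDerivAt.neg
  have e : (fun w => (- p w).coeff k) = - (fun w => (p w).coeff k) := by ext w; simp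
  rw [e]
  refine ⟨this.differentiableAt, fun h => ?_⟩
  rw [this.fderiv]
  simp [(hp k).2 h]

theorem HPD.sum {ι : Type*} (s : Finset ι) {p p' : ι → E → ℝ[X]} 
    (hp : ∀ i, HPD (p i) (p' i) v) :
    HPD (fun w => ∑ i ∈ s, p i w) (fun h => ∑ i ∈ s, p' i h) v := by
  classical
  induction s using Finset.induction_on with
  | empty => simpa using HPD.const (v := v) (0 : ℝ[X])
  | insert a s ha ih =>
    simp only [Finset.sum_insert ha]
    exact (hp a).add ih

theorem HPD.mul (hp : HPD p p' v) (hq : HPD q q' v) :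
    HPD (fun w => p w * q w) (fun h => p' h * q v + p v * q' h) v := by
  intro k
  have := HasFDerivAt.fun_sum (u := Finset.HasAntidiagonal.antidiagonal k) (fun (x : ℕ × ℕ) _ =>
    ((hp x.1).1.hasFDerivAt.mul (hq x.2).1.hasFDerivAt))
  have e : (fun w => (p w * q w).coeff k) = fun w => ∑ x ∈ Finset.HasAntidiagonal.antidiagonal k, 
    ((fun w => (p w).coeff x.1) * (fun w => (q w).coeff x.2)) w := by
      ext w; simp [coeff_mul]
  rw [e]
  refine ⟨this.differentiableAt, fun h => ?_⟩
  rw [this.fderiv]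
  simp only [coeff_add, coeff_mul, ← Finset.sum_add_distrib, ContinuousLinearMap.sum_apply]
  refine Finset.sum_congr rfl fun x _ => ?_
  simp [(hp x.1).2 h, (hq x.2).2 h]
  ring

theorem HPD.C_apply {ι : Type*} [Fintype ι] (v : ι → ℝ) (i : ι) :
    HPD (fun w : ι → ℝ => C (w i)) (fun h => C (h i)) v := by
  intro k
  have : HasFDerivAt (fun w : ι → ℝ => w i) (ContinuousLinearMap.proj i : (ι → ℝ) →L[ℝ] ℝ) v :=
    hasFDerivAt_apply i v
  by_cases hk : k = 0
  · subst hk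
    simp only [coeff_C_zero]
    exact ⟨this.differentiableAt, fun h => by rw [this.fderiv]; rfl⟩
  · simp [coeff_C_of_ne_zero hk]
end

theorem coeff_Q_mul (N : ℕ) (Q q : ℝ[X]) (hq : q.natDegree < N) (k : ℕ) :
    ∑ m : Fin N, (Q * X ^ (m : ℕ)).coeff k * q.coeff m = (Q * q).coeff k := by
  conv_rhs => rw [q.as_sum_range' N hq, Finset.mul_sum, finsetSum_coeff, ← Fin.sum_univ_eq_sum_range (fun m => (Q * monomial m (q.coeff m)).coeff k)]
  refine Finset.sum_congr rfl fun m _ => ?_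
  rw [← C_mul_X_pow_eq_monomial, mul_left_comm, coeff_C_mul, mul_comm]

theorem g_div (g : ℝ[X]) (a : ℝ) : g = (X - C a) * (g /ₘ (X - C a)) + C (g.eval a) := by
  conv_lhs => rw [← modByMonic_add_div g (X - C a), modByMonic_X_sub_C_eq_C_eval]
  ring

theorem det_aux (N : ℕ) (hN : 1 ≤ N) (a b : ℝ) (g : ℝ[X]) (hg : g.natDegree ≤ N)
    (M : Matrix (Fin (N + 2)) (Fin (N + 2)) ℝ)
    (h1 : ∀ k (m : Fin N), M k (Fin.castAdd 2 m) = ((X - C a) * (X - C b) * X ^ (m : ℕ)).coeff k)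
    (h2 : ∀ k, M k (Fin.natAdd N 0) = (- (X - C b) * g).coeff k)
    (h3 : ∀ k, M k (Fin.natAdd N 1) = (- (X - C a) * g).coeff k) :
    |M.det| = |(b - a) * g.eval a * g.eval b| := by
  set Q : ℝ[X] := (X - C a) * (X - C b) with hQ
  have hQm : Q.Monic := (monic_X_sub_C a).mul (monic_X_sub_C b)
  have hQd : Q.natDegree = 2 := by
    rw [hQ, (monic_X_sub_C a).natDegree_mul (monic_X_sub_C b)]; simp
  let P : Fin (N + 2) → ℝ[X] := fun j =>
    if (j : ℕ) = 0 then 1 else if (j : ℕ) = 1 then X - C a else Q * X ^ ((j : ℕ) - 2)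
  let T : Matrix (Fin (N + 2)) (Fin (N + 2)) ℝ := Matrix.of fun i j => (P j).coeff i
  have hT : T.det = 1 := by
    apply Matrix.det_matrixOfPolynomials
    · intro i
      simp only [P]
      split_ifs with h h'
      · simp [h]
      · simp [h']
      · rw [hQm.natDegree_mul (monic_X_pow _), hQd]; simp; omega
    · intro i
      simp only [P]
      split_ifs with h h'
      · exact monic_one
      · exact monic_X_sub_C a
      · exact hQm.mul (monic_X_pow _)
  let e : Fin N ⊕ Fin 2 ≃ Fin (N + 2) := finSumFinEquiv
  let e' : Fin N ⊕ Fin 2 ≃ Fin (N + 2) :=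
    (Equiv.sumComm _ _).trans (finSumFinEquiv.trans (finCongr (Nat.add_comm 2 N)))
  let q : Fin 2 → ℝ[X] := ![-(g /ₘ (X - C a)), -(g /ₘ (X - C b))]
  have hq : ∀ i, (q i).natDegree < N := by
    intro i
    fin_cases i <;> simp [q, natDegree_divByMonic _ (monic_X_sub_C _)] <;> omega
  let B : Matrix (Fin 2) (Fin 2) ℝ := !![(b - a) * g.eval a, 0; -g.eval a, -g.eval b]
  let S : Matrix (Fin N ⊕ Fin 2) (Fin N ⊕ Fin 2) ℝ :=
    Matrix.fromBlocks 1 (Matrix.of fun m i => (q i).coeff m) 0 B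
  have hTl : ∀ k (m : Fin N), T k (e' (Sum.inl m)) = (Q * X ^ (m : ℕ)).coeff k := by
    intro k m
    have hv : (e' (Sum.inl m) : ℕ) = (m : ℕ) + 2 := by simp [e']
    simp only [T, P, Matrix.of_apply, hv]
    simp
  have hT0 : ∀ k, T k (e' (Sum.inr 0)) = (1 : ℝ[X]).coeff k := by
    intro k
    have hv : (e' (Sum.inr 0) : ℕ) = 0 := by simp [e']
    simp only [T, P, Matrix.of_apply, hv]
    simp
  have hT1 : ∀ k, T k (e' (Sum.inr 1)) = (X - C a : ℝ[X]).coeff k := by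
    intro k
    have hv : (e' (Sum.inr 1) : ℕ) = 1 := by simp [e']
    simp only [T, P, Matrix.of_apply, hv]
    simp
  have key : M.submatrix e e = T.submatrix e e' * S := by
    ext k s
    simp only [Matrix.mul_apply, Matrix.submatrix_apply, Fintype.sum_sum_type, Fin.sum_univ_two,
      hTl, hT0, hT1]
    generalize e k = k
    rcases s with m | i
    · simp [S, Matrix.one_apply, e, h1]
    · simp only [S, Matrix.fromBlocks_apply₁₂, Matrix.fromBlocks_apply₂₂, Matrix.of_apply]
      rw [coeff_Q_mul N Q (q i) (hq i)]
      fin_cases i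
      · change M k (Fin.natAdd N 0) = (Q * -(g /ₘ (X - C a))).coeff k +
          ((1 : ℝ[X]).coeff k * ((b - a) * g.eval a) + (X - C a : ℝ[X]).coeff k * (-g.eval a))
        rw [h2, ← coeff_mul_C, ← coeff_mul_C, ← coeff_add, ← coeff_add]
        congr 1
        have := g_div g a
        simp only [C_mul, C_sub, C_neg]
        linear_combination (-(X - C b)) * this
      · change M k (Fin.natAdd N 1) = (Q * -(g /ₘ (X - C b))).coeff k +
          ((1 : ℝ[X]).coeff k * 0 + (X - C a : ℝ[X]).coeff k * (-g.eval b))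
        rw [h3, mul_zero, zero_add, ← coeff_mul_C, ← coeff_add]
        congr 1
        have := g_div g b
        simp only [C_neg]
        linear_combination (-(X - C a)) * this
  have := congrArg (fun A => |Matrix.det A|) key
  simp only [Matrix.det_mul, abs_mul, Matrix.abs_det_submatrix_equiv_equiv, hT] at this
  rw [this]
  simp [S, B, Matrix.det_fromBlocks_zero₂₁, Matrix.det_fin_two, abs_mul]

theorem main_aux (N : ℕ) (hN : 1 ≤ N) (ξ : ℝ) (v : Fin (N + 2) → ℝ) :
    |LinearMap.det
      ((fderiv ℝ
        (fun w : Fin (N + 2) → ℝ => fun k : Fin (N + 2) =>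
          ((X - C (w ⟨N, by omega⟩)) * (X - C (w ⟨N + 1, by omega⟩)) *
            (C ξ * X ^ N +
              ∑ m : Fin (N + 2), if (m : ℕ) < N then C (w m) * X ^ (m : ℕ) else 0)).coeff k)
        v).toLinearMap)| =
    |(v ⟨N + 1, by omega⟩ - v ⟨N, by omega⟩) *
      (ξ * (v ⟨N, by omega⟩) ^ N +
        ∑ m : Fin (N + 2), if (m : ℕ) < N then v m * (v ⟨N, by omega⟩) ^ (m : ℕ) else 0) *
      (ξ * (v ⟨N + 1, by omega⟩) ^ N +
        ∑ m : Fin (N + 2), if (m : ℕ) < N then v m * (v ⟨N + 1, by omega⟩) ^ (m : ℕ) else 0)| := by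
  set ia : Fin (N + 2) := ⟨N, by omega⟩ with hia
  set ib : Fin (N + 2) := ⟨N + 1, by omega⟩ with hib
  let S : (Fin (N + 2) → ℝ) → ℝ[X] := fun w =>
    ∑ m : Fin (N + 2), if (m : ℕ) < N then C (w m) * X ^ (m : ℕ) else 0
  have hS : HPD S S v := by
    apply HPD.sum
    intro m
    split_ifs with h
    · simpa using (HPD.C_apply v m).mul (HPD.const (X ^ (m : ℕ)))
    · exact HPD.const 0
  have hlin : ∀ i, HPD (fun w : Fin (N + 2) → ℝ => X - C (w i)) (fun h => - C (h i)) v := by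
    intro i
    simpa [sub_eq_add_neg] using (HPD.const X).add (HPD.C_apply v i).neg
  set g : ℝ[X] := C ξ * X ^ N + S v with hg
  have hF := ((hlin ia).mul (hlin ib)).mul ((HPD.const (C ξ * X ^ N)).add hS)
  have hdeg : g.natDegree ≤ N := by
    apply natDegree_add_le_of_degree_le (natDegree_C_mul_X_pow_le _ _)
    apply natDegree_sum_le_of_forall_le
    intro m _
    split_ifs with h
    · exact (natDegree_C_mul_X_pow_le _ _).trans h.le
    · simp
  have hev : ∀ x, g.eval x = ξ * x ^ N +
      ∑ m : Fin (N + 2), if (m : ℕ) < N then v m * x ^ (m : ℕ) else 0 := by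
    intro x
    simp only [hg, S, eval_add, eval_mul, eval_C, eval_pow, eval_X, eval_finsetSum]
    congr 1
    refine Finset.sum_congr rfl fun m _ => ?_
    split_ifs <;> simp
  rw [← hev, ← hev, ← LinearMap.det_toMatrix']
  have hent : ∀ k j, LinearMap.toMatrix' ((fderiv ℝ
        (fun w : Fin (N + 2) → ℝ => fun k : Fin (N + 2) =>
          ((X - C (w ia)) * (X - C (w ib)) * (C ξ * X ^ N + S w)).coeff k)
        v).toLinearMap) k j = (((-C ((Pi.single j 1 : Fin (N + 2) → ℝ) ia) * (X - C (v ib)) +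
          (X - C (v ia)) * -C ((Pi.single j 1 : Fin (N + 2) → ℝ) ib)) * g +
          (X - C (v ia)) * (X - C (v ib)) * S (Pi.single j 1)).coeff k) := by
    intro k j
    rw [LinearMap.toMatrix'_apply]
    have hpi := fderiv_pi (𝕜 := ℝ) (x := v) (φ := fun (k : Fin (N + 2)) (w : Fin (N + 2) → ℝ) =>
      ((X - C (w ia)) * (X - C (w ib)) * (C ξ * X ^ N + S w)).coeff k) (fun i => (hF i).1)
    rw [hpi]
    have := (hF k).2 (Pi.single j 1)
    simp only [zero_add] at this
    rw [← this]
    simp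
  have hSs : ∀ j : Fin (N + 2), S (Pi.single j 1) = if (j : ℕ) < N then X ^ (j : ℕ) else 0 := by
    intro j
    simp only [S]
    rw [Finset.sum_eq_single j]
    · simp
    · intro m _ hm
      simp [Pi.single_eq_of_ne hm]
    · simp
  refine det_aux N hN (v ia) (v ib) g hdeg _ ?_ ?_ ?_
  · intro k m
    refine (hent _ _).trans ?_
    have h1 : ia ≠ Fin.castAdd 2 m := by
      intro h; have := congrArg Fin.val h; simp [hia] at this; omega
    have h2 : ib ≠ Fin.castAdd 2 m := by
      intro h; have := congrArg Fin.val h; simp [hib] at this; omega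
    rw [hSs, Pi.single_eq_of_ne h1, Pi.single_eq_of_ne h2]
    simp
  · intro k
    refine (hent _ _).trans ?_
    have h1 : Fin.natAdd N (0 : Fin 2) = ia := by ext; simp [hia]
    have h2 : ib ≠ ia := by simp [hia, hib]
    rw [hSs, h1, Pi.single_eq_same, Pi.single_eq_of_ne h2]
    simp [hia]
  · intro k
    refine (hent _ _).trans ?_
    have h1 : Fin.natAdd N (1 : Fin 2) = ib := by ext; simp [hib]
    have h2 : ia ≠ ib := by simp [hia, hib]
    rw [hSs, h1, Pi.single_eq_same, Pi.single_eq_of_ne h2]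
    simp [hib]

/-- The Jacobian of the coordinate change
`(b_{n-3}, …, b_0, α, β) ↦ (a_{n-1}, …, a_1, a_0)` given by
`ξ x^n + ∑_{k<n} a_k x^k = (x-α)(x-β)(ξ x^{n-2} + ∑_{m ≤ n-3} b_m x^m)`
has absolute value `|(β-α) g(b,α) g(b,β)|` with `g(b,x) = ξ x^{n-2} + ∑_{m ≤ n-3} b_m x^m`.
The input vector `w : Fin n → ℝ` encodes `b_m = w m` for `m < n-2`, `α = w (n-2)`,
`β = w (n-1)`; the output vector gives `a_k` for `k = 0, …, n-1`. -/
theorem jacobian_two_roots_factorization (n : ℕ) (hn : 3 ≤ n) (ξ : ℝ) (hξ : 0 < ξ)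
    (v : Fin n → ℝ) :
    |LinearMap.det
      ((fderiv ℝ
        (fun w : Fin n → ℝ => fun k : Fin n =>
          ((X - C (w ⟨n - 2, by omega⟩)) * (X - C (w ⟨n - 1, by omega⟩)) *
            (C ξ * X ^ (n - 2) +
              ∑ m : Fin n, if (m : ℕ) < n - 2 then C (w m) * X ^ (m : ℕ) else 0)).coeff k)
        v).toLinearMap)| =
    |(v ⟨n - 1, by omega⟩ - v ⟨n - 2, by omega⟩) *
      (ξ * (v ⟨n - 2, by omega⟩) ^ (n - 2) +
        ∑ m : Fin n, if (m : ℕ) < n - 2 then v m * (v ⟨n - 2, by omega⟩) ^ (m : ℕ) else 0) *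
      (ξ * (v ⟨n - 1, by omega⟩) ^ (n - 2) +
        ∑ m : Fin n, if (m : ℕ) < n - 2 then v m * (v ⟨n - 1, by omega⟩) ^ (m : ℕ) else 0)| := by
  obtain ⟨N, rfl⟩ : ∃ N, n = N + 2 := ⟨n - 2, by omega⟩
  exact main_aux N (by omega) ξ v
end

section
/- Let n ≥ 2, let I = [a,b) ⊂ ℝ be a finite interval with |I| ≤ 1, and let 0 < ξ ≤ 1. Let M_n(ξ,I) ⊂ ℝ^n be the set of coefficient vectors (p_{n−1},…,p_1,p_0) with max_i |p_i| ≤ 1 such that the polynomial p(x) = ξx^n + p_{n−1}x^{n−1} + ⋯ + p_1 x + p_0 has at least 2 roots (counted with multiplicity) in I. Then the n-dimensional Lebesgue measure of M_n(ξ,I) is at most λ(n)·(ξ + ρ^{−3})²·|I|³, where ρ = max(1, |a+b|/2) and λ(n) is a constant depending only on n. -/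
open MeasureTheory Polynomial
open scoped Classical

/-- `M_n(ξ,I)` for `I = [a,b)`: coefficient vectors `c = (p_0, …, p_{n-1}) ∈ ℝ^n` with
`max_i |p_i| ≤ 1` such that `ξ x^n + p_{n-1} x^{n-1} + ⋯ + p_0` has at least two real roots
(counted with multiplicity) in `[a,b)`. -/
noncomputable def Mset (n : ℕ) (ξ a b : ℝ) : Set (Fin n → ℝ) :=
  {c | (∀ i, |c i| ≤ 1) ∧
    2 ≤ Multiset.countP (fun x => x ∈ Set.Ico a b)
      ((C ξ * X ^ n + ∑ i : Fin n, C (c i) * X ^ (i : ℕ)).roots)}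


theorem aux_vol {n : ℕ} (S : Set (Fin n → ℝ)) (k l : Fin n) (hkl : k ≠ l)
    (f g : (Fin n → ℝ) →ₗ[ℝ] ℝ) (s t A B : ℝ) (hA : 0 ≤ A) (hB : 0 ≤ B)
    (hf : f (Pi.single k 1) = 1) (hg : g (Pi.single l 1) = 1) (hgk : g (Pi.single k 1) = 0)
    (h1 : ∀ c ∈ S, ∀ i, |c i| ≤ 1) (h2 : ∀ c ∈ S, |s + f c| ≤ A) (h3 : ∀ c ∈ S, |t + g c| ≤ B) :
    volume S ≤ ENNReal.ofReal (2 ^ n * (A * B)) := by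
  set f' : Module.Dual ℝ (Fin n → ℝ) := f - LinearMap.proj k with hf'
  set g' : Module.Dual ℝ (Fin n → ℝ) := g - LinearMap.proj l with hg'
  have hfk : f' (Pi.single k 1) = 0 := by simp [hf', hf]
  have hgl : g' (Pi.single l 1) = 0 := by simp [hg', hg]
  have hgk' : g' (Pi.single k 1) = 0 := by simp [hg', hgk, hkl.symm]
  set T := (LinearMap.transvection g' (Pi.single l 1)) ∘ₗ (LinearMap.transvection f' (Pi.single k 1))
  have hdet : LinearMap.det T = 1 := by
    rw [LinearMap.det_comp]
    rw [LinearMap.transvection.det, LinearMap.transvection.det, hfk, hgl]; simp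
  have hT : ∀ c i, T c i = if i = k then f c else if i = l then g c else c i := by
    intro c i
    simp only [T, LinearMap.comp_apply, LinearMap.transvection.apply, map_add, map_smul, hgk']
    by_cases hik : i = k
    · subst hik
      simp [hf', hkl]
    · by_cases hil : i = l
      · subst hil
        simp [hg', hik]
      · simp [hik, hil]
  set ctr : Fin n → ℝ := fun i => if i = k then -s else if i = l then -t else 0 with hctr
  set r : Fin n → ℝ := fun i => if i = k then A else if i = l then B else 1 with hr
  have hsub : S ⊆ T ⁻¹' (Set.Icc (ctr - r) (ctr + r)) := by
    intro c hc
    have key : ∀ i, |T c i - ctr i| ≤ r i := by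
      intro i
      rw [hT]
      simp only [hctr, hr]
      split_ifs
      · have := h2 c hc
        rwa [add_comm, ← sub_neg_eq_add] at this
      · have := h3 c hc
        rwa [add_comm, ← sub_neg_eq_add] at this
      · simpa using h1 c hc i
    refine ⟨fun i => ?_, fun i => ?_⟩
    · have := abs_le.1 (key i); simp only [Pi.sub_apply]; linarith
    · have := abs_le.1 (key i); simp only [Pi.add_apply]; linarith
  refine (measure_mono hsub).trans ?_
  rw [Measure.addHaar_preimage_linearMap _ (by rw [hdet]; exact one_ne_zero), hdet, Real.volume_Icc_pi]
  have hr0 : ∀ i, 0 ≤ r i := by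
    intro i; simp only [hr]; split_ifs <;> first | assumption | norm_num
  rw [← ENNReal.ofReal_prod_of_nonneg]
  · simp only [inv_one, abs_one, ENNReal.ofReal_one, one_mul]
    apply ENNReal.ofReal_le_ofReal
    have : ∀ i, (ctr + r) i - (ctr - r) i = 2 * r i := by intro i; simp; ring
    simp only [this]
    rw [Finset.prod_mul_distrib]
    simp only [Finset.prod_const, Finset.card_univ, Fintype.card_fin]
    have : ∏ i, r i = A * B := by
      rw [← Finset.mul_prod_erase _ _ (Finset.mem_univ k),
        ← Finset.mul_prod_erase _ _ (Finset.mem_erase.2 ⟨hkl.symm, Finset.mem_univ l⟩),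
        Finset.prod_eq_one]
      · simp [hr, hkl.symm]
      · intro i hi
        simp only [Finset.mem_erase] at hi
        simp [hr, hi.1, hi.2.1]
    rw [this]
  · intro i _
    have := hr0 i
    simp only [Pi.add_apply, Pi.sub_apply]; linarith

theorem aux_mvt (a b K : ℝ) (f f' : ℝ → ℝ) (hf : ∀ x ∈ Set.Icc a b, HasDerivAt f (f' x) x)
    (hK : ∀ x ∈ Set.Icc a b, |f' x| ≤ K) (x y : ℝ) (hx : x ∈ Set.Icc a b) (hy : y ∈ Set.Icc a b)
    (hx0 : f x = 0) : |f y| ≤ K * (b - a) := by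
  have := (convex_Icc a b).norm_image_sub_le_of_norm_hasDerivWithin_le
    (fun x hx => (hf x hx).hasDerivWithinAt) (C := K) (by simpa using hK) hx hy
  rw [hx0] at this
  simp only [sub_zero, Real.norm_eq_abs] at this
  refine this.trans ?_
  have h0 : 0 ≤ K := (abs_nonneg _).trans (hK x hx)
  gcongr
  rw [abs_le]; constructor <;> linarith [hx.1, hx.2, hy.1, hy.2]

theorem aux_roots (p : ℝ[X]) (a b : ℝ)
    (h : 2 ≤ Multiset.countP (fun x => x ∈ Set.Ico a b) p.roots) :
    ∃ x y, x ∈ Set.Icc a b ∧ y ∈ Set.Icc a b ∧ p.eval x = 0 ∧ p.eval y = 0 ∧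
      (x < y ∨ (x = y ∧ p.derivative.eval x = 0)) := by
  rw [Multiset.countP_eq_card_filter] at h
  have hex : ∃ x y, ({x, y} : Multiset ℝ) ≤ p.roots.filter (fun x => x ∈ Set.Ico a b) := by
    obtain ⟨x, hx⟩ := Multiset.card_pos_iff_exists_mem.1 (lt_of_lt_of_le two_pos h)
    obtain ⟨s, hs⟩ := Multiset.exists_cons_of_mem hx
    rw [hs] at h ⊢
    rw [Multiset.card_cons] at h
    obtain ⟨y, hy⟩ := Multiset.card_pos_iff_exists_mem.1 (show 0 < s.card by omega)
    exact ⟨x, y, Multiset.cons_le_cons x (Multiset.singleton_le.2 hy)⟩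
  obtain ⟨x, y, ht⟩ := hex
  have hx := Multiset.mem_of_le ht (show x ∈ ({x, y} : Multiset ℝ) by simp)
  have hy := Multiset.mem_of_le ht (show y ∈ ({x, y} : Multiset ℝ) by simp)
  rw [Multiset.mem_filter] at hx hy
  have hp : p ≠ 0 := (mem_roots'.1 hx.1).1
  have ex : p.eval x = 0 := (mem_roots'.1 hx.1).2
  have ey : p.eval y = 0 := (mem_roots'.1 hy.1).2
  have ix := Set.Ico_subset_Icc_self hx.2
  have iy := Set.Ico_subset_Icc_self hy.2
  rcases lt_trichotomy x y with hxy | hxy | hxy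
  · exact ⟨x, y, ix, iy, ex, ey, Or.inl hxy⟩
  · subst hxy
    refine ⟨x, x, ix, ix, ex, ex, Or.inr ⟨rfl, ?_⟩⟩
    have h2 := Multiset.count_le_of_le x (ht.trans (Multiset.filter_le _ _))
    rw [count_roots] at h2
    have h3 : 1 < p.rootMultiplicity x := by
      have : Multiset.count x ({x, x} : Multiset ℝ) = 2 := by simp
      omega
    exact ((one_lt_rootMultiplicity_iff_isRoot hp).1 h3).2
  · exact ⟨y, x, iy, ix, ey, ex, Or.inl hxy⟩

theorem aux_main {n : ℕ} (ξ a b K : ℝ) (hab : a < b) (k l : Fin n) (hkl : k ≠ l) (hξ : 0 < ξ)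
    (u : ℝ → ℝ) (hu : ∀ x ∈ Set.Icc a b, DifferentiableAt ℝ u x)
    (w w' w'' : ℕ → ℝ → ℝ)
    (hwu : ∀ i x, x ∈ Set.Icc a b → w i x = x ^ i * u x)
    (hw : ∀ i, ∀ x ∈ Set.Icc a b, HasDerivAt (w i) (w' i x) x)
    (hw' : ∀ i, ∀ x ∈ Set.Icc a b, HasDerivAt (w' i) (w'' i x) x)
    (hK : ∀ x ∈ Set.Icc a b, ξ * |w'' n x| + ∑ i : Fin n, |w'' i x| ≤ K)
    (h1 : w k ((a + b) / 2) = 1) (h2 : w' k ((a + b) / 2) = 0) (h3 : w' l ((a + b) / 2) = 1) :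
    volume (Mset n ξ a b) ≤ ENNReal.ofReal (2 ^ n * K ^ 2 * (b - a) ^ 3) := by
  set m := (a + b) / 2 with hm
  have hmI : m ∈ Set.Icc a b := ⟨by linarith, by linarith⟩
  have hK0 : 0 ≤ K := le_trans (by positivity) (hK m hmI)
  have key : ∀ c ∈ Mset n ξ a b,
      |ξ * w n m + ∑ i : Fin n, c i * w i m| ≤ K * (b - a) * (b - a) ∧
      |ξ * w' n m + ∑ i : Fin n, c i * w' i m| ≤ K * (b - a) := by
    intro c hc
    obtain ⟨hc1, hc2⟩ := hc
    set p := (C ξ * X ^ n + ∑ i : Fin n, C (c i) * X ^ (i : ℕ)) with hp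
    set F : ℝ → ℝ := fun x => ξ * w n x + ∑ i : Fin n, c i * w i x with hF
    set F' : ℝ → ℝ := fun x => ξ * w' n x + ∑ i : Fin n, c i * w' i x with hF'
    set F'' : ℝ → ℝ := fun x => ξ * w'' n x + ∑ i : Fin n, c i * w'' i x with hF''
    have dF : ∀ x ∈ Set.Icc a b, HasDerivAt F (F' x) x := by
      intro x hx
      exact ((hw n x hx).const_mul ξ).add
        (HasDerivAt.fun_sum fun i _ => (hw i x hx).const_mul (c i))
    have dF' : ∀ x ∈ Set.Icc a b, HasDerivAt F' (F'' x) x := by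
      intro x hx
      exact ((hw' n x hx).const_mul ξ).add
        (HasDerivAt.fun_sum fun i _ => (hw' i x hx).const_mul (c i))
    have bF : ∀ x ∈ Set.Icc a b, |F'' x| ≤ K := by
      intro x hx
      refine le_trans ?_ (hK x hx)
      refine (abs_add_le _ _).trans ?_
      rw [abs_mul, abs_of_pos hξ]
      gcongr
      refine (Finset.abs_sum_le_sum_abs _ _).trans ?_
      refine Finset.sum_le_sum fun i _ => ?_
      rw [abs_mul]
      exact mul_le_of_le_one_left (abs_nonneg _) (hc1 i)
    have Fp : ∀ x ∈ Set.Icc a b, F x = p.eval x * u x := by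
      intro x hx
      simp only [hF, hp, eval_add, eval_mul, eval_C, eval_pow, eval_X, eval_finsetSum, add_mul,
        Finset.sum_mul]
      rw [hwu n x hx, mul_assoc]
      congr 1
      refine Finset.sum_congr rfl fun i _ => ?_
      rw [hwu i x hx, mul_assoc]
    obtain ⟨x, y, hx, hy, ex, ey, hxy⟩ := aux_roots p a b hc2
    have Fx : F x = 0 := by rw [Fp x hx, ex, zero_mul]
    have Fy : F y = 0 := by rw [Fp y hy, ey, zero_mul]
    have hz : ∃ z ∈ Set.Icc a b, F' z = 0 := by
      rcases hxy with hlt | ⟨rfl, hd⟩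
      · have hsub : Set.Icc x y ⊆ Set.Icc a b := Set.Icc_subset_Icc hx.1 hy.2
        obtain ⟨z, hz, hz0⟩ := exists_hasDerivAt_eq_zero (f := F) (f' := F') hlt
          (fun t ht => (dF t (hsub ht)).continuousAt.continuousWithinAt) (Fx.trans Fy.symm)
          (fun t ht => dF t (hsub (Set.Ioo_subset_Icc_self ht)))
        exact ⟨z, hsub (Set.Ioo_subset_Icc_self hz), hz0⟩
      · refine ⟨x, hx, ?_⟩
        have e1 := (dF x hx).hasDerivWithinAt (s := Set.Icc a b)
        have e2 := ((p.hasDerivAt x).mul (hu x hx).hasDerivAt).hasDerivWithinAt (s := Set.Icc a b)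
        rw [hd, ex, zero_mul, zero_mul, add_zero] at e2
        have e3 := e2.congr (f₁ := F) (fun t ht => Fp t ht) (Fp x hx)
        exact (uniqueDiffOn_Icc hab x hx).eq_deriv _ e1 e3
    obtain ⟨z, hz, hz0⟩ := hz
    have B1 : ∀ t ∈ Set.Icc a b, |F' t| ≤ K * (b - a) := fun t ht =>
      aux_mvt a b K F' F'' dF' bF z t hz ht hz0
    exact ⟨aux_mvt a b _ F F' dF B1 x m hx hmI Fx, B1 m hmI⟩
  obtain ⟨L, hL⟩ : ∃ L : (ℕ → ℝ) → ((Fin n → ℝ) →ₗ[ℝ] ℝ),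
      ∀ v c, L v c = ∑ i : Fin n, c i * v i := by
    refine ⟨fun v => ∑ i : Fin n, v i • LinearMap.proj i, ?_⟩
    intro v c
    simp [LinearMap.sum_apply, mul_comm]
  have hLs : ∀ v (j : Fin n), L v (Pi.single j 1) = v j := by
    intro v j
    rw [hL, Finset.sum_eq_single j]
    · simp
    · intro i _ hij; simp [hij]
    · simp
  have hba : 0 ≤ b - a := by linarith
  refine (aux_vol (Mset n ξ a b) k l hkl (L fun i => w i m) (L fun i => w' i m)
    (ξ * w n m) (ξ * w' n m) (K * (b - a) * (b - a)) (K * (b - a)) (by positivity) (by positivity)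
    (by rw [hLs]; exact h1) (by rw [hLs]; exact h3) (by rw [hLs]; exact h2) (fun c hc => hc.1)
    (fun c hc => by rw [hL]; exact (key c hc).1) (fun c hc => by rw [hL]; exact (key c hc).2)).trans ?_
  apply le_of_eq
  congr 1
  ring

theorem aux_case1 (n : ℕ) (hn : 2 ≤ n) (a b ξ : ℝ) (hab : a < b) (hb : b - a ≤ 1) (hξ : 0 < ξ)
    (hξ1 : ξ ≤ 1) (hm : |a + b| / 2 < 1) :
    volume (Mset n ξ a b) ≤
      ENNReal.ofReal (2 ^ n * (((n : ℝ) + 1) * (n ^ 2 * 2 ^ n)) ^ 2 * (b - a) ^ 3) := by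
  have hm' := abs_lt.1 (show |a + b| < 2 by linarith)
  refine aux_main ξ a b _ hab ⟨0, by omega⟩ ⟨1, by omega⟩ (by simp) hξ (fun _ => 1)
    (fun x _ => differentiableAt_const _) (fun i x => x ^ i) (fun i x => i * x ^ (i - 1))
    (fun i x => i * ((i - 1 : ℕ) * x ^ (i - 1 - 1))) (by simp) (fun i x _ => hasDerivAt_pow i x)
    (fun i x _ => (hasDerivAt_pow (i - 1) x).const_mul _) ?_ (by simp) (by simp) (by simp)
  intro x hx
  have hx2 : |x| ≤ 2 := abs_le.2 ⟨by linarith [hx.1], by linarith [hx.2]⟩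
  have hB : ∀ i : ℕ, i ≤ n →
      |(i : ℝ) * ((i - 1 : ℕ) * x ^ (i - 1 - 1))| ≤ n ^ 2 * 2 ^ n := by
    intro i hi
    rw [abs_mul, abs_mul, abs_pow, Nat.abs_cast, Nat.abs_cast, sq, mul_assoc]
    gcongr
    · omega
    · calc |x| ^ (i - 1 - 1) ≤ 2 ^ (i - 1 - 1) := by gcongr
        _ ≤ 2 ^ n := pow_le_pow_right₀ (by norm_num) (by omega)
  calc _ ≤ 1 * ((n : ℝ) ^ 2 * 2 ^ n) + ∑ i : Fin n, ((n : ℝ) ^ 2 * 2 ^ n) := by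
        gcongr with i
        · exact hB n le_rfl
        · exact hB i i.2.le
    _ = _ := by
        simp only [Finset.sum_const, Finset.card_univ, Fintype.card_fin, nsmul_eq_mul]; ring

theorem aux_case2 (n : ℕ) (hn : 2 ≤ n) (a b ξ : ℝ) (hab : a < b) (hb : b - a ≤ 1) (hξ : 0 < ξ)
    (hm : 1 ≤ |a + b| / 2) :
    volume (Mset n ξ a b) ≤
      ENNReal.ofReal (2 ^ n * (2 * ξ + n * (n ^ 2 * (8 * 2 ^ n * (|a + b| / 2)⁻¹ ^ 3))) ^ 2
        * (b - a) ^ 3) := by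
  set ρ := |a + b| / 2 with hρ
  have hxρ : ∀ x ∈ Set.Icc a b, ρ / 2 ≤ |x| := by
    intro x hx
    have h1 : |a + b - 2 * x| ≤ 1 := abs_le.2 ⟨by linarith [hx.1, hx.2], by linarith [hx.1, hx.2]⟩
    have h2 : |a + b| ≤ |a + b - 2 * x| + |2 * x| := by
      simpa using abs_add_le (a + b - 2 * x) (2 * x)
    rw [abs_mul, abs_two] at h2
    linarith
  have hx0 : ∀ x ∈ Set.Icc a b, x ≠ 0 := by
    intro x hx h
    have := hxρ x hx
    rw [h, abs_zero] at this
    linarith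
  have hmI : (a + b) / 2 ∈ Set.Icc a b := ⟨by linarith, by linarith⟩
  have hn2 : ((n - 2 : ℕ) : ℤ) = (n : ℤ) - 2 := by omega
  have hn1 : ((n - 1 : ℕ) : ℤ) = (n : ℤ) - 1 := by omega
  refine aux_main ξ a b _ hab ⟨n - 2, by omega⟩ ⟨n - 1, by omega⟩ (by simp; omega) hξ
    (fun x => x ^ (-((n : ℤ) - 2)))
    (fun x hx => (hasDerivAt_zpow _ x (Or.inl (hx0 x hx))).differentiableAt)
    (fun i x => x ^ ((i : ℤ) - (n - 2)))
    (fun i x => (((i : ℤ) - (n - 2) : ℤ) : ℝ) * x ^ ((i : ℤ) - (n - 2) - 1))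
    (fun i x => (((i : ℤ) - (n - 2) : ℤ) : ℝ) * ((((i : ℤ) - (n - 2) - 1 : ℤ) : ℝ) *
      x ^ ((i : ℤ) - (n - 2) - 1 - 1)))
    ?_ (fun i x hx => hasDerivAt_zpow _ x (Or.inl (hx0 x hx)))
    (fun i x hx => (hasDerivAt_zpow _ x (Or.inl (hx0 x hx))).const_mul _) ?_
    (by simp [hn2]) (by simp [hn2]) ?_
  · intro i x hx
    rw [sub_eq_add_neg, zpow_add₀ (hx0 x hx), zpow_natCast]
  · intro x hx
    have hxp : 0 < |x| := abs_pos.2 (hx0 x hx)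
    have hρ0 : 0 < ρ := by linarith
    have hB : ∀ i : ℕ, i < n → |(((i : ℤ) - (n - 2) : ℤ) : ℝ) * ((((i : ℤ) - (n - 2) - 1 : ℤ) : ℝ) *
      x ^ ((i : ℤ) - (n - 2) - 1 - 1))| ≤ n ^ 2 * (8 * 2 ^ n * ρ⁻¹ ^ 3) := by
      intro i hi
      by_cases h1 : i = n - 1
      · have : (i : ℤ) - (n - 2) - 1 = 0 := by omega
        rw [this]; simp; positivity
      by_cases h2 : i = n - 2
      · have : (i : ℤ) - (n - 2) = 0 := by omega
        rw [this]; simp; positivity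
      obtain ⟨j, hj⟩ : ∃ j, n = i + 3 + j := ⟨n - i - 3, by omega⟩
      have he : (i : ℤ) - (n - 2) - 1 - 1 = -((3 + j : ℕ) : ℤ) := by push_cast; omega
      rw [he, zpow_neg, zpow_natCast, abs_mul, abs_mul, abs_inv, abs_pow, sq, mul_assoc]
      have hi1 : |x|⁻¹ ≤ 2 * ρ⁻¹ := by
        rw [← div_eq_mul_inv, ← inv_div]
        exact inv_anti₀ (by positivity) (hxρ x hx)
      have hi2 : |x|⁻¹ ≤ 2 := hi1.trans (by
        have : ρ⁻¹ ≤ 1 := inv_le_one_of_one_le₀ hm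
        linarith)
      have hn0 : (n : ℝ) = i + 3 + j := by exact_mod_cast hj
      have hi0 : (0 : ℝ) ≤ i := Nat.cast_nonneg i
      have hj0 : (0 : ℝ) ≤ j := Nat.cast_nonneg j
      gcongr
      · push_cast
        rw [abs_le]; constructor <;> linarith
      · push_cast
        rw [abs_le]; constructor <;> linarith
      · rw [← inv_pow, pow_add]
        calc |x|⁻¹ ^ 3 * |x|⁻¹ ^ j ≤ (2 * ρ⁻¹) ^ 3 * 2 ^ j := by gcongr
          _ ≤ (2 * ρ⁻¹) ^ 3 * 2 ^ n := by
              gcongr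
              · norm_num
              · omega
          _ = _ := by ring
    have hN : |(((n : ℤ) - (n - 2) : ℤ) : ℝ) * ((((n : ℤ) - (n - 2) - 1 : ℤ) : ℝ) *
      x ^ ((n : ℤ) - (n - 2) - 1 - 1))| = 2 := by
      have : (n : ℤ) - (n - 2) = 2 := by ring
      rw [this]; norm_num
    calc _ ≤ ξ * 2 + ∑ i : Fin n, ((n : ℝ) ^ 2 * (8 * 2 ^ n * ρ⁻¹ ^ 3)) := by
          gcongr with i
          · exact hN.le
          · exact hB i i.2
      _ = _ := by
          simp only [Finset.sum_const, Finset.card_univ, Fintype.card_fin, nsmul_eq_mul]; ring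
  · have : ((n - 1 : ℕ) : ℤ) - (n - 2) = 1 := by omega
    simp only [this]; simp

theorem measure_two_roots_bound (n : ℕ) (hn : 2 ≤ n) :
    ∃ lam : ℝ, 0 < lam ∧ ∀ a b ξ : ℝ, a < b → b - a ≤ 1 → 0 < ξ → ξ ≤ 1 →
      volume (Mset n ξ a b) ≤
        ENNReal.ofReal (lam * (ξ + (max 1 (|a + b| / 2))⁻¹ ^ 3) ^ 2 * (b - a) ^ 3) := by
  have hn0 : (2 : ℝ) ≤ n := by exact_mod_cast hn
  set D : ℝ := ((n : ℝ) + 1) * (n ^ 2 * (8 * 2 ^ n)) with hD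
  have hD0 : 0 < D := by positivity
  have hE : 0 ≤ (n : ℝ) ^ 2 * 2 ^ n := by positivity
  refine ⟨2 ^ n * D ^ 2, by positivity, ?_⟩
  intro a b ξ hab hb hξ hξ1
  have hba : 0 ≤ b - a := by linarith
  rcases lt_or_ge (|a + b| / 2) 1 with hm | hm
  · refine (aux_case1 n hn a b ξ hab hb hξ hξ1 hm).trans (ENNReal.ofReal_le_ofReal ?_)
    rw [max_eq_left hm.le, inv_one, one_pow, mul_assoc (2 ^ n) (D ^ 2), ← mul_pow]
    have h5 : ((n : ℝ) + 1) * (n ^ 2 * 2 ^ n) ≤ D * (ξ + 1) := by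
      calc ((n : ℝ) + 1) * (n ^ 2 * 2 ^ n) ≤ D * 1 := by rw [hD]; nlinarith
        _ ≤ D * (ξ + 1) := by gcongr; linarith
    have h6 := pow_le_pow_left₀ (by positivity) h5 2
    exact mul_le_mul_of_nonneg_right (mul_le_mul_of_nonneg_left h6 (by positivity)) (by positivity)
  · refine (aux_case2 n hn a b ξ hab hb hξ hm).trans (ENNReal.ofReal_le_ofReal ?_)
    rw [max_eq_right hm, mul_assoc (2 ^ n) (D ^ 2), ← mul_pow]
    set r := (|a + b| / 2)⁻¹ ^ 3 with hr
    have hr0 : 0 ≤ r := by positivity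
    gcongr
    have h1 : 2 ≤ D := by
      have : (1 : ℝ) ≤ 2 ^ n := one_le_pow₀ (by norm_num)
      have h4 : (4 : ℝ) ≤ n ^ 2 := by nlinarith
      have : (4 : ℝ) ≤ n ^ 2 * 2 ^ n := by nlinarith
      rw [hD]; nlinarith
    have h2 : (n : ℝ) * (n ^ 2 * (8 * 2 ^ n)) ≤ D := by rw [hD]; nlinarith
    calc 2 * ξ + n * (n ^ 2 * (8 * 2 ^ n * r)) = 2 * ξ + n * (n ^ 2 * (8 * 2 ^ n)) * r := by ring
      _ ≤ D * ξ + D * r := by gcongr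
      _ = _ := by ring
end

section
/- Let V ⊂ ℝ^k be a bounded measurable region symmetric with respect to the origin (x ∈ V iff −x ∈ V), let v ∈ ℝ^k be a nonzero vector, and let ε > 0. For η > 0 set V(η) = {x ∈ V : |v·x| < η}. Then for every 0 < λ < 1: (1−λ)·ε·mes_k V(λε) ≤ ∫_V |v·x + ε| dx − ∫_V |v·x| dx ≤ ε·mes_k V(ε). Moreover, if V(ε) = V then ∫_V |v·x + ε| dx = ε·mes_k V. -/
open MeasureTheory

theorem integral_shift_estimate (k : ℕ) (V : Set (Fin k → ℝ))
    (hVb : Bornology.IsBounded V) (hVm : MeasurableSet V)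
    (hsymm : ∀ x : Fin k → ℝ, x ∈ V ↔ -x ∈ V)
    (v : Fin k → ℝ) (hv : v ≠ 0) (ε : ℝ) (hε : 0 < ε) :
    (∀ lam : ℝ, 0 < lam → lam < 1 →
      (1 - lam) * ε *
          (volume {x ∈ V | |∑ i, v i * x i| < lam * ε}).toReal ≤
        (∫ x in V, |(∑ i, v i * x i) + ε|) - ∫ x in V, |∑ i, v i * x i| ∧
      (∫ x in V, |(∑ i, v i * x i) + ε|) - (∫ x in V, |∑ i, v i * x i|) ≤
        ε * (volume {x ∈ V | |∑ i, v i * x i| < ε}).toReal) ∧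
    ({x ∈ V | |∑ i, v i * x i| < ε} = V →
      (∫ x in V, |(∑ i, v i * x i) + ε|) = ε * (volume V).toReal) := by
  set f : (Fin k → ℝ) → ℝ := fun x => ∑ i, v i * x i with hf
  have hfc : Continuous f := by fun_prop
  have hfn : ∀ x, f (-x) = - f x := by
    intro x; simp [hf]
  have hint : ∀ g : (Fin k → ℝ) → ℝ, Continuous g → IntegrableOn g V := by
    intro g hg
    exact (hg.continuousOn.integrableOn_compact hVb.isCompact_closure).mono_set subset_closure
  have hflip : (∫ x in V, |f x + ε|) = ∫ x in V, |f x - ε| := by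
    rw [← integral_indicator hVm, ← integral_indicator hVm,
      ← integral_neg_eq_self (V.indicator fun x => |f x + ε|)]
    congr 1
    ext x
    by_cases hx : x ∈ V
    · rw [Set.indicator_of_mem hx, Set.indicator_of_mem ((hsymm x).1 hx), hfn, ← abs_neg]
      congr 1; ring
    · rw [Set.indicator_of_notMem hx, Set.indicator_of_notMem (fun h => hx ((hsymm x).2 h))]
  have hkey : (∫ x in V, |f x + ε|) = ∫ x in V, max |f x| ε := by
    have h2 : (∫ x in V, |f x + ε|) + (∫ x in V, |f x - ε|) = 2 * ∫ x in V, max |f x| ε := by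
      rw [← integral_add (hint _ (by fun_prop)) (hint _ (by fun_prop)), ← integral_const_mul]
      congr 1
      ext x
      rcases le_total |f x| ε with h | h
      · rw [max_eq_right h]
        have := abs_le.1 h
        rw [abs_of_nonneg (by linarith), abs_of_nonpos (by linarith)]; ring
      · rw [max_eq_left h]
        rcases le_abs.1 h with h' | h'
        · rw [abs_of_nonneg (by linarith), abs_of_nonneg (by linarith),
            abs_of_nonneg (by linarith)]; ring
        · rw [abs_of_nonpos (by linarith), abs_of_nonpos (by linarith),
            abs_of_nonpos (by linarith)]; ring
    linarith
  have hdiff : (∫ x in V, |f x + ε|) - (∫ x in V, |f x|) = ∫ x in V, (max |f x| ε - |f x|) := by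
    rw [hkey, integral_sub (hint _ (by fun_prop)) (hint _ (by fun_prop))]
  have hS : ∀ η : ℝ, MeasurableSet {x | |f x| < η} := fun η =>
    (isOpen_lt (by fun_prop) (by fun_prop)).measurableSet
  have hfin : volume V ≠ ⊤ := hVb.measure_lt_top.ne
  have hind : ∀ η c : ℝ, (∫ x in V, ({x | |f x| < η}).indicator (fun _ => c) x)
      = c * (volume {x ∈ V | |f x| < η}).toReal := by
    intro η c
    rw [setIntegral_indicator (hS η), setIntegral_const, smul_eq_mul, mul_comm]
    rfl
  have hindi : ∀ η c : ℝ, IntegrableOn (({x | |f x| < η}).indicator (fun _ => c)) V := by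
    intro η c
    exact (integrableOn_const hfin).indicator (hS η)
  refine ⟨fun lam h0 h1 => ⟨?_, ?_⟩, fun h => ?_⟩
  · change _ ≤ (∫ x in V, |f x + ε|) - (∫ x in V, |f x|)
    rw [hdiff]
    refine (hind (lam * ε) ((1 - lam) * ε)).symm.le.trans ?_
    refine integral_mono (hindi _ _) (hint _ (by fun_prop)) fun x => ?_
    by_cases hx : |f x| < lam * ε
    · rw [Set.indicator_of_mem (by exact hx)]
      have := le_max_right |f x| ε
      dsimp only
      linarith
    · rw [Set.indicator_of_notMem (by exact hx)]
      have := le_max_left |f x| ε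
      dsimp only
      linarith
  · change (∫ x in V, |f x + ε|) - (∫ x in V, |f x|) ≤ _
    rw [hdiff]
    refine le_trans ?_ (hind ε ε).le
    refine integral_mono (hint _ (by fun_prop)) (hindi _ _) fun x => ?_
    by_cases hx : |f x| < ε
    · rw [Set.indicator_of_mem (by exact hx)]
      dsimp only
      rw [max_eq_right hx.le]
      linarith [abs_nonneg (f x)]
    · rw [Set.indicator_of_notMem (by exact hx)]
      dsimp only
      rw [max_eq_left (not_lt.1 hx)]
      linarith
  · change (∫ x in V, |f x + ε|) = _
    have h3 : (∫ x in V, max |f x| ε) = ∫ x in V, ε := by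
      refine setIntegral_congr_fun hVm fun x hx => ?_
      rw [← h] at hx
      exact max_eq_right (le_of_lt hx.2)
    rw [hkey, h3, setIntegral_const, smul_eq_mul, mul_comm]
    rfl
end

section
/- Fix an integer n ≥ 2 and an integer 1 ≤ k ≤ n. For a finite interval I ⊂ ℝ, let N_n(Q,k,I) be the number of irreducible monic integer polynomials of degree n and height at most Q having exactly k roots in I, and for 0 < ξ ≤ 1 let G_n(ξ,k,I) ⊂ ℝ^n be the set of coefficient vectors (p_{n−1},…,p_0) with max_i |p_i| ≤ 1 such that ξx^n + p_{n−1}x^{n−1} + ⋯ + p_0 has exactly k roots (counted with multiplicity) in I. Then N_n(Q,k,I) = Q^n·mes_n G_n(Q^{−1},k,I) + O(Q^{n−1}(ln Q)^{δ(n)}) as Q → ∞, where δ(n)=1 if n≤2 and δ(n)=0 if n≥3, and the implicit constant depends only on n. -/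
open MeasureTheory Polynomial
open scoped Classical

/-- `N_n(Q,k,I)` for `I = [a,b)`: the number of irreducible monic integer polynomials of
degree `n` and height at most `Q` having exactly `k` real roots (with multiplicity) in `I`.
Here "irreducible" means: not a product of two integer polynomials of degree at least 1. -/
noncomputable def Ncount (n k : ℕ) (Q a b : ℝ) : ℕ :=
  {p : Polynomial ℤ | p.Monic ∧ p.natDegree = n ∧ (∀ i, (|p.coeff i| : ℝ) ≤ Q) ∧
    (¬ ∃ q r : Polynomial ℤ, 1 ≤ q.natDegree ∧ 1 ≤ r.natDegree ∧ p = q * r) ∧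
    Multiset.countP (fun x => x ∈ Set.Ico a b)
      ((p.map (Int.castRingHom ℝ)).roots) = k}.ncard

/-- `G_n(ξ,k,I)` for `I = [a,b)`: coefficient vectors `(p_0, …, p_{n-1}) ∈ ℝ^n` with
`max_i |p_i| ≤ 1` such that `ξ x^n + p_{n-1} x^{n-1} + ⋯ + p_0` has exactly `k` real roots
(with multiplicity) in `I`. -/
noncomputable def GsetCount (n k : ℕ) (ξ a b : ℝ) : Set (Fin n → ℝ) :=
  {c | (∀ i, |c i| ≤ 1) ∧
    Multiset.countP (fun x => x ∈ Set.Ico a b)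
      ((C ξ * X ^ n + ∑ i : Fin n, C (c i) * X ^ (i : ℕ)).roots) = k}

/-- `δ(n) = 1` for `n ≤ 2` and `δ(n) = 0` for `n ≥ 3`. -/
def deltaExp (n : ℕ) : ℕ := if n ≤ 2 then 1 else 0

noncomputable def rc (a b : ℝ) (p : ℝ[X]) : ℕ :=
  Multiset.countP (fun x => x ∈ Set.Ico a b) p.roots

lemma ordc_aux (A : Set ℝ) (hA : A.OrdConnected) {s t : ℝ} (hst : s ≤ t)
    (h1 : sInf A ∉ Set.Icc s t) (h2 : sSup A ∉ Set.Icc s t) : s ∈ A ↔ t ∈ A := by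
  constructor
  · intro hs
    by_contra ht
    have hub : ∀ x ∈ A, x ≤ t := by
      intro x hx
      by_contra h
      exact ht (hA.out hs hx ⟨hst, by linarith⟩)
    exact h2 ⟨le_csSup ⟨t, hub⟩ hs, csSup_le ⟨s, hs⟩ hub⟩
  · intro ht
    by_contra hs
    have hub : ∀ x ∈ A, s ≤ x := by
      intro x hx
      by_contra h
      exact hs (hA.out hx ht ⟨by linarith, hst⟩)
    exact h1 ⟨le_csInf ⟨t, ht⟩ hub, csInf_le ⟨s, hub⟩ ht⟩

lemma rm_zero (g : ℝ[X]) (i : ℕ) {s t : ℝ} (hs : s ≠ - g.coeff i) (ht : t ≠ - g.coeff i) :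
    (g + C s * X ^ i).rootMultiplicity 0 = (g + C t * X ^ i).rootMultiplicity 0 := by
  rw [rootMultiplicity_eq_natTrailingDegree', rootMultiplicity_eq_natTrailingDegree']
  have : (g + C s * X ^ i).support = (g + C t * X ^ i).support := by
    ext j
    simp only [mem_support_iff, coeff_add, coeff_C_mul, coeff_X_pow]
    by_cases hj : j = i
    · subst hj
      simp only [if_true, mul_one]
      constructor <;> intro _ h
      · exact ht (by linarith)
      · exact hs (by linarith)
    · simp [hj]
  unfold natTrailingDegree trailingDegree
  rw [this]

/-- the piece just after `d` -/
def piece (D : Finset ℝ) (d : ℝ) : Set ℝ := {x | d < x ∧ ∀ e ∈ D, d < e → x < e}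

lemma piece_ordc (D : Finset ℝ) (d : ℝ) : (piece D d).OrdConnected := by
  refine ⟨fun x hx y hy z hz => ⟨lt_of_lt_of_le hx.1 hz.1, fun e he hde => ?_⟩⟩
  exact lt_of_le_of_lt hz.2 (hy.2 e he hde)

lemma piece_not_mem (D : Finset ℝ) (d : ℝ) {x : ℝ} (hx : x ∈ piece D d) : x ∉ D :=
  fun h => lt_irrefl _ (hx.2 x h hx.1)

lemma line_const (g : ℝ[X]) (n i : ℕ) (hg : g.Monic) (hd : g.natDegree = n) (hi : i < n)
    (a b : ℝ) (hab : a < b) : ∃ E : Finset ℝ, E.card ≤ 3 * n + 10 ∧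
      ∀ s t, s ≤ t → (∀ e ∈ E, e ∉ Set.Icc s t) →
        rc a b (g + C s * X ^ i) = rc a b (g + C t * X ^ i) := by
  set cr : ℝ[X] := X * derivative g - C (i : ℝ) * g with hcr
  have hcr0 : cr ≠ 0 := by
    intro h
    have h1 : cr.coeff n = n - i := by
      obtain ⟨m, rfl⟩ : ∃ m, n = m + 1 := ⟨n - 1, by omega⟩
      have : g.coeff (m+1) = 1 := by rw [← hd]; exact hg
      rw [hcr, coeff_sub, coeff_X_mul, coeff_C_mul, coeff_derivative, this]
      push_cast; ring
    rw [h, coeff_zero] at h1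
    have : (i : ℝ) < n := by exact_mod_cast hi
    linarith
  have hcrd : cr.natDegree ≤ n := by
    rw [hcr]
    refine (natDegree_sub_le _ _).trans (max_le ?_ ?_)
    · refine (natDegree_mul_le).trans ?_
      have := natDegree_derivative_le g
      have := natDegree_X_le (R := ℝ)
      omega
    · exact (natDegree_C_mul_le _ _).trans hd.le
  set D : Finset ℝ := cr.roots.toFinset ∪ {0, a, b} with hD
  have hDcard : D.card ≤ n + 3 := by
    refine (Finset.card_union_le _ _).trans (add_le_add ?_ Finset.card_le_three)
    exact (Multiset.toFinset_card_le _).trans ((card_roots' _).trans hcrd)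
  have h0D : (0:ℝ) ∈ D := by simp [hD]
  have haD : a ∈ D := by simp [hD]
  have hbD : b ∈ D := by simp [hD]
  have hcD : ∀ x, cr.eval x = 0 → x ∈ D := by
    intro x hx; simp [hD, hcr0, hx]
  set ψ : ℝ → ℝ := fun x => - g.eval x / x ^ i with hψ
  set P : ℝ → ℝ[X] := fun t => g + C t * X ^ i with hP
  have hPm : ∀ t, (P t).Monic := by
    intro t
    refine hg.add_of_left ?_
    refine (degree_C_mul_X_pow_le i t).trans_lt ?_
    rw [degree_eq_natDegree hg.ne_zero, hd]
    exact_mod_cast hi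
  have hroot : ∀ t x, x ≠ 0 → ((P t).eval x = 0 ↔ ψ x = t) := by
    intro t x hx
    have : x ^ i ≠ 0 := pow_ne_zero _ hx
    simp only [hP, hψ, eval_add, eval_mul, eval_C, eval_pow, eval_X]
    rw [div_eq_iff this]
    constructor <;> intro h <;> linarith
  have hψc : ∀ d, ContinuousOn ψ (piece D d) := by
    intro d
    refine ContinuousOn.div (by fun_prop) (by fun_prop) ?_
    intro x hx
    refine pow_ne_zero _ ?_
    rintro rfl
    exact piece_not_mem D d hx h0D
  have hψd : ∀ x, x ≠ 0 → HasDerivAt ψ ((- (derivative g).eval x * x ^ i - (- g.eval x) * (i * x ^ (i-1))) / (x^i)^2) x := by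
    intro x hx
    exact HasDerivAt.div (g.hasDerivAt x).neg (hasDerivAt_pow i x) (pow_ne_zero _ hx)
  have hxi : ∀ x : ℝ, x * (i * x ^ (i-1)) = i * x ^ i := by
    intro x
    rcases Nat.eq_zero_or_pos i with h | h
    · simp [h]
    · obtain ⟨m, rfl⟩ : ∃ m, i = m + 1 := ⟨i - 1, by omega⟩
      simp [pow_succ]; ring
  have hinj : ∀ d, ∀ x ∈ piece D d, ∀ y ∈ piece D d, x < y → ψ x ≠ ψ y := by
    intro d x hx y hy hxy h
    have hsub : ∀ z ∈ Set.Icc x y, z ∈ piece D d := fun z hz => (piece_ordc D d).out hx hy hz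
    have hz0 : ∀ z ∈ Set.Icc x y, z ≠ 0 := by
      rintro z hz rfl
      exact piece_not_mem D d (hsub _ hz) h0D
    obtain ⟨z, hz, hz'⟩ := exists_hasDerivAt_eq_zero hxy ((hψc d).mono hsub) h
      (fun z hz => hψd z (hz0 z ⟨hz.1.le, hz.2.le⟩))
    have hz1 := hz0 z ⟨hz.1.le, hz.2.le⟩
    have hzi : z ^ i ≠ 0 := pow_ne_zero _ hz1
    rw [div_eq_zero_iff] at hz'
    rcases hz' with hz' | hz'
    swap
    · exact hzi (by simpa using hz')
    refine piece_not_mem D d (hsub z ⟨hz.1.le, hz.2.le⟩) (hcD z ?_)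
    have h3 := hxi z
    have : z ^ i * cr.eval z = 0 := by
      simp only [hcr, eval_sub, eval_mul, eval_X, eval_C]
      linear_combination (-z) * hz' + (eval z g) * h3
    exact (mul_eq_zero.1 this).resolve_left hzi
  set E : Finset ℝ := D.image ψ ∪ {- g.coeff i} ∪
    (D.image (fun d => sInf (ψ '' piece D d)) ∪ D.image (fun d => sSup (ψ '' piece D d))) with hE
  have hEcard : E.card ≤ 3 * n + 10 := by
    have h1 := (Finset.card_image_le (s := D) (f := ψ))
    have h2 := (Finset.card_image_le (s := D) (f := (fun d => sInf (ψ '' piece D d))))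
    have h3 := (Finset.card_image_le (s := D) (f := (fun d => sSup (ψ '' piece D d))))
    have h4 : E.card ≤ _ := Finset.card_union_le _ _
    have h5 := Finset.card_union_le (D.image ψ) {- g.coeff i}
    have h6 := Finset.card_union_le (D.image (fun d => sInf (ψ '' piece D d))) (D.image (fun d => sSup (ψ '' piece D d)))
    rw [Finset.card_singleton] at h5
    omega
  -- main formula
  have hform : ∀ t, t ∉ E → rc a b (P t) =
      (if (0:ℝ) ∈ Set.Ico a b then (P t).rootMultiplicity 0 else 0) +
      ∑ d ∈ D.filter (fun d => d ∈ Set.Ico a b), if t ∈ ψ '' piece D d then 1 else 0 := by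
    intro t ht
    have htD : ∀ x ∈ D, x ≠ 0 → (P t).eval x ≠ 0 := by
      intro x hx hx0 h
      rw [hroot t x hx0] at h
      apply ht
      rw [hE, Finset.mem_union, Finset.mem_union]
      exact Or.inl (Or.inl (Finset.mem_image.2 ⟨x, hx, h⟩))
    have hsimple : ∀ x, x ≠ 0 → (P t).eval x = 0 → (P t).rootMultiplicity x = 1 := by
      intro x hx0 hx
      have hpos : 0 < (P t).rootMultiplicity x :=
        (rootMultiplicity_pos (hPm t).ne_zero).2 hx
      by_contra hne
      have h1 : 1 < (P t).rootMultiplicity x := by omega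
      rw [one_lt_rootMultiplicity_iff_isRoot (hPm t).ne_zero] at h1
      have h2 : (derivative (P t)).eval x = 0 := h1.2
      refine htD x (hcD x ?_) hx0 hx
      simp only [hP, derivative_add, derivative_C_mul, derivative_X_pow, eval_add, eval_mul, eval_C, eval_pow, eval_X] at h2 hx
      simp only [hcr, eval_sub, eval_mul, eval_X, eval_C]
      have h3 := hxi x
      linear_combination x * h2 - i * hx - t * h3
    have e1 : rc a b (P t) = ∑ x ∈ (P t).roots.toFinset.filter (fun x => x ∈ Set.Ico a b),
        (P t).rootMultiplicity x := by
      unfold rc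
      rw [Multiset.countP_eq_card_filter, ← Multiset.toFinset_sum_count_eq, Multiset.toFinset_filter]
      refine Finset.sum_congr rfl fun x hx => ?_
      rw [Multiset.count_filter, if_pos (Finset.mem_filter.1 hx).2, count_roots]
    set R := (P t).roots.toFinset.filter (fun x => x ∈ Set.Ico a b) with hR
    have hRm : ∀ x, x ∈ R ↔ (P t).eval x = 0 ∧ x ∈ Set.Ico a b := by
      intro x; rw [hR, Finset.mem_filter, Multiset.mem_toFinset, mem_roots (hPm t).ne_zero]; rfl
    rw [e1, ← Finset.sum_filter_add_sum_filter_not R (fun x => x = 0)]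
    congr 1
    · rw [Finset.sum_filter, Finset.sum_ite_eq']
      by_cases h0 : (0:ℝ) ∈ R
      · rw [if_pos h0, if_pos ((hRm 0).1 h0).2]
      · rw [if_neg h0]
        split_ifs with h1
        · symm
          rw [rootMultiplicity_eq_zero_iff]
          intro h2
          exact absurd ((hRm 0).2 ⟨h2, h1⟩) h0
        · rfl
    · have e2 : ∑ x ∈ R.filter (fun x => ¬ x = 0), (P t).rootMultiplicity x
          = (R.filter (fun x => ¬ x = 0)).card := by
        rw [Finset.card_eq_sum_ones]
        refine Finset.sum_congr rfl fun x hx => ?_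
        obtain ⟨h1, h2⟩ := Finset.mem_filter.1 hx
        exact hsimple x h2 ((hRm x).1 h1).1
      have e3 : R.filter (fun x => ¬ x = 0) = (D.filter (fun d => d ∈ Set.Ico a b)).biUnion
          (fun d => R.filter (fun x => x ∈ piece D d)) := by
        ext x
        simp only [Finset.mem_filter, Finset.mem_biUnion]
        constructor
        · rintro ⟨hx, hx0⟩
          obtain ⟨hx1, hx2⟩ := (hRm x).1 hx
          have hxD : x ∉ D := fun h => htD x h hx0 hx1
          have hax : a < x := lt_of_le_of_ne hx2.1 (by rintro rfl; exact hxD haD)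
          have hne : (D.filter (fun d => d < x)).Nonempty := ⟨a, Finset.mem_filter.2 ⟨haD, hax⟩⟩
          have hm := Finset.max'_mem _ hne
          set d := (D.filter (fun d => d < x)).max' hne with hdd
          obtain ⟨hm1, hm2⟩ := Finset.mem_filter.1 hm
          refine ⟨d, ⟨hm1, ?_, hm2.trans hx2.2⟩, hx, hm2, ?_⟩
          · exact Finset.le_max' _ _ (Finset.mem_filter.2 ⟨haD, hax⟩)
          · intro e he hde
            by_contra hex
            have : e < x := lt_of_le_of_ne (not_lt.1 hex) (by rintro rfl; exact hxD he)
            exact absurd (Finset.le_max' _ _ (Finset.mem_filter.2 ⟨he, this⟩)) (not_le.2 hde)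
        · rintro ⟨d, ⟨hd1, hd2⟩, hx, hx2⟩
          refine ⟨hx, ?_⟩
          rintro rfl
          exact piece_not_mem D d hx2 h0D
      rw [e2, e3, Finset.card_biUnion]
      · refine Finset.sum_congr rfl fun d hd => ?_
        obtain ⟨hd1, hd2⟩ := Finset.mem_filter.1 hd
        have hle : (R.filter (fun x => x ∈ piece D d)).card ≤ 1 := by
          rw [Finset.card_le_one]
          intro x hx y hy
          obtain ⟨hx1, hx2⟩ := Finset.mem_filter.1 hx
          obtain ⟨hy1, hy2⟩ := Finset.mem_filter.1 hy
          have hx0 : x ≠ 0 := by rintro rfl; exact piece_not_mem D d hx2 h0D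
          have hy0 : y ≠ 0 := by rintro rfl; exact piece_not_mem D d hy2 h0D
          have hx3 := (hroot t x hx0).1 ((hRm x).1 hx1).1
          have hy3 := (hroot t y hy0).1 ((hRm y).1 hy1).1
          rcases lt_trichotomy x y with h | h | h
          · exact absurd (hx3.trans hy3.symm) (hinj d x hx2 y hy2 h)
          · exact h
          · exact absurd (hy3.trans hx3.symm) (hinj d y hy2 x hx2 h)
        split_ifs with hmem
        · obtain ⟨x, hx, hxt⟩ := hmem
          have hx0 : x ≠ 0 := by rintro rfl; exact piece_not_mem D d hx h0D
          refine le_antisymm hle (Finset.card_pos.2 ⟨x, Finset.mem_filter.2 ⟨(hRm x).2 ⟨(hroot t x hx0).2 hxt, ?_, ?_⟩, hx⟩⟩)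
          · exact hd2.1.trans hx.1.le
          · exact hx.2 b hbD hd2.2
        · rw [Finset.card_eq_zero, Finset.filter_eq_empty_iff]
          intro x hx hx2
          have hx0 : x ≠ 0 := by rintro rfl; exact piece_not_mem D d hx2 h0D
          exact hmem ⟨x, hx2, (hroot t x hx0).1 ((hRm x).1 hx).1⟩
      · intro d hd e he hde
        rw [Function.onFun, Finset.disjoint_left]
        intro x hx hx'
        have h1 := (Finset.mem_filter.1 hx).2
        have h2 := (Finset.mem_filter.1 hx').2
        have hd1 := (Finset.mem_filter.1 hd).1
        have he1 := (Finset.mem_filter.1 he).1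
        rcases lt_or_gt_of_ne hde with h | h
        · exact lt_asymm (h1.2 e he1 h) h2.1
        · exact lt_asymm (h2.2 d hd1 h) h1.1
  refine ⟨E, hEcard, fun s t hst h => ?_⟩
  have hsE : s ∉ E := fun hs => h s hs ⟨le_rfl, hst⟩
  have htE : t ∉ E := fun hs => h t hs ⟨hst, le_rfl⟩
  have hgi : - g.coeff i ∈ E := by simp [hE]
  change rc a b (P s) = rc a b (P t)
  rw [hform s hsE, hform t htE]
  congr 1
  · have : (P s).rootMultiplicity 0 = (P t).rootMultiplicity 0 :=
      rm_zero g i (by rintro h; exact hsE (h ▸ hgi)) (by rintro h; exact htE (h ▸ hgi))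
    rw [this]
  · refine Finset.sum_congr rfl fun d hd => ?_
    have hdD := (Finset.mem_filter.1 hd).1
    have hoc : (ψ '' piece D d).OrdConnected := by
      have : IsPreconnected (piece D d) := (piece_ordc D d).isPreconnected
      exact (this.image ψ (hψc d)).ordConnected
    have := ordc_aux _ hoc hst (h _ ?_) (h _ ?_)
    · simp only [this]
    · rw [hE, Finset.mem_union]
      exact Or.inr (Finset.mem_union.2 <| Or.inl (Finset.mem_image.2 ⟨d, hdD, rfl⟩))
    · rw [hE, Finset.mem_union]
      exact Or.inr (Finset.mem_union.2 <| Or.inr (Finset.mem_image.2 ⟨d, hdD, rfl⟩))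

lemma oneD (A : Set ℝ) (hAm : MeasurableSet A) (Q : ℝ) (hA : A ⊆ Set.Icc (-Q) Q) (E : Finset ℝ)
    (hE : ∀ s t, s ≤ t → (∀ e ∈ E, e ∉ Set.Icc s t) → (s ∈ A ↔ t ∈ A)) :
    |∑ z ∈ Finset.Icc (-⌊Q⌋) ⌊Q⌋, (if ((z : ℤ) : ℝ) ∈ A then (1:ℝ) else 0) - (volume A).toReal|
      ≤ 2 * E.card := by
  set W : Finset ℤ := Finset.Ico (-⌊Q⌋ - 1) (⌊Q⌋ + 1) with hW
  have hs : ∑ z ∈ Finset.Icc (-⌊Q⌋) ⌊Q⌋, (if ((z : ℤ) : ℝ) ∈ A then (1:ℝ) else 0)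
      = ∑ z ∈ W, (if ((z : ℤ) : ℝ) ∈ A then (1:ℝ) else 0) := by
    refine Finset.sum_subset ?_ ?_
    · intro z hz
      simp only [hW, Finset.mem_Icc, Finset.mem_Ico] at *
      omega
    · intro z _ hz
      rw [if_neg]
      intro h
      have := hA h
      apply hz
      rw [Finset.mem_Icc]
      refine ⟨?_, Int.le_floor.2 this.2⟩
      have : -z ≤ ⌊Q⌋ := Int.le_floor.2 (by push_cast; linarith [this.1])
      linarith
  have hU : A = ⋃ j ∈ W, A ∩ Set.Ico (j:ℝ) (j+1) := by
    ext x
    simp only [Set.mem_iUnion]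
    constructor
    · intro hx
      refine ⟨⌊x⌋, ?_, hx, Int.floor_le x, Int.lt_floor_add_one x⟩
      have := hA hx
      rw [hW, Finset.mem_Ico]
      have h1 : ⌊x⌋ ≤ ⌊Q⌋ := Int.floor_le_floor this.2
      have h2 : -⌊Q⌋ - 1 ≤ ⌊x⌋ := by
        rw [Int.le_floor]; push_cast
        linarith [this.1, Int.lt_floor_add_one Q]
      omega
    · rintro ⟨j, _, h, _⟩
      exact h
  have hdis : (W : Set ℤ).PairwiseDisjoint (fun j : ℤ => A ∩ Set.Ico (j:ℝ) (j+1)) := by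
    intro i _ j _ hij
    rw [Function.onFun, Set.disjoint_left]
    rintro x ⟨_, hx1, hx2⟩ ⟨_, hx3, hx4⟩
    apply hij
    have h1 : ⌊x⌋ = i := Int.floor_eq_iff.2 ⟨hx1, hx2⟩
    have h2 : ⌊x⌋ = j := Int.floor_eq_iff.2 ⟨hx3, hx4⟩
    omega
  have hv1 : ∀ j : ℤ, volume (A ∩ Set.Ico (j:ℝ) (j+1)) ≤ 1 := by
    intro j
    refine (measure_mono Set.inter_subset_right).trans ?_
    simp
  have hv : (volume A).toReal = ∑ j ∈ W, (volume (A ∩ Set.Ico (j:ℝ) (j+1))).toReal := by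
    conv_lhs => rw [hU]
    rw [measure_biUnion_finset hdis (fun j _ => hAm.inter measurableSet_Ico),
      ENNReal.toReal_sum]
    intro j _
    exact ((hv1 j).trans_lt ENNReal.one_lt_top).ne
  rw [hs, hv, ← Finset.sum_sub_distrib]
  refine (Finset.abs_sum_le_sum_abs _ _).trans ?_
  have hterm : ∀ j ∈ W, |(if ((j : ℤ) : ℝ) ∈ A then (1:ℝ) else 0) -
      (volume (A ∩ Set.Ico (j:ℝ) (j+1))).toReal| ≤
      ∑ e ∈ E, if e ∈ Set.Icc (j:ℝ) (j+1) then (1:ℝ) else 0 := by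
    intro j _
    by_cases h : ∃ e ∈ E, e ∈ Set.Icc (j:ℝ) (j+1)
    · obtain ⟨e, he, hej⟩ := h
      have h1 : (1:ℝ) ≤ ∑ e ∈ E, if e ∈ Set.Icc (j:ℝ) (j+1) then (1:ℝ) else 0 := by
        have := Finset.single_le_sum (f := fun e => if e ∈ Set.Icc (j:ℝ) (j+1) then (1:ℝ) else 0)
          (fun e _ => by positivity) he
        simpa only [if_pos hej] using this
      refine le_trans ?_ h1
      have h2 : (volume (A ∩ Set.Ico (j:ℝ) (j+1))).toReal ≤ 1 := by
        have := ENNReal.toReal_mono ENNReal.one_ne_top (hv1 j)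
        simpa using this
      have h3 : 0 ≤ (volume (A ∩ Set.Ico (j:ℝ) (j+1))).toReal := ENNReal.toReal_nonneg
      rw [abs_le]
      split_ifs <;> constructor <;> linarith
    · push Not at h
      have hc : ∀ x ∈ Set.Ico (j:ℝ) (j+1), ((j:ℝ) ∈ A ↔ x ∈ A) := by
        intro x hx
        refine hE _ _ hx.1 fun e he hh => h e he ⟨hh.1, hh.2.trans hx.2.le⟩
      refine le_trans (le_of_eq ?_) (Finset.sum_nonneg fun e _ => by positivity)
      rw [abs_eq_zero]
      by_cases hj : (j:ℝ) ∈ A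
      · have : A ∩ Set.Ico (j:ℝ) (j+1) = Set.Ico (j:ℝ) (j+1) :=
          Set.inter_eq_right.2 fun x hx => (hc x hx).1 hj
        rw [if_pos hj, this]; simp
      · have : A ∩ Set.Ico (j:ℝ) (j+1) = ∅ := by
          rw [Set.eq_empty_iff_forall_notMem]
          rintro x ⟨hx1, hx2⟩
          exact hj ((hc x hx2).2 hx1)
        rw [if_neg hj, this]; simp
  refine (Finset.sum_le_sum hterm).trans ?_
  rw [Finset.sum_comm]
  have : ∀ e ∈ E, ∑ j ∈ W, (if e ∈ Set.Icc (j:ℝ) (j+1) then (1:ℝ) else 0) ≤ 2 := by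
    intro e _
    rw [← Finset.sum_filter, Finset.sum_const, nsmul_eq_mul, mul_one]
    have : W.filter (fun j : ℤ => e ∈ Set.Icc (j:ℝ) (j+1)) ⊆ {⌊e⌋, ⌊e⌋ - 1} := by
      intro j hj
      have hj := (Finset.mem_filter.1 hj).2
      have h1 : j ≤ ⌊e⌋ := Int.le_floor.2 hj.1
      have h2 : ⌊e⌋ ≤ j + 1 := by
        have : (⌊e⌋:ℝ) ≤ ((j + 1 : ℤ) : ℝ) := by push_cast; exact (Int.floor_le e).trans hj.2
        exact_mod_cast this
      simp only [Finset.mem_insert, Finset.mem_singleton]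
      omega
    have h3 := (Finset.card_le_card this).trans Finset.card_le_two
    exact_mod_cast h3
  refine (Finset.sum_le_sum this).trans ?_
  rw [Finset.sum_const, nsmul_eq_mul, mul_comm]

lemma sum_pi_succ (n : ℕ) (T : Finset ℤ) (F : (Fin (n+1) → ℤ) → ℝ) :
    ∑ z ∈ Fintype.piFinset (fun _ : Fin (n+1) => T), F z =
      ∑ t ∈ T, ∑ z ∈ Fintype.piFinset (fun _ : Fin n => T), F (Fin.cons t z) := by
  rw [← Finset.sum_product']
  symm
  refine Finset.sum_bij (fun x _ => Fin.cons x.1 x.2) ?_ ?_ ?_ ?_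
  · intro x hx
    rw [Finset.mem_product] at hx
    rw [Fintype.mem_piFinset]
    intro i
    refine Fin.cases ?_ ?_ i
    · simpa using hx.1
    · intro j; simpa using (Fintype.mem_piFinset.1 hx.2) j
  · rintro ⟨t, z⟩ _ ⟨t', z'⟩ _ h
    obtain ⟨h1, h2⟩ := Fin.cons_inj.1 h
    exact Prod.ext h1 h2
  · intro z hz
    rw [Fintype.mem_piFinset] at hz
    refine ⟨(z 0, Fin.tail z), ?_, Fin.cons_self_tail z⟩
    rw [Finset.mem_product, Fintype.mem_piFinset]
    exact ⟨hz 0, fun i => hz i.succ⟩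
  · intro x _; rfl

lemma vol_succ (n : ℕ) (S : Set (Fin (n+1) → ℝ)) (hS : MeasurableSet S) :
    MeasurableSet {x : ℝ × (Fin n → ℝ) | (Fin.cons x.1 x.2 : Fin (n+1) → ℝ) ∈ S} ∧
    volume S = (volume.prod volume) {x : ℝ × (Fin n → ℝ) | (Fin.cons x.1 x.2 : Fin (n+1) → ℝ) ∈ S} := by
  have h := (volume_preserving_piFinSuccAbove (fun _ : Fin (n+1) => ℝ) 0).symm
  have e : {x : ℝ × (Fin n → ℝ) | (Fin.cons x.1 x.2 : Fin (n+1) → ℝ) ∈ S} =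
      (MeasurableEquiv.piFinSuccAbove (fun _ : Fin (n+1) => ℝ) 0).symm ⁻¹' S := by
    ext x
    simp [MeasurableEquiv.piFinSuccAbove, Fin.insertNthEquiv]
  rw [e]
  exact ⟨h.measurable hS, (h.measure_preimage_equiv S).symm⟩

lemma nD (M Q : ℝ) (hM : 0 ≤ M) (hQ : 1 ≤ Q) (n : ℕ) : ∀ (S : Set (Fin n → ℝ))
    (hS : MeasurableSet S) (hbox : ∀ c ∈ S, ∀ i, |c i| ≤ Q)
    (hline : ∀ i c, |∑ z ∈ Finset.Icc (-⌊Q⌋) ⌊Q⌋,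
        (if Function.update c i ((z : ℤ) : ℝ) ∈ S then (1:ℝ) else 0)
        - (volume {t | Function.update c i t ∈ S}).toReal| ≤ M),
    |∑ z ∈ Fintype.piFinset (fun _ : Fin n => Finset.Icc (-⌊Q⌋) ⌊Q⌋),
        (if (fun i => ((z i : ℤ) : ℝ)) ∈ S then (1:ℝ) else 0) - (volume S).toReal|
      ≤ n * M * (3 * Q) ^ (n - 1) := by
  set T := Finset.Icc (-⌊Q⌋) ⌊Q⌋ with hT
  have hTc : (T.card : ℝ) ≤ 3 * Q := by
    have hf : 0 ≤ ⌊Q⌋ := Int.floor_nonneg.2 (by linarith)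
    have h1 : (T.card : ℤ) = 2 * ⌊Q⌋ + 1 := by
      rw [hT, Int.card_Icc]; omega
    have h2 : (T.card : ℝ) = 2 * ⌊Q⌋ + 1 := by exact_mod_cast h1
    rw [h2]
    linarith [Int.floor_le Q]
  induction n with
  | zero =>
    intro S hS _ _
    have hsub : S = ∅ ∨ S = Set.univ := by
      rcases S.eq_empty_or_nonempty with h | ⟨x, hx⟩
      · exact Or.inl h
      · right; ext y; rw [Subsingleton.elim y x]; simp [hx]
    rcases hsub with rfl | rfl
    · simp
    · have : (volume (Set.univ : Set (Fin 0 → ℝ))) = 1 := by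
        rw [volume_pi, Measure.pi_empty_univ]
      simp [this]
  | succ n ih =>
    intro S hS hbox hline
    obtain ⟨hm, hv⟩ := vol_succ n S hS
    set S' := {x : ℝ × (Fin n → ℝ) | (Fin.cons x.1 x.2 : Fin (n+1) → ℝ) ∈ S} with hS'
    set St : ℝ → Set (Fin n → ℝ) := fun t => {c | (Fin.cons t c : Fin (n+1) → ℝ) ∈ S} with hSt
    set L : (Fin n → ℝ) → Set ℝ := fun c => {t | (Fin.cons t c : Fin (n+1) → ℝ) ∈ S} with hL
    set B : Set (Fin n → ℝ) := Set.univ.pi (fun _ => Set.Icc (-Q) Q) with hB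
    have hStm : ∀ t, MeasurableSet (St t) := fun t => measurable_prodMk_left (x := t) hm
    have hBm : MeasurableSet B := MeasurableSet.univ_pi fun _ => measurableSet_Icc
    have hBv : volume B = ENNReal.ofReal (2 * Q) ^ n := by
      rw [hB, volume_pi_pi]; simp [two_mul]
    have hBfin : volume B < ⊤ := by rw [hBv]; exact ENNReal.pow_lt_top ENNReal.ofReal_lt_top
    have hBr : volume.real B = (2 * Q) ^ n := by
      rw [Measure.real, hBv, ENNReal.toReal_pow, ENNReal.toReal_ofReal (by linarith)]
    have hStB : ∀ t, St t ⊆ B := by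
      intro t c hc i _
      have := hbox _ hc i.succ
      rw [Fin.cons_succ] at this
      exact abs_le.1 this
    have hLQ : ∀ c, L c ⊆ Set.Icc (-Q) Q := by
      intro c t ht
      have := hbox _ ht 0
      rw [Fin.cons_zero] at this
      exact abs_le.1 this
    have hLv : ∀ c, volume (L c) ≤ ENNReal.ofReal (2 * Q) := by
      intro c
      refine (measure_mono (hLQ c)).trans ?_
      rw [Real.volume_Icc]; apply le_of_eq; ring_nf
    have hLB : ∀ c, c ∉ B → L c = ∅ := by
      intro c hc
      rw [Set.eq_empty_iff_forall_notMem]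
      intro t ht
      exact hc (hStB t ht)
    have hLmeas : Measurable fun c => volume (L c) := measurable_measure_prodMk_right hm
    have hLint : IntegrableOn (fun c => (volume (L c)).toReal) B := by
      refine Measure.integrableOn_of_bounded (M := 2 * Q) hBfin.ne hLmeas.ennreal_toReal.aestronglyMeasurable ?_
      refine Filter.Eventually.of_forall fun c => ?_
      rw [Real.norm_of_nonneg ENNReal.toReal_nonneg]
      exact ENNReal.toReal_le_of_le_ofReal (by linarith) (hLv c)
    have hvS : (volume S).toReal = ∫ c in B, (volume (L c)).toReal := by
      rw [hv, Measure.prod_apply_symm hm, setIntegral_eq_integral_of_forall_compl_eq_zero, integral_toReal]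
      · rfl
      · exact hLmeas.aemeasurable
      · exact Filter.Eventually.of_forall fun c => (hLv c).trans_lt ENNReal.ofReal_lt_top
      · intro c hc; rw [hLB c hc]; simp
    have hindint : ∀ t, IntegrableOn (fun c => if c ∈ St t then (1:ℝ) else 0) B := by
      intro t
      refine Measure.integrableOn_of_bounded (M := 1) hBfin.ne ?_ ?_
      · exact (Measurable.ite (hStm t) measurable_const measurable_const).aestronglyMeasurable
      · refine Filter.Eventually.of_forall fun c => ?_
        split_ifs <;> simp
    have hvSt : ∀ t, (volume (St t)).toReal = ∫ c in B, if c ∈ St t then (1:ℝ) else 0 := by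
      intro t
      have : (fun c => if c ∈ St t then (1:ℝ) else 0) = (St t).indicator 1 := by
        ext c; simp [Set.indicator]
      rw [this, setIntegral_indicator (hStm t), Set.inter_eq_right.2 (hStB t)]
      simp [Measure.real]
    -- first difference
    have hd1 : |∑ t ∈ T, ((volume (St t)).toReal) - (volume S).toReal| ≤ M * (2 * Q) ^ n := by
      have : ∑ t ∈ T, ((volume (St t)).toReal) - (volume S).toReal =
          ∫ c in B, ((∑ t ∈ T, if c ∈ St t then (1:ℝ) else 0) - (volume (L c)).toReal) := by
        rw [integral_sub (integrable_finsetSum T fun t _ => hindint (t:ℝ)) hLint,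
          integral_finsetSum T (fun t _ => hindint (t:ℝ)), ← hvS]
        congr 1
        exact Finset.sum_congr rfl fun t _ => hvSt t
      rw [this, ← hBr, ← Real.norm_eq_abs]
      refine norm_setIntegral_le_of_norm_le_const hBfin ?_
      intro c _
      have := hline 0 (Fin.cons 0 c)
      simp only [Fin.update_cons_zero] at this
      exact this
    have hd2 : |∑ z ∈ Fintype.piFinset (fun _ : Fin (n+1) => T),
        (if (fun i => ((z i : ℤ) : ℝ)) ∈ S then (1:ℝ) else 0) - ∑ t ∈ T, ((volume (St t)).toReal)| ≤
        T.card * (n * M * (3 * Q) ^ (n - 1)) := by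
      rw [sum_pi_succ, ← Finset.sum_sub_distrib]
      refine (Finset.abs_sum_le_sum_abs _ _).trans ?_
      rw [← nsmul_eq_mul]
      refine Finset.sum_le_card_nsmul _ _ _ fun t _ => ?_
      have := ih (St t) (hStm t) (fun c hc i => abs_le.2 (hStB t hc i trivial)) ?_
      · have key : ∀ z : Fin n → ℤ, ((fun i => (((Fin.cons t z : Fin (n+1) → ℤ) i : ℤ) : ℝ)) ∈ S) =
            ((fun i => ((z i : ℤ):ℝ)) ∈ St t) := by
          intro z
          have : (fun i => (((Fin.cons t z : Fin (n+1) → ℤ) i : ℤ) : ℝ)) =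
            (Fin.cons (t:ℝ) (fun i => ((z i : ℤ):ℝ)) : Fin (n+1) → ℝ) := by
            ext i
            refine Fin.cases ?_ ?_ i <;> simp
          rw [this]; rfl
        simp only [key]
        exact this
      · intro i c
        have := hline i.succ (Fin.cons t c)
        simp only [← Fin.cons_update] at this
        exact this
    have hd3 : (T.card : ℝ) * (n * M * (3 * Q) ^ (n - 1)) ≤ n * M * (3 * Q) ^ n := by
      rcases n with _ | m
      · simp
      · rw [Nat.add_sub_cancel, pow_succ]
        have : 0 ≤ ((m + 1 : ℕ) : ℝ) * M * (3 * Q) ^ m := by positivity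
        nlinarith
    have hd4 : M * (2 * Q) ^ n ≤ M * (3 * Q) ^ n := by
      gcongr; norm_num
    rw [Nat.add_sub_cancel]
    push_cast
    have := abs_sub_le (∑ z ∈ Fintype.piFinset (fun _ : Fin (n+1) => T),
        (if (fun i => ((z i : ℤ) : ℝ)) ∈ S then (1:ℝ) else 0)) (∑ t ∈ T, ((volume (St t)).toReal)) (volume S).toReal
    linarith

noncomputable def pc {R : Type*} [CommRing R] (n : ℕ) (c : Fin n → R) : R[X] :=
  X ^ n + ∑ i : Fin n, C (c i) * X ^ (i : ℕ)

lemma pc_deg {R : Type*} [CommRing R] (n : ℕ) (c : Fin n → R) :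
    (∑ i : Fin n, C (c i) * X ^ (i : ℕ) : R[X]).degree < n := by
  refine (degree_sum_le _ _).trans_lt ?_
  refine (Finset.sup_lt_iff (WithBot.bot_lt_coe n)).2 ?_
  intro i _
  refine (degree_C_mul_X_pow_le _ _).trans_lt ?_
  exact WithBot.coe_lt_coe.2 i.2

lemma pc_monic {R : Type*} [CommRing R] (n : ℕ) (c : Fin n → R) : (pc n c).Monic :=
  monic_X_pow_add (pc_deg n c)

lemma pc_natDegree {R : Type*} [CommRing R] [Nontrivial R] (n : ℕ) (c : Fin n → R) :
    (pc n c).natDegree = n := by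
  unfold pc
  rw [natDegree_add_eq_left_of_degree_lt, natDegree_X_pow]
  rw [degree_X_pow]; exact pc_deg n c

lemma pc_coeff {R : Type*} [CommRing R] (n : ℕ) (c : Fin n → R) (j : Fin n) :
    (pc n c).coeff j = c j := by
  have : ∀ i : Fin n, ((j : ℕ) = (i : ℕ)) = (j = i) := fun i => by rw [Fin.ext_iff]
  simp only [pc, coeff_add, coeff_X_pow, finsetSum_coeff, coeff_C_mul, this]
  rw [if_neg j.2.ne]
  simp

lemma eq_pc {R : Type*} [CommRing R] [Nontrivial R] (n : ℕ) (p : R[X]) (hp : p.Monic)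
    (hd : p.natDegree = n) : p = pc n (fun i => p.coeff i) := by
  ext j
  rcases lt_trichotomy j n with h | h | h
  · exact (pc_coeff n (fun i => p.coeff i) ⟨j, h⟩).symm
  · rw [h]
    have h1 := pc_monic n (fun i => p.coeff i)
    rw [Monic, leadingCoeff, pc_natDegree] at h1
    rw [h1]; rw [Monic, leadingCoeff, hd] at hp; exact hp
  · rw [coeff_eq_zero_of_natDegree_lt (by omega), coeff_eq_zero_of_natDegree_lt]
    rw [pc_natDegree]; exact h

lemma pc_update (n : ℕ) (c : Fin n → ℝ) (i : Fin n) (t : ℝ) :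
    pc n (Function.update c i t) = pc n (Function.update c i 0) + C t * X ^ (i : ℕ) := by
  unfold pc
  rw [add_assoc]
  congr 1
  rw [← Finset.add_sum_erase _ _ (Finset.mem_univ i), ← Finset.add_sum_erase _ _ (Finset.mem_univ i)]
  have : ∀ s, ∑ x ∈ Finset.univ.erase i, C (Function.update c i s x) * X ^ (x : ℕ) =
      ∑ x ∈ Finset.univ.erase i, C (c x) * X ^ (x : ℕ) := by
    intro s
    refine Finset.sum_congr rfl fun x hx => ?_
    rw [Function.update_of_ne (Finset.ne_of_mem_erase hx)]
  rw [this, this]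
  simp [add_comm]

lemma cont_prod {Y : Type*} [TopologicalSpace Y] {ι : Type*} (s : Finset ι) (P : ι → Y → ℝ[X])
    (h : ∀ i ∈ s, ∀ j, Continuous fun y => (P i y).coeff j) :
    ∀ j, Continuous fun y => (∏ i ∈ s, P i y).coeff j := by
  induction s using Finset.induction_on with
  | empty => intro j; simp only [Finset.prod_empty]; exact continuous_const
  | insert a s ha ih =>
    intro j
    simp only [Finset.prod_insert ha, coeff_mul]
    refine continuous_finsetSum _ fun x _ => ?_
    exact (h a (Finset.mem_insert_self _ _) _).mul (ih (fun i hi => h i (Finset.mem_insert_of_mem hi)) _)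

lemma meas_ge (n k : ℕ) (a b : ℝ) : MeasurableSet {c : Fin n → ℝ | k ≤ rc a b (pc n c)} := by
  by_cases hk : k ≤ n
  swap
  · convert MeasurableSet.empty
    rw [Set.eq_empty_iff_forall_notMem]
    intro c hc
    have h1 : k ≤ rc a b (pc n c) := hc
    have h2 : rc a b (pc n c) ≤ n :=
      (Multiset.countP_le_card _ _).trans ((card_roots' _).trans (pc_natDegree n c).le)
    omega
  set U : Set ((Fin k → ℝ) × (Fin (n - k) → ℝ)) := {y | ∀ i, y.1 i ∈ Set.Ico a b} with hU
  set P : (Fin k → ℝ) × (Fin (n - k) → ℝ) → ℝ[X] :=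
    fun y => (∏ i, (X - C (y.1 i))) * pc (n - k) y.2 with hP
  set F : (Fin k → ℝ) × (Fin (n - k) → ℝ) → (Fin n → ℝ) := fun y j => (P y).coeff j with hF
  have hUlc : IsLocallyClosed U := by
    refine ⟨{y | ∀ i, y.1 i < b}, {y | ∀ i, a ≤ y.1 i}, ?_, ?_, ?_⟩
    · simp only [Set.ofPred_forall]
      exact isOpen_iInter_of_finite fun i => isOpen_lt (by fun_prop) continuous_const
    · simp only [Set.ofPred_forall]
      exact isClosed_iInter fun i => isClosed_le continuous_const (by fun_prop)
    · ext y
      constructor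
      · intro h; exact ⟨fun i => (h i).2, fun i => (h i).1⟩
      · intro h i; exact ⟨h.2 i, h.1 i⟩
  have hUs : IsSigmaCompact U := by
    rw [isSigmaCompact_iff_sigmaCompactSpace]
    have := hUlc.locallyCompactSpace
    infer_instance
  have hFc : Continuous F := by
    refine continuous_pi fun j => ?_
    simp only [hF, hP, coeff_mul]
    refine continuous_finsetSum _ fun x _ => ?_
    refine Continuous.mul ?_ ?_
    · refine cont_prod Finset.univ (fun i (y : (Fin k → ℝ) × (Fin (n - k) → ℝ)) => X - C (y.1 i)) ?_ _
      intro i _ j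
      simp only [coeff_sub, coeff_C]
      split_ifs <;> fun_prop
    · simp only [pc, coeff_add, finsetSum_coeff, coeff_C_mul]
      fun_prop
  have hPm : ∀ y, (P y).Monic := fun y =>
    (monic_prod_of_monic _ _ fun i _ => monic_X_sub_C _).mul (pc_monic _ _)
  have hPd : ∀ y, (P y).natDegree = n := by
    intro y
    rw [hP]
    simp only
    rw [(monic_prod_of_monic _ _ fun i _ => monic_X_sub_C _).natDegree_mul (pc_monic _ _), pc_natDegree,
      natDegree_prod_of_monic _ _ fun i _ => monic_X_sub_C _]
    simp; omega
  have hset : {c : Fin n → ℝ | k ≤ rc a b (pc n c)} = F '' U := by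
    ext c
    constructor
    · intro hc
      have hc : k ≤ rc a b (pc n c) := hc
      rw [rc, Multiset.countP_eq_card_filter] at hc
      set m := (pc n c).roots.filter (fun x => x ∈ Set.Ico a b) with hm
      set l := m.toList.take k with hl
      have hlen : l.length = k := by simp [hl, hc]
      have hlm : (l : Multiset ℝ) ≤ m := by
        conv_rhs => rw [← Multiset.coe_toList m]
        exact (List.take_sublist _ _).subperm
      have hlr : (l : Multiset ℝ) ≤ (pc n c).roots := hlm.trans (Multiset.filter_le _ _)
      have hdvd := (Multiset.prod_X_sub_C_dvd_iff_le_roots (pc_monic n c).ne_zero (l : Multiset ℝ)).2 hlr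
      obtain ⟨q, hq⟩ := hdvd
      set x : Fin k → ℝ := fun i => l.get (i.cast hlen.symm) with hx
      have hprod : (Multiset.map (fun a => X - C a) (l : Multiset ℝ)).prod = ∏ i, (X - C (x i)) := by
        rw [Multiset.map_coe, Multiset.prod_coe, ← List.prod_ofFn]
        congr 1
        apply List.ext_get
        · simp [hlen]
        · intro i h1 h2
          simp [hx]
      rw [hprod] at hq
      have hmon : (∏ i, (X - C (x i))).Monic := monic_prod_of_monic _ _ fun i _ => monic_X_sub_C _
      have hqm : q.Monic := hmon.of_mul_monic_left (hq ▸ pc_monic n c)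
      have hqd : q.natDegree = n - k := by
        have := congrArg natDegree hq
        rw [pc_natDegree, hmon.natDegree_mul hqm, natDegree_prod_of_monic _ _ fun i _ => monic_X_sub_C _] at this
        simp at this; omega
      refine ⟨(x, fun i => q.coeff i), ?_, ?_⟩
      · intro i
        have : x i ∈ m := Multiset.mem_of_le hlm (by rw [Multiset.mem_coe]; exact List.get_mem _ _)
        exact (Multiset.mem_filter.1 this).2
      · ext j
        simp only [hF, hP]
        rw [← eq_pc (n - k) q hqm hqd, ← hq, pc_coeff]
    · rintro ⟨y, hy, rfl⟩
      change k ≤ rc a b (pc n (F y))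
      have : pc n (F y) = P y := (eq_pc n (P y) (hPm y) (hPd y)).symm
      rw [this]
      have hle : (Finset.univ.val.map y.1) ≤ (P y).roots := by
        rw [← Multiset.prod_X_sub_C_dvd_iff_le_roots (hPm y).ne_zero, Multiset.map_map]
        exact Dvd.intro _ rfl
      refine le_trans (le_of_eq ?_) (Multiset.countP_le_of_le _ hle)
      symm
      have : Multiset.countP (fun x => x ∈ Set.Ico a b) (Finset.univ.val.map y.1) =
        (Finset.univ.val.map y.1).card := by
        rw [Multiset.countP_eq_card]
        intro x hx
        obtain ⟨i, _, rfl⟩ := Multiset.mem_map.1 hx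
        exact hy i
      rw [this]; simp
  rw [hset]
  obtain ⟨K, hK, hKU⟩ := hUs.image hFc
  rw [← hKU]
  exact MeasurableSet.iUnion fun i => (hK i).measurableSet

/-- the region -/
def Sreg (n k : ℕ) (Q a b : ℝ) : Set (Fin n → ℝ) :=
  {c | (∀ i, |c i| ≤ Q) ∧ rc a b (pc n c) = k}

lemma meas_Sreg (n k : ℕ) (Q a b : ℝ) : MeasurableSet (Sreg n k Q a b) := by
  have : Sreg n k Q a b = (⋂ i, {c : Fin n → ℝ | |c i| ≤ Q}) ∩
      ({c : Fin n → ℝ | k ≤ rc a b (pc n c)} \ {c : Fin n → ℝ | k + 1 ≤ rc a b (pc n c)}) := by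
    ext c
    simp only [Sreg, Set.mem_inter_iff, Set.mem_iInter, Set.mem_sdiff]
    refine and_congr Iff.rfl ?_
    change _ = _ ↔ k ≤ _ ∧ ¬ (k + 1 ≤ _)
    omega
  rw [this]
  refine MeasurableSet.inter (MeasurableSet.iInter fun i => ?_) ((meas_ge n k a b).diff (meas_ge n (k+1) a b))
  exact measurableSet_le (by fun_prop) measurable_const

lemma lattice (n k : ℕ) (Q a b : ℝ) (hQ : 1 ≤ Q) (hab : a < b) :
    |∑ z ∈ Fintype.piFinset (fun _ : Fin n => Finset.Icc (-⌊Q⌋) ⌊Q⌋),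
        (if (fun i => ((z i : ℤ) : ℝ)) ∈ Sreg n k Q a b then (1:ℝ) else 0) -
          (volume (Sreg n k Q a b)).toReal|
      ≤ n * (2 * (3 * n + 12)) * (3 * Q) ^ (n - 1) := by
  refine nD _ Q (by positivity) hQ n _ (meas_Sreg n k Q a b) (fun c hc => hc.1) ?_
  intro i c
  obtain ⟨E, hEc, hE⟩ := line_const (pc n (Function.update c i 0)) n i (pc_monic _ _) (pc_natDegree _ _) i.2 a b hab
  set A := {t | Function.update c i t ∈ Sreg n k Q a b} with hA
  have hAm : MeasurableSet A := measurable_update c (meas_Sreg n k Q a b)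
  have h := oneD A hAm Q ?_ (E ∪ {Q, -Q}) ?_
  · refine le_trans h ?_
    have h1 : (E ∪ {Q, -Q}).card ≤ (3 * n + 10) + 2 :=
      (Finset.card_union_le _ _).trans (add_le_add hEc Finset.card_le_two)
    have h2 : (((E ∪ {Q, -Q}).card : ℕ) : ℝ) ≤ ((3 * n + 10 + 2 : ℕ) : ℝ) := by exact_mod_cast h1
    push_cast at h2
    linarith
  · intro t ht
    have : |Function.update c i t i| ≤ Q := ht.1 i
    rw [Function.update_self] at this
    exact abs_le.1 this
  · intro s t hst hh
    have h1 := hE s t hst (fun e he => hh e (Finset.mem_union_left _ he))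
    rw [← pc_update, ← pc_update] at h1
    have h2 := hh Q (by simp)
    have h3 := hh (-Q) (by simp)
    have h4 : |s| ≤ Q ↔ |t| ≤ Q := by
      simp only [Set.mem_Icc, not_and_or, not_le] at h2 h3
      rw [abs_le, abs_le]
      constructor
      · rintro ⟨h5, h6⟩
        constructor
        · linarith
        · rcases h2 with h2 | h2 <;> linarith
      · rintro ⟨h5, h6⟩
        constructor
        · rcases h3 with h3 | h3 <;> linarith
        · linarith
    change ((∀ j, |Function.update c i s j| ≤ Q) ∧ rc a b _ = k) ↔
      ((∀ j, |Function.update c i t j| ≤ Q) ∧ rc a b _ = k)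
    rw [h1]
    refine and_congr ?_ Iff.rfl
    refine forall_congr' fun j => ?_
    by_cases hj : j = i
    · subst hj; simpa using h4
    · simp [hj]

/-- height -/
noncomputable def ht (q : ℤ[X]) : ℕ := q.support.sup (fun i => (q.coeff i).natAbs)

lemma le_ht (q : ℤ[X]) (i : ℕ) : (q.coeff i).natAbs ≤ ht q := by
  by_cases h : i ∈ q.support
  · exact Finset.le_sup (f := fun i => (q.coeff i).natAbs) h
  · rw [notMem_support_iff] at h; simp [h]

lemma ht_attain (q : ℤ[X]) (hq : q ≠ 0) : ∃ i, (q.coeff i).natAbs = ht q := by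
  obtain ⟨i, _, hi⟩ := Finset.exists_mem_eq_sup q.support (nonempty_support_iff.2 hq) (fun i => (q.coeff i).natAbs)
  exact ⟨i, hi.symm⟩

lemma ht_pos (q : ℤ[X]) (hq : q.Monic) : 1 ≤ ht q := by
  have := le_ht q q.natDegree
  rw [show q.coeff q.natDegree = 1 from hq] at this
  simpa using this

lemma coeff_le_mahler (n : ℕ) (q : ℤ[X]) (hq : q.natDegree ≤ n) (i : ℕ) :
    ((q.coeff i).natAbs : ℝ) ≤ 2 ^ n * (q.map (Int.castRingHom ℂ)).mahlerMeasure := by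
  have h := norm_coeff_le_choose_mul_mahlerMeasure i (q.map (Int.castRingHom ℂ))
  have h1 : ‖(q.map (Int.castRingHom ℂ)).coeff i‖ = ((q.coeff i).natAbs : ℝ) := by
    rw [coeff_map]; simp [Nat.cast_natAbs]
  rw [h1] at h
  refine h.trans ?_
  gcongr
  · exact mahlerMeasure_nonneg _
  · have h2 : (q.map (Int.castRingHom ℂ)).natDegree ≤ n := natDegree_map_le.trans hq
    have h3 := Nat.choose_le_two_pow (q.map (Int.castRingHom ℂ)).natDegree i
    have h4 : 2 ^ (q.map (Int.castRingHom ℂ)).natDegree ≤ 2 ^ n := Nat.pow_le_pow_right (by norm_num) h2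
    exact_mod_cast h3.trans h4

lemma ht_mul (n : ℕ) (Q : ℝ) (q r : ℤ[X]) (hq : q ≠ 0) (hr : r ≠ 0) (hd : (q * r).natDegree = n)
    (hQ : ∀ i, (|(q * r).coeff i| : ℝ) ≤ Q) : ((ht q * ht r : ℕ) : ℝ) ≤ 4 ^ n * (n + 1) * Q := by
  obtain ⟨i, hi⟩ := ht_attain q hq
  obtain ⟨j, hj⟩ := ht_attain r hr
  have hdeg := natDegree_mul hq hr
  have h1 := coeff_le_mahler n q (by omega) i
  have h2 := coeff_le_mahler n r (by omega) j
  have h3 := mahlerMeasure_le_sum_norm_coeff ((q * r).map (Int.castRingHom ℂ))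
  have h4 : (((q * r).map (Int.castRingHom ℂ)).sum fun _ a => ‖a‖) ≤ (n + 1) * Q := by
    rw [sum_over_range' _ (fun _ => norm_zero) (n + 1) (by
      have : ((q * r).map (Int.castRingHom ℂ)).natDegree ≤ n := natDegree_map_le.trans hd.le
      omega)]
    have : ∀ i ∈ Finset.range (n+1), ‖((q * r).map (Int.castRingHom ℂ)).coeff i‖ ≤ Q := by
      intro i _
      rw [coeff_map]
      have := hQ i
      simpa using this
    refine (Finset.sum_le_card_nsmul _ _ _ this).trans ?_
    simp
  rw [Polynomial.map_mul, mahlerMeasure_mul] at h3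
  rw [Polynomial.map_mul] at h4
  push_cast
  rw [← hi, ← hj]
  set Mq := (q.map (Int.castRingHom ℂ)).mahlerMeasure
  set Mr := (r.map (Int.castRingHom ℂ)).mahlerMeasure
  calc ((q.coeff i).natAbs : ℝ) * ((r.coeff j).natAbs : ℝ)
      ≤ (2 ^ n * Mq) * (2 ^ n * Mr) := by
        gcongr
        have : 0 ≤ Mq := mahlerMeasure_nonneg _
        positivity
    _ = 4 ^ n * (Mq * Mr) := by
        rw [show (4:ℝ) = 2 * 2 by norm_num, mul_pow]; ring
    _ ≤ 4 ^ n * ((n + 1) * Q) := mul_le_mul_of_nonneg_left (h3.trans h4) (by positivity)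
    _ = _ := by ring

/-- polynomials with bounded coefficients -/
noncomputable def Bx (m h : ℕ) : Finset ℤ[X] :=
  (Fintype.piFinset (fun _ : Fin m => Finset.Icc (-(h:ℤ)) h)).image (pc m)

lemma Bx_card (m h : ℕ) : (Bx m h).card ≤ (2 * h + 1) ^ m := by
  refine Finset.card_image_le.trans ?_
  rw [Fintype.card_piFinset_const, Int.card_Icc]
  apply Nat.pow_le_pow_left
  omega

lemma mem_Bx (m h : ℕ) (q : ℤ[X]) (hq : q.Monic) (hd : q.natDegree = m) (hh : ht q ≤ h) :
    q ∈ Bx m h := by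
  rw [Bx, Finset.mem_image]
  refine ⟨fun i => q.coeff i, ?_, (eq_pc m q hq hd).symm⟩
  rw [Fintype.mem_piFinset]
  intro i
  have := le_ht q i
  rw [Finset.mem_Icc]
  omega

noncomputable def RedSet (n N : ℕ) : Finset ℤ[X] :=
  (Finset.Icc 1 (n / 2)).biUnion fun m => (Finset.range (Nat.log 2 N + 1)).biUnion fun j =>
    Finset.image₂ (fun q r => q * r) (Bx m (2 ^ (j + 1))) (Bx (n - m) (N / 2 ^ j))

lemma mem_RedSet_aux (n N : ℕ) (q r : ℤ[X]) (hq : q.Monic) (hr : r.Monic) (h1 : 1 ≤ q.natDegree)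
    (hle : q.natDegree ≤ r.natDegree) (hd : q.natDegree + r.natDegree = n) (hN : ht q * ht r ≤ N) :
    q * r ∈ RedSet n N := by
  have hq1 := ht_pos q hq
  have hr1 := ht_pos r hr
  have h2 : 2 ^ (Nat.log 2 (ht q)) ≤ ht q := Nat.pow_log_le_self 2 (by omega)
  have h3 : ht q < 2 ^ (Nat.log 2 (ht q) + 1) := Nat.lt_pow_succ_log_self (by norm_num) _
  simp only [RedSet, Finset.mem_biUnion, Finset.mem_image₂, Finset.mem_Icc, Finset.mem_range]
  refine ⟨q.natDegree, ⟨h1, by omega⟩, Nat.log 2 (ht q), ?_, q, mem_Bx _ _ q hq rfl h3.le, r, mem_Bx _ _ r hr (by omega) ?_, rfl⟩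
  · have : Nat.log 2 (ht q) ≤ Nat.log 2 N := Nat.log_mono_right (by nlinarith)
    omega
  · rw [Nat.le_div_iff_mul_le (by positivity)]
    nlinarith

lemma mem_RedSet (n N : ℕ) (Q : ℝ) (p : ℤ[X]) (hN : N = ⌊4 ^ n * (n + 1) * Q⌋₊) (hp : p.Monic)
    (hd : p.natDegree = n) (hQ : ∀ i, (|p.coeff i| : ℝ) ≤ Q)
    (h : ∃ q r : ℤ[X], 1 ≤ q.natDegree ∧ 1 ≤ r.natDegree ∧ p = q * r) : p ∈ RedSet n N := by
  obtain ⟨q, r, hq1, hr1, rfl⟩ := h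
  have hM : ∃ q' r' : ℤ[X], q'.Monic ∧ r'.Monic ∧ q'.natDegree = q.natDegree ∧ r'.natDegree = r.natDegree ∧
      q' * r' = q * r := by
    have hl : q.leadingCoeff * r.leadingCoeff = 1 := by rw [← leadingCoeff_mul]; exact hp
    rcases Int.mul_eq_one_iff_eq_one_or_neg_one.1 hl with ⟨h1, h2⟩ | ⟨h1, h2⟩
    · exact ⟨q, r, h1, h2, rfl, rfl, rfl⟩
    · refine ⟨-q, -r, ?_, ?_, natDegree_neg _, natDegree_neg _, by ring⟩
      · rw [Monic, leadingCoeff_neg, h1]; norm_num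
      · rw [Monic, leadingCoeff_neg, h2]; norm_num
  obtain ⟨q', r', hq', hr', hqd, hrd, he⟩ := hM
  rw [← he] at hd hQ ⊢
  have h1 := ht_mul n Q q' r' hq'.ne_zero hr'.ne_zero hd hQ
  have h2 : ht q' * ht r' ≤ N := by rw [hN]; exact Nat.le_floor h1
  rw [hq'.natDegree_mul hr'] at hd
  rcases le_total q'.natDegree r'.natDegree with h | h
  · exact mem_RedSet_aux n N q' r' hq' hr' (by omega) h hd h2
  · rw [mul_comm]
    exact mem_RedSet_aux n N r' q' hr' hq' (by omega) h (by omega) (by rw [mul_comm]; exact h2)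

lemma term_bound (n N m j : ℕ) (hN : 1 ≤ N) (hj : j ≤ Nat.log 2 N) (hm : 2 * m ≤ n) :
    (((2 * 2 ^ (j + 1) + 1) ^ m * (2 * (N / 2 ^ j) + 1) ^ (n - m) : ℕ) : ℝ) ≤
      5 ^ n * ((N:ℝ) ^ m * ((N:ℝ) / 2 ^ j) ^ (n - 2 * m)) := by
  have hx : (2:ℕ) ^ j ≤ N := (Nat.pow_le_pow_right (by norm_num) hj).trans (Nat.pow_log_le_self 2 (by omega))
  have hx1 : (2:ℝ) ^ j ≤ N := by exact_mod_cast hx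
  have hx0 : (1:ℝ) ≤ 2 ^ j := one_le_pow₀ (by norm_num)
  have hdiv : ((N / 2 ^ j : ℕ) : ℝ) ≤ (N:ℝ) / 2 ^ j := by
    have := Nat.cast_div_le (α := ℝ) (m := N) (n := 2 ^ j)
    push_cast at this; exact this
  have h1 : 1 ≤ (N:ℝ) / 2 ^ j := by rw [le_div_iff₀ (by positivity)]; linarith
  push_cast [pow_succ]
  push_cast at hdiv
  calc (2 * (2 ^ j * 2) + 1 : ℝ) ^ m * (2 * ((N / 2 ^ j : ℕ) : ℝ) + 1) ^ (n - m)
      ≤ (5 * 2 ^ j) ^ m * (5 * ((N:ℝ) / 2 ^ j)) ^ (n - m) := by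
        gcongr
        · linarith
        · push_cast; linarith
    _ = 5 ^ n * ((N:ℝ) ^ m * ((N:ℝ) / 2 ^ j) ^ (n - 2 * m)) := by
        have e1 : n - m = m + (n - 2 * m) := by omega
        have e2 : (5:ℝ) ^ n = 5 ^ m * 5 ^ (n - m) := by rw [← pow_add]; congr 1; omega
        rw [e2, mul_pow, mul_pow, e1, pow_add ((N:ℝ)/2^j), div_pow _ _ m]
        field_simp

lemma sum_bound (n N m : ℕ) (hn : 2 ≤ n) (hN : 1 ≤ N) (hm1 : 1 ≤ m) (hm : 2 * m ≤ n) :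
    ∑ j ∈ Finset.range (Nat.log 2 N + 1), ((N:ℝ) ^ m * ((N:ℝ) / 2 ^ j) ^ (n - 2 * m)) ≤
      2 * (N:ℝ) ^ (n - 1) * ((Nat.log 2 N + 1 : ℕ) : ℝ) ^ deltaExp n := by
  have hNr : (1:ℝ) ≤ N := by exact_mod_cast hN
  have hle : ∀ j : ℕ, (N:ℝ) / 2 ^ j ≤ N := fun j => div_le_self (by linarith) (one_le_pow₀ (by norm_num))
  have hL1 : (1:ℝ) ≤ ((Nat.log 2 N + 1 : ℕ) : ℝ) := by push_cast; linarith [Nat.cast_nonneg (α := ℝ) (Nat.log 2 N)]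
  have hLN : ((Nat.log 2 N + 1 : ℕ) : ℝ) ≤ N := by
    have h1 : Nat.log 2 N < 2 ^ Nat.log 2 N := Nat.lt_two_pow_self
    have h2 := Nat.pow_log_le_self 2 (x := N) (by omega)
    have : Nat.log 2 N + 1 ≤ N := by omega
    exact_mod_cast this
  have hgen : ∑ j ∈ Finset.range (Nat.log 2 N + 1), ((N:ℝ) ^ m * ((N:ℝ) / 2 ^ j) ^ (n - 2 * m)) ≤
      ((Nat.log 2 N + 1 : ℕ) : ℝ) * (N:ℝ) ^ (n - m) := by
    have : ∀ j ∈ Finset.range (Nat.log 2 N + 1), ((N:ℝ) ^ m * ((N:ℝ) / 2 ^ j) ^ (n - 2 * m)) ≤ (N:ℝ) ^ (n - m) := by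
      intro j _
      calc ((N:ℝ) ^ m * ((N:ℝ) / 2 ^ j) ^ (n - 2 * m)) ≤ (N:ℝ) ^ m * (N:ℝ) ^ (n - 2 * m) := by
            gcongr; exact hle j
        _ = _ := by rw [← pow_add]; congr 1; omega
    refine (Finset.sum_le_card_nsmul _ _ _ this).trans ?_
    rw [Finset.card_range, nsmul_eq_mul]
  unfold deltaExp
  split_ifs with h2
  · obtain rfl : n = 2 := by omega
    obtain rfl : m = 1 := by omega
    refine hgen.trans ?_
    simp only [pow_one]
    norm_num
    nlinarith
  · rw [pow_zero, mul_one]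
    by_cases hm2 : m = 1
    · subst hm2
      have : ∀ j ∈ Finset.range (Nat.log 2 N + 1), ((N:ℝ) ^ 1 * ((N:ℝ) / 2 ^ j) ^ (n - 2 * 1)) ≤
          (N:ℝ) ^ (n - 1) * (1 / 2) ^ j := by
        intro j _
        have e : n - 2 * 1 = (n - 3) + 1 := by omega
        have e' : n - 1 = 1 + (n - 3) + 1 := by omega
        rw [e, e', pow_succ]
        calc (N:ℝ) ^ 1 * (((N:ℝ) / 2 ^ j) ^ (n - 3) * ((N:ℝ) / 2 ^ j)) ≤
            (N:ℝ) ^ 1 * ((N:ℝ) ^ (n - 3) * ((N:ℝ) / 2 ^ j)) := by gcongr; exact hle j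
          _ = _ := by rw [pow_add, pow_add, div_pow, one_pow]; ring
      refine (Finset.sum_le_sum this).trans ?_
      rw [← Finset.mul_sum, mul_comm 2]
      gcongr
      have := Summable.sum_le_tsum (f := fun j : ℕ => ((1:ℝ)/2) ^ j) (Finset.range (Nat.log 2 N + 1)) (fun j _ => by positivity) summable_geometric_two
      rwa [tsum_geometric_two] at this
    · refine hgen.trans ?_
      calc ((Nat.log 2 N + 1 : ℕ) : ℝ) * (N:ℝ) ^ (n - m) ≤ N * (N:ℝ) ^ (n - 2) := by
            gcongr
            omega
        _ = (N:ℝ) ^ (n - 1) := by rw [← pow_succ']; congr 1; omega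
        _ ≤ _ := by
          have : 0 ≤ (N:ℝ) ^ (n - 1) := by positivity
          linarith

lemma RedSet_card (n N : ℕ) (hn : 2 ≤ n) (hN : 1 ≤ N) : ((RedSet n N).card : ℝ) ≤
    n * (5 ^ n * (2 * (N:ℝ) ^ (n - 1) * ((Nat.log 2 N + 1 : ℕ) : ℝ) ^ deltaExp n)) := by
  have h1 : (RedSet n N).card ≤ ∑ m ∈ Finset.Icc 1 (n / 2), ∑ j ∈ Finset.range (Nat.log 2 N + 1),
      (2 * 2 ^ (j + 1) + 1) ^ m * (2 * (N / 2 ^ j) + 1) ^ (n - m) := by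
    refine Finset.card_biUnion_le.trans (Finset.sum_le_sum fun m _ => ?_)
    refine Finset.card_biUnion_le.trans (Finset.sum_le_sum fun j _ => ?_)
    refine (Finset.card_image₂_le _ _ _).trans ?_
    exact Nat.mul_le_mul (Bx_card _ _) (Bx_card _ _)
  have h2 : ((RedSet n N).card : ℝ) ≤ ∑ m ∈ Finset.Icc 1 (n / 2), ∑ j ∈ Finset.range (Nat.log 2 N + 1),
      (((2 * 2 ^ (j + 1) + 1) ^ m * (2 * (N / 2 ^ j) + 1) ^ (n - m) : ℕ) : ℝ) := by
    exact_mod_cast h1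
  refine h2.trans ?_
  have h3 : ∀ m ∈ Finset.Icc 1 (n / 2), ∑ j ∈ Finset.range (Nat.log 2 N + 1),
      (((2 * 2 ^ (j + 1) + 1) ^ m * (2 * (N / 2 ^ j) + 1) ^ (n - m) : ℕ) : ℝ) ≤
      5 ^ n * (2 * (N:ℝ) ^ (n - 1) * ((Nat.log 2 N + 1 : ℕ) : ℝ) ^ deltaExp n) := by
    intro m hm
    rw [Finset.mem_Icc] at hm
    refine (Finset.sum_le_sum fun j hj => term_bound n N m j hN (by rw [Finset.mem_range] at hj; omega) (by omega)).trans ?_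
    rw [← Finset.mul_sum]
    gcongr
    exact sum_bound n N m hn hN hm.1 (by omega)
  refine (Finset.sum_le_card_nsmul _ _ _ h3).trans ?_
  rw [nsmul_eq_mul, Nat.card_Icc]
  gcongr
  omega

lemma pc_map (n : ℕ) (z : Fin n → ℤ) :
    (pc n z).map (Int.castRingHom ℝ) = pc n (fun i => ((z i : ℤ) : ℝ)) := by
  simp [pc, Polynomial.map_sum]

lemma vol_G (n k : ℕ) (Q a b : ℝ) (hQ : 2 ≤ Q) :
    Q ^ n * (volume (GsetCount n k Q⁻¹ a b)).toReal = (volume (Sreg n k Q a b)).toReal := by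
  have hQ0 : Q ≠ 0 := by linarith
  have hset : GsetCount n k Q⁻¹ a b = (fun c => Q • c) ⁻¹' (Sreg n k Q a b) := by
    ext c
    change ((∀ i, |c i| ≤ 1) ∧ rc a b _ = k) ↔ ((∀ i, |(Q • c) i| ≤ Q) ∧ rc a b (pc n (Q • c)) = k)
    refine and_congr (forall_congr' fun i => ?_) ?_
    · rw [Pi.smul_apply, smul_eq_mul, abs_mul, abs_of_pos (by linarith : 0 < Q)]
      constructor <;> intro h <;> nlinarith
    · have : (C Q⁻¹ * X ^ n + ∑ i : Fin n, C (c i) * X ^ (i : ℕ)) = C Q⁻¹ * pc n (Q • c) := by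
        unfold pc
        rw [mul_add, Finset.mul_sum]
        congr 1
        refine Finset.sum_congr rfl fun i _ => ?_
        rw [← mul_assoc, ← C_mul, Pi.smul_apply, smul_eq_mul, inv_mul_cancel_left₀ hQ0]
      rw [this, rc, roots_C_mul _ (inv_ne_zero hQ0), rc]
  rw [hset, Measure.addHaar_preimage_smul volume hQ0, ENNReal.toReal_mul, ENNReal.toReal_ofReal (abs_nonneg _)]
  have : 0 < Q ^ n := by positivity
  simp only [Module.finrank_fin_fun]
  rw [abs_of_pos (by positivity), ← mul_assoc, mul_inv_cancel₀ this.ne', one_mul]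

lemma count_bounds (n k : ℕ) (Q a b : ℝ) (hQ : 2 ≤ Q) :
    |(Ncount n k Q a b : ℝ) - ∑ z ∈ Fintype.piFinset (fun _ : Fin n => Finset.Icc (-⌊Q⌋) ⌊Q⌋),
        (if (fun i => ((z i : ℤ) : ℝ)) ∈ Sreg n k Q a b then (1:ℝ) else 0)| ≤
      ((RedSet n ⌊4 ^ n * (n + 1) * Q⌋₊).card : ℝ) := by
  set N := ⌊4 ^ n * (n + 1) * Q⌋₊ with hN
  set Sf := (Fintype.piFinset (fun _ : Fin n => Finset.Icc (-⌊Q⌋) ⌊Q⌋)).filter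
    (fun z => (fun i => ((z i : ℤ) : ℝ)) ∈ Sreg n k Q a b) with hSf
  have hsum : ∑ z ∈ Fintype.piFinset (fun _ : Fin n => Finset.Icc (-⌊Q⌋) ⌊Q⌋),
        (if (fun i => ((z i : ℤ) : ℝ)) ∈ Sreg n k Q a b then (1:ℝ) else 0) = Sf.card := by
    rw [← Finset.sum_filter, Finset.sum_const, nsmul_eq_mul, mul_one]
  rw [hsum]
  set A := Sf.image (pc n) with hA
  have hAc : A.card = Sf.card := by
    refine Finset.card_image_of_injective _ fun z z' h => ?_
    ext i
    rw [← pc_coeff n z i, ← pc_coeff n z' i, h]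
  set I := {p : Polynomial ℤ | p.Monic ∧ p.natDegree = n ∧ (∀ i, (|p.coeff i| : ℝ) ≤ Q) ∧
    (¬ ∃ q r : Polynomial ℤ, 1 ≤ q.natDegree ∧ 1 ≤ r.natDegree ∧ p = q * r) ∧
    Multiset.countP (fun x => x ∈ Set.Ico a b)
      ((p.map (Int.castRingHom ℝ)).roots) = k} with hI
  have hNI : Ncount n k Q a b = I.ncard := rfl
  have h1 : I ⊆ (A : Set ℤ[X]) := by
    rintro p ⟨hp, hd, hc, _, hk⟩
    rw [Finset.mem_coe, hA, Finset.mem_image]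
    refine ⟨fun i => p.coeff i, ?_, (eq_pc n p hp hd).symm⟩
    rw [hSf, Finset.mem_filter, Fintype.mem_piFinset]
    refine ⟨fun i => ?_, fun i => hc i, ?_⟩
    · have := abs_le.1 (hc i)
      rw [Finset.mem_Icc]
      refine ⟨?_, Int.le_floor.2 this.2⟩
      have : -(p.coeff i) ≤ ⌊Q⌋ := Int.le_floor.2 (by push_cast; linarith [this.1])
      linarith
    · rw [← pc_map, ← eq_pc n p hp hd]; exact hk
  have h2 : (A : Set ℤ[X]) ⊆ I ∪ (RedSet n N : Set ℤ[X]) := by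
    intro p hp
    rw [Finset.mem_coe, hA, Finset.mem_image] at hp
    obtain ⟨z, hz, rfl⟩ := hp
    rw [hSf, Finset.mem_filter] at hz
    have hc : ∀ i, (|(pc n z).coeff i| : ℝ) ≤ Q := by
      intro i
      rcases lt_trichotomy i n with h | h | h
      · have := pc_coeff n z ⟨i, h⟩
        simp only at this
        rw [this]
        exact hz.2.1 ⟨i, h⟩
      · have := pc_monic n z
        rw [Monic, leadingCoeff, pc_natDegree] at this
        rw [h, this]; simp; linarith
      · rw [coeff_eq_zero_of_natDegree_lt (by rw [pc_natDegree]; exact h)]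
        simp; linarith
    by_cases hred : ∃ q r : Polynomial ℤ, 1 ≤ q.natDegree ∧ 1 ≤ r.natDegree ∧ pc n z = q * r
    · exact Or.inr (mem_RedSet n N Q _ hN (pc_monic n z) (pc_natDegree n z) hc hred)
    · refine Or.inl ⟨pc_monic n z, pc_natDegree n z, hc, hred, ?_⟩
      rw [pc_map]; exact hz.2.2
  have hIf : I.Finite := A.finite_toSet.subset h1
  have h3 : I.ncard ≤ A.card := by
    have := Set.ncard_le_ncard h1 A.finite_toSet
    rwa [Set.ncard_coe_finset] at this
  have h4 : A.card ≤ I.ncard + (RedSet n N).card := by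
    have := Set.ncard_le_ncard h2 (hIf.union (RedSet n N).finite_toSet)
    rw [Set.ncard_coe_finset] at this
    refine this.trans ((Set.ncard_union_le _ _).trans ?_)
    rw [Set.ncard_coe_finset]
  rw [hAc] at h3 h4
  rw [hNI]
  have h3' : (I.ncard : ℝ) ≤ Sf.card := by exact_mod_cast h3
  have h4' : (Sf.card : ℝ) ≤ I.ncard + (RedSet n N).card := by exact_mod_cast h4
  rw [abs_le]
  constructor <;> linarith [Nat.cast_nonneg (α := ℝ) (RedSet n N).card]

lemma log_bound (K Q : ℝ) (hK : 1 ≤ K) (hQ : 2 ≤ Q) :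
    ((Nat.log 2 ⌊K * Q⌋₊ + 1 : ℕ) : ℝ) ≤ ((Real.log K / Real.log 2 + 2) / Real.log 2) * Real.log Q := by
  have h2 : 0 < Real.log 2 := Real.log_pos (by norm_num)
  have hlQ : Real.log 2 ≤ Real.log Q := Real.log_le_log (by norm_num) hQ
  have hlK : 0 ≤ Real.log K := Real.log_nonneg hK
  have hKQ : 1 ≤ K * Q := by nlinarith
  have hN : 1 ≤ ⌊K * Q⌋₊ := Nat.le_floor (by simpa using hKQ)
  have h3 : (2:ℝ) ^ Nat.log 2 ⌊K * Q⌋₊ ≤ K * Q := by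
    have h4 := Nat.pow_log_le_self 2 (x := ⌊K * Q⌋₊) (by omega)
    have h5 : ((2 ^ Nat.log 2 ⌊K * Q⌋₊ : ℕ) : ℝ) ≤ (⌊K * Q⌋₊ : ℝ) := by exact_mod_cast h4
    push_cast at h5
    exact h5.trans (Nat.floor_le (by linarith))
  have h6 := Real.log_le_log (by positivity) h3
  rw [Real.log_pow, Real.log_mul (by linarith) (by linarith)] at h6
  push_cast
  set l := (Nat.log 2 ⌊K * Q⌋₊ : ℝ)
  rw [div_mul_eq_mul_div, le_div_iff₀ h2]
  have h7 : Real.log K ≤ Real.log K / Real.log 2 * Real.log Q := by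
    rw [div_mul_eq_mul_div, le_div_iff₀ h2]
    exact mul_le_mul_of_nonneg_left hlQ hlK
  linarith

theorem count_irreducible_monic_asymptotic (n k : ℕ) (hn : 2 ≤ n) (hk1 : 1 ≤ k)
    (hkn : k ≤ n) :
    ∃ C : ℝ, 0 < C ∧ ∀ a b : ℝ, a < b → ∀ Q : ℝ, 2 ≤ Q →
      |(Ncount n k Q a b : ℝ) - Q ^ n * (volume (GsetCount n k Q⁻¹ a b)).toReal| ≤
        C * Q ^ (n - 1) * (Real.log Q) ^ deltaExp n := by
  set K : ℝ := 4 ^ n * (n + 1) with hKdef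
  have hK : 1 ≤ K := by
    have h1 : (1:ℝ) ≤ 4 ^ n := one_le_pow₀ (by norm_num)
    have h2 : (1:ℝ) ≤ n + 1 := by linarith [Nat.cast_nonneg (α := ℝ) n]
    exact one_le_mul_of_one_le_of_one_le h1 h2
  set C1 : ℝ := (Real.log K / Real.log 2 + 2) / Real.log 2 with hC1
  have hl2 : 0 < Real.log 2 := Real.log_pos (by norm_num)
  have hC1p : 0 < C1 := by
    have : 0 ≤ Real.log K := Real.log_nonneg hK
    positivity
  have hnp : (0:ℝ) < n := by exact_mod_cast (by omega : 0 < n)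
  refine ⟨n * (2 * (3 * n + 12)) * 3 ^ (n - 1) * 2 +
    n * (5 ^ n * (2 * K ^ (n - 1) * C1 ^ deltaExp n)), by positivity, ?_⟩
  intro a b hab Q hQ
  have hlQ : Real.log 2 ≤ Real.log Q := Real.log_le_log (by norm_num) hQ
  rw [vol_G n k Q a b hQ]
  have h1 := lattice n k Q a b (by linarith) hab
  have h2 := count_bounds n k Q a b hQ
  have hKQ : 1 ≤ K * Q := by nlinarith
  have hN : 1 ≤ ⌊K * Q⌋₊ := Nat.le_floor (by simpa using hKQ)
  have h3 := RedSet_card n ⌊K * Q⌋₊ hn hN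
  have h4 := log_bound K Q hK hQ
  have h5 : (⌊K * Q⌋₊ : ℝ) ≤ K * Q := Nat.floor_le (by linarith)
  have h6 : n * (5 ^ n * (2 * (⌊K * Q⌋₊:ℝ) ^ (n - 1) * ((Nat.log 2 ⌊K * Q⌋₊ + 1 : ℕ) : ℝ) ^ deltaExp n)) ≤
      n * (5 ^ n * (2 * (K * Q) ^ (n - 1) * (C1 * Real.log Q) ^ deltaExp n)) := by
    gcongr
  have h7 : 1 ≤ 2 * Real.log Q ^ deltaExp n := by
    unfold deltaExp
    split_ifs
    · have := Real.log_two_gt_d9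
      rw [pow_one]; linarith
    · norm_num
  have h8 : (n:ℝ) * (2 * (3 * n + 12)) * (3 * Q) ^ (n - 1) ≤
      n * (2 * (3 * n + 12)) * (3 * Q) ^ (n - 1) * (2 * Real.log Q ^ deltaExp n) :=
    le_mul_of_one_le_right (by positivity) h7
  refine (abs_sub_le _ _ _).trans ((add_le_add (h2.trans (h3.trans h6)) (h1.trans h8)).trans (le_of_eq ?_))
  rw [mul_pow, mul_pow, mul_pow]
  ring
end
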